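/- Let z ∈ ℂ with |z| ≤ 1, and let c₀, M > 0 with c₀ ≤ 2/11. Suppose the Dirichlet series F(s) = ∑_{n≥1} a_n n^{−s} has nonnegative real coefficients a_n ≥ 0 and has property P(z; c₀, 1/2, M). Then there is an absolute constant C > 0 such that for all real x ≥ e^{16/c₀}: |∑_{n ≤ x} a_n − x·exp((z − 1)·log log x)·G(1)/Γ(z)| ≤ C·x·(log x)^{Re z − 1}·M·R₀(x), where G(1) is the value at s = 1 of the analytic continuation of G(s) = F(s)·exp(−z·log ζ(s)), 1/Γ(z) is interpreted as 0 when z is a nonpositive integer, and R₀(x) = c₀^{−3}·(e^{−(1/9)√(c₀ log x)} + (log x)^{−1}). -/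

import Mathlib

noncomputable section

/-- `log⁺ y = max {0, log y}`. -/
def logPlus (y : ℝ) : ℝ := max 0 (Real.log y)

/-- The region `{s = σ + iτ : σ ≥ 1 - c₀ / (1 + log⁺ |τ|)}`. -/
def sdRegion (c₀ : ℝ) : Set ℂ := {s : ℂ | 1 - c₀ / (1 + logPlus |s.im|) ≤ s.re}

/-- `log ζ(s) = ∑_{n ≥ 2} Λ(n) / (n^s log n)`, for `Re s > 1`. -/
def logZeta (s : ℂ) : ℂ :=
  ∑' n : ℕ, (ArithmeticFunction.vonMangoldt n : ℂ) / ((n : ℂ) ^ s * (Real.log n : ℂ))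

/-- The Dirichlet series `F(s) = ∑_{n ≥ 1} a_n n^{-s}`. -/
def DSeries (a : ℕ → ℂ) (s : ℂ) : ℂ := ∑' n : ℕ, a (n + 1) / ((n + 1 : ℕ) : ℂ) ^ s

/-- `G, U` witness the analytic continuation and growth bound required in property
`P(z; c₀, δ, M)` for the Dirichlet series with coefficients `a`. -/
def IsPContinuation (a : ℕ → ℂ) (z : ℂ) (c₀ δ M : ℝ) (G : ℂ → ℂ) (U : Set ℂ) : Prop :=
  IsOpen U ∧ sdRegion c₀ ⊆ U ∧ AnalyticOnNhd ℂ G U ∧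
    (∀ s : ℂ, 1 < s.re → G s = DSeries a s * Complex.exp (-z * logZeta s)) ∧
    (∀ s ∈ sdRegion c₀, ‖G s‖ ≤ M * (1 + |s.im|) ^ (1 - δ))

/-- The Dirichlet series with coefficients `a` has property `P(z; c₀, δ, M)`. -/
def HasPropertyP (a : ℕ → ℂ) (z : ℂ) (c₀ δ M : ℝ) : Prop :=
  (∀ s : ℂ, 1 < s.re → Summable fun n : ℕ => ‖a (n + 1) / ((n + 1 : ℕ) : ℂ) ^ s‖) ∧
  ∃ (G : ℂ → ℂ) (U : Set ℂ), IsPContinuation a z c₀ δ M G U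

section

open Complex Filter Topology Set MeasureTheory
open scoped FourierTransform

/-- The coefficients `Λ(n) / log n` of `log ζ`. -/
def logZetaCoeff (n : ℕ) : ℂ := (ArithmeticFunction.vonMangoldt n : ℂ) / (Real.log n : ℂ)

lemma logZeta_eq_LSeries : logZeta = LSeries logZetaCoeff := by
  ext s
  refine tsum_congr fun n => ?_
  rcases eq_or_ne n 0 with rfl | hn
  · simp
  · rw [LSeries.term_of_ne_zero hn, logZetaCoeff]
    rw [div_div, mul_comm]

lemma abscissa_logZetaCoeff_le : LSeries.abscissaOfAbsConv logZetaCoeff ≤ 1 := by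
  refine LSeries.abscissaOfAbsConv_le_of_le_const ⟨1, fun n hn => ?_⟩
  rw [logZetaCoeff, norm_div, Complex.norm_real, Complex.norm_real, Real.norm_eq_abs,
    Real.norm_eq_abs, abs_of_nonneg ArithmeticFunction.vonMangoldt_nonneg]
  have h := ArithmeticFunction.vonMangoldt_le_log (n := n)
  exact div_le_one_of_le₀ (h.trans (le_abs_self _)) (abs_nonneg _)

lemma abscissa_logZetaCoeff_lt {s : ℂ} (hs : 1 < s.re) :
    LSeries.abscissaOfAbsConv logZetaCoeff < s.re :=
  abscissa_logZetaCoeff_le.trans_lt (by exact_mod_cast hs)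

lemma hasDerivAt_logZeta {s : ℂ} (hs : 1 < s.re) :
    HasDerivAt logZeta (deriv riemannZeta s / riemannZeta s) s := by
  have h := LSeries_hasDerivAt (abscissa_logZetaCoeff_lt hs)
  have h2 : LSeries (LSeries.logMul logZetaCoeff) s =
      LSeries (fun n => (ArithmeticFunction.vonMangoldt n : ℂ)) s := by
    refine LSeries_congr (fun {n} hn => ?_) s
    simp only [LSeries.logMul, logZetaCoeff]
    rw [← Complex.ofReal_natCast, ← Complex.ofReal_log (Nat.cast_nonneg n)]
    rcases eq_or_ne n 1 with rfl | h1
    · simp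
    · have : (Real.log n : ℂ) ≠ 0 := by
        have : 1 < n := by omega
        exact_mod_cast (Real.log_pos (by exact_mod_cast this)).ne'
      field_simp
  rw [h2, ArithmeticFunction.LSeries_vonMangoldt_eq_deriv_riemannZeta_div hs] at h
  rw [logZeta_eq_LSeries]
  convert h using 1
  ring

lemma isOpen_halfPlane : IsOpen {s : ℂ | 1 < s.re} := isOpen_lt continuous_const continuous_re

lemma exp_logZeta {s : ℂ} (hs : 1 < s.re) : Complex.exp (logZeta s) = riemannZeta s := by
  have hne : ∀ w : ℂ, 1 < w.re → w ≠ 1 := fun w hw h => by simp [h] at hw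
  have hd : ∀ w : ℂ, 1 < w.re →
      HasDerivAt (fun w => Complex.exp (-logZeta w) * riemannZeta w) 0 w := by
    intro w hw
    have h1 := (hasDerivAt_logZeta hw).neg.cexp
    have h2 := (differentiableAt_riemannZeta (hne w hw)).hasDerivAt
    refine (h1.mul h2).congr_deriv ?_
    have := riemannZeta_ne_zero_of_one_le_re hw.le
    change cexp (-logZeta w) * -(deriv riemannZeta w / riemannZeta w) * riemannZeta w +
      cexp (-logZeta w) * deriv riemannZeta w = 0
    field_simp
    ring
  have hconst : ∀ w : ℂ, 1 < w.re → Complex.exp (-logZeta w) * riemannZeta w =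
      Complex.exp (-logZeta s) * riemannZeta s := by
    intro w hw
    exact (convex_halfSpace_re_gt 1).is_const_of_fderivWithin_eq_zero (𝕜 := ℂ)
      (f := fun w => Complex.exp (-logZeta w) * riemannZeta w)
      (fun x hx => (hd x hx).differentiableAt.differentiableWithinAt)
      (fun x hx => by
        rw [fderivWithin_of_isOpen isOpen_halfPlane hx, (hd x hx).hasFDerivAt.fderiv]
        ext; simp) hw hs
  have t1 : Tendsto (fun x : ℝ => logZeta x) atTop (𝓝 0) := by
    rw [logZeta_eq_LSeries]
    have := LSeries.tendsto_atTop (f := logZetaCoeff)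
      (abscissa_logZetaCoeff_le.trans_lt (by exact_mod_cast EReal.coe_lt_top 1))
    simpa [logZetaCoeff] using this
  have t2 : Tendsto (fun x : ℝ => riemannZeta x) atTop (𝓝 1) := by
    have := LSeries.tendsto_atTop (f := 1) (by
      rw [LSeries.abscissaOfAbsConv_one]; exact_mod_cast EReal.coe_lt_top 1)
    simp only [Pi.one_apply] at this
    refine this.congr' ?_
    filter_upwards [eventually_gt_atTop (1 : ℝ)] with x hx
    exact LSeries_one_eq_riemannZeta (by simpa using hx)
  have t3 : Tendsto (fun x : ℝ => Complex.exp (-logZeta x) * riemannZeta x) atTop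
      (𝓝 (Complex.exp (-0) * 1)) := (t1.neg.cexp).mul t2
  have t4 : Tendsto (fun x : ℝ => Complex.exp (-logZeta x) * riemannZeta x) atTop
      (𝓝 (Complex.exp (-logZeta s) * riemannZeta s)) := by
    refine tendsto_const_nhds.congr' ?_
    filter_upwards [eventually_gt_atTop (1 : ℝ)] with x hx
    exact (hconst x (by simpa using hx)).symm
  have := tendsto_nhds_unique t4 t3
  rw [Complex.exp_neg] at this
  have h0 := Complex.exp_ne_zero (logZeta s)
  field_simp at this
  simpa using this.symm

lemma logZeta_ofReal_im (x : ℝ) : (logZeta x).im = 0 := by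
  rw [← Complex.conj_eq_iff_im, logZeta, Complex.conj_tsum]
  refine tsum_congr fun n => ?_
  have : (n : ℂ) ^ (x : ℂ) = (((n : ℝ) ^ x : ℝ) : ℂ) := by
    rw [Complex.ofReal_cpow (Nat.cast_nonneg n)]; simp
  rw [this, map_div₀, map_mul, Complex.conj_ofReal, Complex.conj_ofReal, Complex.conj_ofReal]

/-- The terms of the series `(s - 1) ζ(s) = 1 + ∑ h_n(s)`, valid to the left of `Re s = 1`. -/
def zetaTerm (n : ℕ) (s : ℂ) : ℂ :=
  (s - 1) * ((n + 1 : ℝ) : ℂ) ^ (-s) - ((n + 1 : ℝ) : ℂ) ^ (1 - s) + ((n + 2 : ℝ) : ℂ) ^ (1 - s)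

lemma norm_cpow_neg_sub_le {s : ℂ} (hs : 0 < s.re) {a x : ℝ} (ha : 0 < a) (hx : a ≤ x) :
    ‖(a : ℂ) ^ (-s) - (x : ℂ) ^ (-s)‖ ≤ ‖s‖ * a ^ (-s.re - 1) * (x - a) := by
  have h := (convex_Icc a x).norm_image_sub_le_of_norm_hasDerivWithin_le (𝕜 := ℝ)
    (f := fun y : ℝ => (y : ℂ) ^ (-s)) (f' := fun y : ℝ => -s * (y : ℂ) ^ (-s - 1))
    (C := ‖s‖ * a ^ (-s.re - 1)) (x := a) (y := x)
    (fun y hy => (hasDerivAt_ofReal_cpow_const (ha.trans_le hy.1).ne' (by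
      intro h; simp [neg_eq_zero.mp h] at hs)).hasDerivWithinAt)
    (fun y hy => by
      have hy0 := ha.trans_le hy.1
      rw [norm_mul, norm_neg, Complex.norm_cpow_eq_rpow_re_of_pos hy0]
      simp only [sub_re, neg_re, one_re]
      exact mul_le_mul_of_nonneg_left
        (Real.rpow_le_rpow_of_nonpos ha hy.1 (by linarith)) (norm_nonneg _))
    ⟨le_rfl, hx⟩ ⟨hx, le_rfl⟩
  rw [norm_sub_rev]
  simpa [abs_of_nonneg (sub_nonneg.mpr hx)] using h

lemma norm_cpow_neg_sub_le_two {s : ℂ} (hs : 0 < s.re) {a x : ℝ} (ha : 0 < a) (hx : a ≤ x) :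
    ‖(a : ℂ) ^ (-s) - (x : ℂ) ^ (-s)‖ ≤ 2 * a ^ (-s.re) := by
  refine (norm_sub_le _ _).trans ?_
  rw [Complex.norm_cpow_eq_rpow_re_of_pos ha, Complex.norm_cpow_eq_rpow_re_of_pos
    (ha.trans_le hx), neg_re]
  have := Real.rpow_le_rpow_of_nonpos ha hx (by linarith : -s.re ≤ 0)
  linarith

lemma norm_cpow_neg_sub_le_interp {s : ℂ} (hs : 0 < s.re) {θ : ℝ} (hθ : 0 < θ) (hθ1 : θ ≤ 1)
    {a x : ℝ} (ha : 1 ≤ a) (hx : a ≤ x) (hx1 : x ≤ a + 1) :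
    ‖(a : ℂ) ^ (-s) - (x : ℂ) ^ (-s)‖ ≤ 2 * ‖s‖ ^ θ * a ^ (-s.re - θ) := by
  have ha0 : 0 < a := by linarith
  have hn : 0 < ‖s‖ := norm_pos_iff.mpr (by rintro rfl; simp at hs)
  have e : ‖s‖ ^ θ * a ^ (-s.re - θ) = (‖s‖ / a) ^ θ * a ^ (-s.re) := by
    rw [Real.div_rpow hn.le ha0.le, Real.rpow_sub ha0]; ring
  have hp : 0 < a ^ (-s.re) := Real.rpow_pos_of_pos ha0 _
  have hq : 0 ≤ (‖s‖ / a) ^ θ := by positivity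
  rw [mul_assoc, e]
  rcases le_total ‖s‖ a with h | h
  · refine (norm_cpow_neg_sub_le hs ha0 hx).trans ?_
    have h1 : ‖s‖ / a ≤ (‖s‖ / a) ^ θ := by
      conv_lhs => rw [← Real.rpow_one (‖s‖ / a)]
      exact Real.rpow_le_rpow_of_exponent_ge (by positivity) ((div_le_one ha0).mpr h) hθ1
    have h2 : ‖s‖ * a ^ (-s.re - 1) = ‖s‖ / a * a ^ (-s.re) := by
      rw [Real.rpow_sub ha0, Real.rpow_one]; ring
    rw [h2]
    have h3 : ‖s‖ / a * a ^ (-s.re) ≤ (‖s‖ / a) ^ θ * a ^ (-s.re) := by gcongr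
    have h4 : 0 ≤ ‖s‖ / a * a ^ (-s.re) := by positivity
    nlinarith
  · refine (norm_cpow_neg_sub_le_two hs ha0 hx).trans ?_
    have : 1 ≤ (‖s‖ / a) ^ θ := Real.one_le_rpow ((one_le_div ha0).mpr h) hθ.le
    nlinarith

lemma norm_zetaTerm_le {s : ℂ} (hs : 0 < s.re) {θ : ℝ} (hθ : 0 < θ) (hθ1 : θ ≤ 1) (n : ℕ) :
    ‖zetaTerm n s‖ ≤ ‖s - 1‖ * (2 * ‖s‖ ^ θ * ((n : ℝ) + 1) ^ (-s.re - θ)) := by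
  rcases eq_or_ne s 1 with rfl | h1
  · simp [zetaTerm]
  have hn : (0 : ℝ) < (n : ℝ) + 1 := by positivity
  have e1 : ∫ x in ((n : ℝ) + 1)..((n : ℝ) + 2), (x : ℂ) ^ (-s) =
      (((n + 2 : ℝ) : ℂ) ^ (1 - s) - ((n + 1 : ℝ) : ℂ) ^ (1 - s)) / (1 - s) := by
    rw [integral_cpow (Or.inr ⟨fun h => h1 (by rwa [neg_inj] at h), ?_⟩)]
    · rw [neg_add_eq_sub]
    · rw [uIcc_of_le (by linarith)]
      intro h
      linarith [h.1]
  have e : zetaTerm n s = (s - 1) * ∫ x in ((n : ℝ) + 1)..((n : ℝ) + 2),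
      (((n + 1 : ℝ) : ℂ) ^ (-s) - (x : ℂ) ^ (-s)) := by
    rw [intervalIntegral.integral_sub (by simp), e1]
    · simp only [intervalIntegral.integral_const]
      have : 1 - s ≠ 0 := sub_ne_zero.mpr h1.symm
      rw [zetaTerm]
      have e2 : ((n : ℝ) + 2 - ((n : ℝ) + 1)) = 1 := by ring
      rw [e2, one_smul]
      field_simp
      ring
    · apply ContinuousOn.intervalIntegrable
      intro x hx
      rw [uIcc_of_le (by linarith)] at hx
      apply ContinuousAt.continuousWithinAt
      exact (continuousAt_ofReal_cpow_const _ _ (Or.inr (by linarith [hx.1])))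
  rw [e, norm_mul]
  gcongr
  have := intervalIntegral.norm_integral_le_of_norm_le_const
    (a := (n : ℝ) + 1) (b := (n : ℝ) + 2)
    (f := fun x : ℝ => (((n + 1 : ℝ) : ℂ) ^ (-s) - (x : ℂ) ^ (-s)))
    (C := 2 * ‖s‖ ^ θ * ((n : ℝ) + 1) ^ (-s.re - θ)) (fun x hx => by
      rw [uIoc_of_le (by linarith)] at hx
      exact norm_cpow_neg_sub_le_interp hs hθ hθ1 (by linarith [(n.cast_nonneg : (0 : ℝ) ≤ n)])
        hx.1.le (by linarith [hx.2]))
  refine this.trans (le_of_eq ?_)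
  have e2 : ((n : ℝ) + 2 - ((n : ℝ) + 1)) = 1 := by ring
  rw [e2, abs_one, mul_one]

lemma summable_nat_add_one_rpow {p : ℝ} (hp : 1 < p) :
    Summable (fun n : ℕ => ((n : ℝ) + 1) ^ (-p)) := by
  have := (summable_nat_add_iff 1).mpr (Real.summable_nat_rpow.mpr (neg_lt_neg hp))
  simpa using this

lemma riemannZeta₁_eq {s : ℂ} (hs : s ≠ 1) : riemannZeta₁ s = (s - 1) * riemannZeta s := by
  rw [riemannZeta_eq_inv_sub_mul hs, mul_inv_cancel_left₀ (sub_ne_zero.mpr hs)]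

lemma hasSum_zetaTerm_of_one_lt {s : ℂ} (hs : 1 < s.re) :
    HasSum (fun n => zetaTerm n s) (riemannZeta₁ s - 1) := by
  have h1 : s ≠ 1 := by rintro rfl; simp at hs
  have hsum : Summable (fun n => zetaTerm n s) := by
    refine Summable.of_norm_bounded (((summable_nat_add_one_rpow
      (p := s.re + 1) (by linarith)).mul_left (2 * ‖s‖ ^ (1 : ℝ))).mul_left ‖s - 1‖) fun n => ?_
    convert norm_zetaTerm_le (by linarith) one_pos le_rfl n using 4
    ring
  have hz : HasSum (fun n : ℕ => ((n + 1 : ℝ) : ℂ) ^ (-s)) (riemannZeta s) := by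
    rw [zeta_eq_tsum_one_div_nat_add_one_cpow hs]
    have : Summable (fun n : ℕ => 1 / ((n : ℂ) + 1) ^ s) := by
      have := (summable_nat_add_iff 1).mpr (Complex.summable_one_div_nat_cpow.mpr hs)
      simpa using this
    convert this.hasSum using 2 with n
    rw [Complex.cpow_neg]; push_cast; simp
  have hz' := hz.mul_left (s - 1)
  have htel := hsum.sub hz'.summable
  have h2 : HasSum (fun n : ℕ => zetaTerm n s - (s - 1) * ((n + 1 : ℝ) : ℂ) ^ (-s)) (-1) := by
    refine (htel.hasSum_iff_tendsto_nat).mpr ?_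
    have e : ∀ N : ℕ, ∑ n ∈ Finset.range N,
        (zetaTerm n s - (s - 1) * ((n + 1 : ℝ) : ℂ) ^ (-s)) =
        ((N + 1 : ℝ) : ℂ) ^ (1 - s) - 1 := by
      intro N
      induction N with
      | zero => simp
      | succ N ih =>
        rw [Finset.sum_range_succ, ih, zetaTerm]
        push_cast
        have : (N : ℂ) + 1 + 1 = N + 2 := by ring
        rw [this]
        ring
    simp_rw [e]
    have : Tendsto (fun N : ℕ => ((N + 1 : ℝ) : ℂ) ^ (1 - s)) atTop (𝓝 0) := by
      rw [tendsto_zero_iff_norm_tendsto_zero]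
      have hn : ∀ N : ℕ, ‖((N + 1 : ℝ) : ℂ) ^ (1 - s)‖ = ((N : ℝ) + 1) ^ (-(s.re - 1)) := by
        intro N
        rw [Complex.norm_cpow_eq_rpow_re_of_pos (by positivity)]
        simp
      simp_rw [hn]
      exact (tendsto_rpow_neg_atTop (by linarith)).comp
        (tendsto_atTop_add_const_right _ _ tendsto_natCast_atTop_atTop)
    simpa using this.sub_const 1
  have := h2.add hz'
  rw [riemannZeta₁_eq h1]
  convert this using 1
  · ext n; ring
  · ring

lemma differentiable_zetaTerm (n : ℕ) : Differentiable ℂ (zetaTerm n) := by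
  have h1 : ((n + 1 : ℝ) : ℂ) ≠ 0 := by exact_mod_cast (by positivity : (n : ℝ) + 1 ≠ 0)
  have h2 : ((n + 2 : ℝ) : ℂ) ≠ 0 := by exact_mod_cast (by positivity : (n : ℝ) + 2 ≠ 0)
  intro s
  unfold zetaTerm
  have a1 : DifferentiableAt ℂ (fun s : ℂ => ((n + 1 : ℝ) : ℂ) ^ (-s)) s :=
    (differentiableAt_id.neg).const_cpow (Or.inl h1)
  have a2 : DifferentiableAt ℂ (fun s : ℂ => ((n + 1 : ℝ) : ℂ) ^ (1 - s)) s :=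
    (differentiableAt_id.const_sub 1).const_cpow (Or.inl h1)
  have a3 : DifferentiableAt ℂ (fun s : ℂ => ((n + 2 : ℝ) : ℂ) ^ (1 - s)) s :=
    (differentiableAt_id.const_sub 1).const_cpow (Or.inl h2)
  exact (((differentiableAt_id.sub_const 1).mul a1).sub a2).add a3

lemma riemannZeta₁_eq_tsum {s : ℂ} (hs : 199 / 200 < s.re) :
    riemannZeta₁ s = 1 + ∑' n, zetaTerm n s := by
  set R := ‖s‖ + 3
  let V : Set ℂ := {w : ℂ | 199 / 200 < w.re} ∩ Metric.ball 0 R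
  have hVo : IsOpen V := (isOpen_lt continuous_const continuous_re).inter Metric.isOpen_ball
  have hVc : Convex ℝ V := (convex_halfSpace_re_gt _).inter (convex_ball _ _)
  have hd : DifferentiableOn ℂ (fun w => 1 + ∑' n, zetaTerm n w) V := by
    refine (DifferentiableOn.const_add (c := (1 : ℂ)) ?_)
    refine Complex.differentiableOn_tsum_of_summable_norm
      (u := fun n : ℕ => (R + 1) * (2 * R ^ (1 / 100 : ℝ) * ((n : ℝ) + 1) ^ (-(201 / 200 : ℝ))))
      ?_ (fun n => (differentiable_zetaTerm n).differentiableOn) hVo ?_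
    · exact ((summable_nat_add_one_rpow (by norm_num)).mul_left _).mul_left _
    · intro n w hw
      have hw2 : ‖w‖ < R := by simpa using hw.2
      have hw1 : 199 / 200 < w.re := hw.1
      refine (norm_zetaTerm_le (by linarith) (θ := 1 / 100) (by norm_num)
        (by norm_num) n).trans ?_
      have : ‖w - 1‖ ≤ R + 1 := (norm_sub_le _ _).trans (by simp; linarith)
      gcongr
      · linarith [(n.cast_nonneg : (0 : ℝ) ≤ n)]
      · linarith
  have h2 : (2 : ℂ) ∈ V := by
    refine ⟨by norm_num, ?_⟩
    simp only [Metric.mem_ball, dist_zero_right, Complex.norm_ofNat, R]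
    linarith [norm_nonneg s]
  have key := (differentiable_riemannZeta₁.differentiableOn.analyticOnNhd
    hVo).eqOn_of_preconnected_of_eventuallyEq (hd.analyticOnNhd hVo) hVc.isPreconnected h2 (by
      filter_upwards [isOpen_halfPlane.mem_nhds (by norm_num : (1 : ℝ) < (2 : ℂ).re)] with w hw
      rw [(hasSum_zetaTerm_of_one_lt hw).tsum_eq]; ring)
  exact key ⟨hs, by simp [R]⟩

/-- `(s - 1) ζ(s)` is of order at most `|s|^{1 + 1/100}` for `Re s > 199/200`. -/
lemma exists_norm_riemannZeta₁_le : ∃ K : ℝ, 0 < K ∧ ∀ s : ℂ, 199 / 200 < s.re →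
    ‖riemannZeta₁ s‖ ≤ K * (1 + ‖s - 1‖ * ‖s‖ ^ (1 / 100 : ℝ)) := by
  have hS := summable_nat_add_one_rpow (p := 201 / 200) (by norm_num)
  set S := ∑' n : ℕ, ((n : ℝ) + 1) ^ (-(201 / 200 : ℝ)) with hSdef
  have hS0 : 0 ≤ S := tsum_nonneg fun n => by positivity
  refine ⟨1 + 2 * S, by linarith, fun s hs => ?_⟩
  rw [riemannZeta₁_eq_tsum hs]
  have hb : ‖∑' n, zetaTerm n s‖ ≤ ‖s - 1‖ * (2 * ‖s‖ ^ (1 / 100 : ℝ)) * S := by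
    refine tsum_of_norm_bounded (hS.hasSum.mul_left (‖s - 1‖ * (2 * ‖s‖ ^ (1 / 100 : ℝ))))
      fun n => ?_
    refine (norm_zetaTerm_le (by linarith) (θ := 1 / 100) (by norm_num)
        (by norm_num) n).trans ?_
    rw [mul_assoc ‖s - 1‖]
    gcongr
    · linarith [(n.cast_nonneg : (0 : ℝ) ≤ n)]
    · linarith
  refine (norm_add_le _ _).trans ?_
  rw [norm_one]
  have : 0 ≤ ‖s - 1‖ * ‖s‖ ^ (1 / 100 : ℝ) := by positivity
  nlinarith

lemma riemannZeta_product_ge_one {x : ℝ} (hx : 0 < x) (y : ℝ) :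
    1 ≤ ‖riemannZeta (1 + x)‖ ^ 3 * ‖riemannZeta (1 + x + I * y)‖ ^ 4 *
      ‖riemannZeta (1 + x + 2 * I * y)‖ := by
  have h := DirichletCharacter.norm_LFunction_product_ge_one (N := 1) 1 hx y
  have e : DirichletCharacter.LFunctionTrivChar 1 = riemannZeta := by
    rw [DirichletCharacter.LFunctionTrivChar, DirichletCharacter.LFunction_modOne_eq]
  rw [e, DirichletCharacter.LFunction_modOne_eq, DirichletCharacter.LFunction_modOne_eq] at h
  simpa [norm_mul, norm_pow] using h

lemma exists_norm_riemannZeta₁_le_im : ∃ K : ℝ, 0 < K ∧ ∀ s : ℂ, 199 / 200 < s.re → s.re ≤ 4 →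
    ‖riemannZeta₁ s‖ ≤ K * (1 + |s.im|) ^ (101 / 100 : ℝ) := by
  obtain ⟨K, hK, h⟩ := exists_norm_riemannZeta₁_le
  refine ⟨K * (1 + 16), by positivity, fun s hs hs' => (h s hs).trans ?_⟩
  set T := 1 + |s.im|
  have hT : 1 ≤ T := by simp [T]
  have h1 : ‖s - 1‖ ≤ 4 * T := by
    refine (Complex.norm_le_abs_re_add_abs_im _).trans ?_
    simp only [sub_re, one_re, sub_im, one_im, sub_zero]
    have : |s.re - 1| ≤ 3 := abs_le.mpr ⟨by linarith, by linarith⟩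
    simp only [T]
    linarith [abs_nonneg s.im]
  have h2 : ‖s‖ ≤ 4 * T := by
    refine (Complex.norm_le_abs_re_add_abs_im _).trans ?_
    have : |s.re| ≤ 4 := abs_le.mpr ⟨by linarith, by linarith⟩
    simp only [T]
    linarith [abs_nonneg s.im]
  have h3 : ‖s‖ ^ (1 / 100 : ℝ) ≤ 4 * T ^ (1 / 100 : ℝ) := by
    calc ‖s‖ ^ (1 / 100 : ℝ) ≤ (4 * T) ^ (1 / 100 : ℝ) := by gcongr
      _ = 4 ^ (1 / 100 : ℝ) * T ^ (1 / 100 : ℝ) := Real.mul_rpow (by norm_num) (by linarith)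
      _ ≤ 4 ^ (1 : ℝ) * T ^ (1 / 100 : ℝ) := by
          gcongr <;> norm_num
      _ = _ := by rw [Real.rpow_one]
  have e : T ^ (101 / 100 : ℝ) = T * T ^ (1 / 100 : ℝ) := by
    rw [show (101 / 100 : ℝ) = 1 + 1 / 100 by norm_num, Real.rpow_add (by linarith), Real.rpow_one]
  have h4 : ‖s - 1‖ * ‖s‖ ^ (1 / 100 : ℝ) ≤ 16 * T ^ (101 / 100 : ℝ) := by
    calc ‖s - 1‖ * ‖s‖ ^ (1 / 100 : ℝ) ≤ (4 * T) * (4 * T ^ (1 / 100 : ℝ)) := by gcongr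
      _ = _ := by rw [e]; ring
  have h5 : 1 ≤ T ^ (101 / 100 : ℝ) := Real.one_le_rpow hT (by norm_num)
  rw [mul_assoc]
  gcongr
  linarith

/-- `(s - 1) ζ(s)` is Lipschitz near `1 ≤ Re s ≤ 2`, with a constant of order `|s|^{1 + 1/100}`. -/
lemma exists_norm_riemannZeta₁_sub_le : ∃ K : ℝ, 0 < K ∧ ∀ s w : ℂ, 1 ≤ s.re → s.re ≤ 2 →
    ‖w - s‖ ≤ 1 / 400 →
    ‖riemannZeta₁ w - riemannZeta₁ s‖ ≤ K * (1 + |s.im|) ^ (101 / 100 : ℝ) * ‖w - s‖ := by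
  obtain ⟨K, hK, h⟩ := exists_norm_riemannZeta₁_le_im
  refine ⟨400 * (K * 2 ^ (101 / 100 : ℝ)), by positivity, fun s w hs hs' hw => ?_⟩
  set T := 1 + |s.im| with hTdef
  have hT : 1 ≤ T := by simp [T]
  have hder : ∀ v ∈ Metric.closedBall s (1 / 400), ‖deriv riemannZeta₁ v‖ ≤
      400 * (K * 2 ^ (101 / 100 : ℝ)) * T ^ (101 / 100 : ℝ) := by
    intro v hv
    have := Complex.norm_deriv_le_of_forall_mem_sphere_norm_le (c := v) (R := 1 / 400)
      (C := K * 2 ^ (101 / 100 : ℝ) * T ^ (101 / 100 : ℝ)) (f := riemannZeta₁) (by norm_num)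
      differentiable_riemannZeta₁.diffContOnCl (fun u hu => ?_)
    · refine this.trans (le_of_eq ?_); ring
    · have hus : ‖u - s‖ ≤ 1 / 200 := by
        have h1 : ‖u - v‖ = 1 / 400 := by simpa [dist_eq_norm] using hu
        have h2 : ‖v - s‖ ≤ 1 / 400 := by simpa [dist_eq_norm] using hv
        calc ‖u - s‖ = ‖(u - v) + (v - s)‖ := by ring_nf
          _ ≤ _ := (norm_add_le _ _).trans (by linarith)
      have hre := (Complex.abs_re_le_norm (u - s)).trans hus
      have him := (Complex.abs_im_le_norm (u - s)).trans hus
      rw [sub_re] at hre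
      rw [sub_im] at him
      have hre' := abs_le.mp hre
      have him2 : |u.im| ≤ |s.im| + 1 / 200 := by
        have := abs_add_le (u.im - s.im) s.im
        simp only [sub_add_cancel] at this
        linarith
      have hcont : ‖riemannZeta₁ u‖ ≤ K * (1 + |u.im|) ^ (101 / 100 : ℝ) := by
        rcases lt_or_eq_of_le (show 199 / 200 ≤ u.re by linarith) with hlt | heq
        · exact h u hlt (by linarith)
        · have ht : Tendsto (fun x : ℝ => u + x) (𝓝[>] 0) (𝓝 (u + (0 : ℝ))) := by
            have : Continuous (fun x : ℝ => u + x) := by fun_prop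
            exact this.continuousAt.tendsto.mono_left nhdsWithin_le_nhds
          rw [ofReal_zero, add_zero] at ht
          refine le_of_tendsto ((differentiable_riemannZeta₁.continuous.tendsto u).comp ht).norm ?_
          filter_upwards [Ioo_mem_nhdsGT (zero_lt_one (α := ℝ))] with x hx
          have := h (u + x) (by simp only [add_re, ofReal_re]; linarith [hx.1])
            (by simp only [add_re, ofReal_re]; linarith [hx.2])
          simpa using this
      refine hcont.trans ?_
      rw [mul_assoc, ← Real.mul_rpow (by norm_num) (by linarith)]
      gcongr
      simp only [hTdef]
      linarith [abs_nonneg s.im]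
  have := (convex_closedBall s (1 / 400)).norm_image_sub_le_of_norm_deriv_le
    (fun v _ => differentiable_riemannZeta₁ v) hder (x := s) (y := w) (by simp)
    (by simpa [dist_eq_norm] using hw)
  exact this

lemma riemannZeta₁_ne_zero_of_one_le_re {s : ℂ} (hs : 1 ≤ s.re) : riemannZeta₁ s ≠ 0 := by
  rcases eq_or_ne s 1 with rfl | h
  · simp
  · rw [riemannZeta₁_eq h]
    exact mul_ne_zero (sub_ne_zero.mpr h) (riemannZeta_ne_zero_of_one_le_re hs)

lemma exists_le_norm_riemannZeta₁_of_abs_im_le_one : ∃ k : ℝ, 0 < k ∧ ∀ s : ℂ, 1 ≤ s.re →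
    s.re ≤ 2 → |s.im| ≤ 1 → k ≤ ‖riemannZeta₁ s‖ := by
  have hc : IsCompact (Icc (1 : ℝ) 2 ×ℂ Icc (-1 : ℝ) 1) := isCompact_Icc.reProdIm isCompact_Icc
  have hne : (Icc (1 : ℝ) 2 ×ℂ Icc (-1 : ℝ) 1).Nonempty :=
    ⟨1, by simp [mem_reProdIm]⟩
  obtain ⟨s₀, hs₀, hmin⟩ := hc.exists_isMinOn hne
    (differentiable_riemannZeta₁.continuous.norm.continuousOn)
  refine ⟨‖riemannZeta₁ s₀‖, norm_pos_iff.mpr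
    (riemannZeta₁_ne_zero_of_one_le_re (mem_reProdIm.mp hs₀).1.1), fun s h1 h2 h3 => ?_⟩
  exact hmin (mem_reProdIm.mpr ⟨⟨h1, h2⟩, abs_le.mp h3⟩)

/-- The fourth-power lower bound for `(s - 1) ζ(s)` given by the `3-4-1` inequality. -/
lemma exists_le_norm_riemannZeta₁_pow_four : ∃ c : ℝ, 0 < c ∧ ∀ (x t : ℝ), 0 < x → x ≤ 1 →
    1 ≤ |t| → c * x ^ 3 * (1 + |t|) ^ (4 - 1 / 100 : ℝ) ≤ ‖riemannZeta₁ (1 + x + I * t)‖ ^ 4 := by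
  obtain ⟨K, hK, h⟩ := exists_norm_riemannZeta₁_le_im
  refine ⟨1 / (K ^ 4 * 2 ^ (101 / 100 : ℝ) * 32), by positivity, fun x t hx hx1 ht => ?_⟩
  set T := 1 + |t| with hTdef
  have hT : 0 < T := by positivity
  have hprod := riemannZeta_product_ge_one hx t
  have b1 : x * ‖riemannZeta (1 + x)‖ ≤ K := by
    have h1 := h (1 + x) (by simp; linarith) (by simp; linarith)
    rw [riemannZeta₁_eq (by
      intro h0
      have := congrArg re h0
      simp at this
      exact hx.ne' this)] at h1
    simpa [abs_of_pos hx] using h1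
  have b2 : |t| * ‖riemannZeta (1 + x + 2 * I * t)‖ ≤ K * 2 ^ (101 / 100 : ℝ) * T ^ (101 / 100 : ℝ) := by
    have h1 := h (1 + x + 2 * I * t) (by simp; linarith) (by simp; linarith)
    rw [riemannZeta₁_eq (by
      intro h0
      have := congrArg re h0
      simp at this
      exact hx.ne' this), norm_mul] at h1
    have h2 : |t| ≤ ‖1 + (x : ℂ) + 2 * I * t - 1‖ := by
      refine le_trans ?_ (Complex.abs_im_le_norm _)
      simp [abs_mul]
      linarith [abs_nonneg t]
    have h3 : (1 + |(1 + (x : ℂ) + 2 * I * t).im|) ^ (101 / 100 : ℝ) ≤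
        2 ^ (101 / 100 : ℝ) * T ^ (101 / 100 : ℝ) := by
      rw [← Real.mul_rpow (by norm_num) hT.le]
      gcongr
      simp [abs_mul, hTdef]
      linarith [abs_nonneg t]
    calc |t| * ‖riemannZeta (1 + x + 2 * I * t)‖
        ≤ ‖1 + (x : ℂ) + 2 * I * t - 1‖ * ‖riemannZeta (1 + x + 2 * I * t)‖ := by gcongr
      _ ≤ K * (1 + |(1 + (x : ℂ) + 2 * I * t).im|) ^ (101 / 100 : ℝ) := h1
      _ ≤ K * (2 ^ (101 / 100 : ℝ) * T ^ (101 / 100 : ℝ)) := by gcongr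
      _ = _ := by ring
  have b3 : |t| * ‖riemannZeta (1 + x + I * t)‖ ≤ ‖riemannZeta₁ (1 + x + I * t)‖ := by
    rw [riemannZeta₁_eq (by
      intro h0
      have := congrArg re h0
      simp at this
      exact hx.ne' this), norm_mul]
    gcongr
    refine le_trans ?_ (Complex.abs_im_le_norm _)
    simp
  set A := ‖riemannZeta (1 + x)‖
  set B := ‖riemannZeta (1 + x + I * t)‖
  set D := ‖riemannZeta (1 + x + 2 * I * t)‖
  set E := ‖riemannZeta₁ (1 + x + I * t)‖
  have hA : 0 ≤ A := norm_nonneg _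
  have hB : 0 ≤ B := norm_nonneg _
  have hD : 0 ≤ D := norm_nonneg _
  have main : x ^ 3 * |t| ^ 5 ≤ K ^ 3 * E ^ 4 * (K * 2 ^ (101 / 100 : ℝ) * T ^ (101 / 100 : ℝ)) := by
    calc x ^ 3 * |t| ^ 5 ≤ x ^ 3 * |t| ^ 5 * (A ^ 3 * B ^ 4 * D) := by
          exact le_mul_of_one_le_right (by positivity) hprod
      _ = (x * A) ^ 3 * (|t| * B) ^ 4 * (|t| * D) := by ring
      _ ≤ K ^ 3 * E ^ 4 * (K * 2 ^ (101 / 100 : ℝ) * T ^ (101 / 100 : ℝ)) := by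
          gcongr
  have hTt : T ≤ 2 * |t| := by simp only [hTdef]; linarith
  have hT5 : T ^ 5 ≤ 32 * |t| ^ 5 := by
    calc T ^ 5 ≤ (2 * |t|) ^ 5 := by gcongr
      _ = _ := by ring
  have e : T ^ (4 - 1 / 100 : ℝ) * T ^ (101 / 100 : ℝ) = T ^ 5 := by
    rw [← Real.rpow_add hT, ← Real.rpow_natCast]
    norm_num
  have hp : 0 < T ^ (101 / 100 : ℝ) := by positivity
  refine le_of_mul_le_mul_right ?_ hp
  rw [mul_assoc, e]
  have h2p : (0 : ℝ) < 2 ^ (101 / 100 : ℝ) := by positivity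
  rw [div_mul_eq_mul_div, one_mul, div_mul_eq_mul_div, div_le_iff₀ (by positivity)]
  calc x ^ 3 * T ^ 5 ≤ x ^ 3 * (32 * |t| ^ 5) := by gcongr
    _ = 32 * (x ^ 3 * |t| ^ 5) := by ring
    _ ≤ 32 * (K ^ 3 * E ^ 4 * (K * 2 ^ (101 / 100 : ℝ) * T ^ (101 / 100 : ℝ))) := by gcongr
    _ = _ := by ring

/-- Lower bound for `(s - 1) ζ(s)` on `1 < Re s ≤ 2`. -/
lemma exists_le_norm_riemannZeta₁ : ∃ k : ℝ, 0 < k ∧ ∀ s : ℂ, 1 < s.re → s.re ≤ 2 →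
    k * (1 + |s.im|) ^ (24 / 25 : ℝ) ≤ ‖riemannZeta₁ s‖ := by
  obtain ⟨k₀, hk₀, hcomp⟩ := exists_le_norm_riemannZeta₁_of_abs_im_le_one
  obtain ⟨c, hc, h4⟩ := exists_le_norm_riemannZeta₁_pow_four
  obtain ⟨K, hK, hlip⟩ := exists_norm_riemannZeta₁_sub_le
  obtain ⟨d, hd, hdc⟩ : ∃ d : ℝ, 0 < d ∧ d ^ 4 = c :=
    ⟨c ^ (1 / 4 : ℝ), by positivity, by
      rw [← Real.rpow_natCast, ← Real.rpow_mul hc.le]; norm_num⟩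
  set l := min (1 / 400) (d / (2 * K)) with hl
  have hl0 : 0 < l := by positivity
  have hl1 : l ≤ 1 / 400 := min_le_left _ _
  have hl2 : 2 * K * l ≤ d := by
    have := min_le_right (1 / 400) (d / (2 * K))
    rw [← hl, le_div_iff₀ (by positivity)] at this
    linarith
  refine ⟨min (k₀ / 2) (d * l ^ 3 / 2), by positivity, fun s hs hs2 => ?_⟩
  set T := 1 + |s.im| with hTdef
  have hT : 1 ≤ T := by simp [T]
  have hT0 : 0 < T := by linarith
  rcases le_total |s.im| 1 with ht | ht
  · refine le_trans ?_ (hcomp s hs.le hs2 ht)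
    have h1 : T ^ (24 / 25 : ℝ) ≤ 2 := by
      calc T ^ (24 / 25 : ℝ) ≤ T ^ (1 : ℝ) := by gcongr; norm_num
        _ ≤ 2 := by rw [Real.rpow_one]; simp only [hTdef]; linarith
    calc min (k₀ / 2) (d * l ^ 3 / 2) * T ^ (24 / 25 : ℝ) ≤ (k₀ / 2) * 2 := by
          gcongr; exact min_le_left _ _
      _ = k₀ := by ring
  · refine le_trans (mul_le_mul_of_nonneg_right (min_le_right _ _) (by positivity)) ?_
    set x₁ := l ^ 4 * T ^ (-(1 / 20) : ℝ) with hx₁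
    have hx₁0 : 0 < x₁ := by positivity
    have hTm : T ^ (-(1 / 20) : ℝ) ≤ 1 := Real.rpow_le_one_of_one_le_of_nonpos hT (by norm_num)
    have hl4 : l ^ 4 ≤ 1 / 400 := by
      calc l ^ 4 ≤ l ^ 1 := pow_le_pow_of_le_one hl0.le (by linarith) (by norm_num)
        _ ≤ _ := by simpa using hl1
    have hx₁1 : x₁ ≤ 1 / 400 := by
      calc x₁ ≤ 1 / 400 * 1 := by rw [hx₁]; gcongr
        _ = _ := by ring
    have far : ∀ x : ℝ, x₁ ≤ x → x ≤ 1 →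
        d * l ^ 3 * T ^ (24 / 25 : ℝ) ≤ ‖riemannZeta₁ (1 + x + I * s.im)‖ := by
      intro x hx hx1
      have h := h4 x s.im (hx₁0.trans_le hx) hx1 ht
      refine le_of_pow_le_pow_left₀ (n := 4) (by norm_num) (norm_nonneg _) (le_trans ?_ h)
      have e : (d * l ^ 3 * T ^ (24 / 25 : ℝ)) ^ 4 = c * x₁ ^ 3 * T ^ (4 - 1 / 100 : ℝ) := by
        have e1 : (T ^ (24 / 25 : ℝ)) ^ 4 = (T ^ (-(1 / 20) : ℝ)) ^ 3 * T ^ (4 - 1 / 100 : ℝ) := by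
          rw [← Real.rpow_natCast (T ^ (24 / 25 : ℝ)), ← Real.rpow_natCast (T ^ (-(1 / 20) : ℝ)),
            ← Real.rpow_mul hT0.le, ← Real.rpow_mul hT0.le, ← Real.rpow_add hT0]
          norm_num
        rw [hx₁, mul_pow, e1, ← hdc]
        ring
      rw [e]
      gcongr
    have es : s = 1 + ((s.re - 1 : ℝ) : ℂ) + I * s.im := by
      apply Complex.ext <;> simp
    have hpos : 0 < d * l ^ 3 * T ^ (24 / 25 : ℝ) := by positivity
    rcases le_total x₁ (s.re - 1) with hx | hx
    · have := far (s.re - 1) hx (by linarith)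
      rw [← es] at this
      linarith
    · have h1 := far x₁ le_rfl (by linarith)
      set w : ℂ := 1 + x₁ + I * s.im with hw
      have hnorm : ‖w - s‖ ≤ x₁ := by
        have : w - s = ((x₁ - (s.re - 1) : ℝ) : ℂ) := by
          apply Complex.ext <;> simp [hw]
          ring
        rw [this, Complex.norm_real, Real.norm_eq_abs, abs_of_nonneg (by linarith)]
        linarith
      have h2 := hlip s w hs.le hs2 (hnorm.trans hx₁1)
      have h3 : K * T ^ (101 / 100 : ℝ) * ‖w - s‖ ≤ d * l ^ 3 * T ^ (24 / 25 : ℝ) / 2 := by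
        calc K * T ^ (101 / 100 : ℝ) * ‖w - s‖ ≤ K * T ^ (101 / 100 : ℝ) * x₁ := by gcongr
          _ = (2 * K * l) * l ^ 3 * (T ^ (101 / 100 : ℝ) * T ^ (-(1 / 20) : ℝ)) / 2 := by
              rw [hx₁]; ring
          _ = (2 * K * l) * l ^ 3 * T ^ (24 / 25 : ℝ) / 2 := by
              rw [← Real.rpow_add hT0]; norm_num
          _ ≤ _ := by gcongr
      have h5 := norm_sub_norm_le (riemannZeta₁ w) (riemannZeta₁ s)
      linarith

/-- Away from `s = 1`, on discs of radius `κ (1 + |Im s|)^{-1/20}` the function `ζ` is of slow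
growth and is close to its value at the centre. -/
lemma exists_riemannZeta_disc {c : ℝ} (hc : 0 < c) (hc1 : c ≤ 1) : ∃ κ K : ℝ, 0 < κ ∧ κ ≤ c / 40 ∧
    0 < K ∧ ∀ s : ℂ, 1 < s.re → s.re ≤ 2 → c ≤ ‖s - 1‖ → ∀ w : ℂ,
      ‖w - s‖ ≤ κ * (1 + |s.im|) ^ (-(1 / 20) : ℝ) →
      ‖riemannZeta w / riemannZeta s - 1‖ ≤ 1 / 2 ∧
      ‖riemannZeta w‖ ≤ K * (1 + |s.im|) ^ (1 / 100 : ℝ) := by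
  obtain ⟨k, hk, hlow⟩ := exists_le_norm_riemannZeta₁
  obtain ⟨K, hK, hlip⟩ := exists_norm_riemannZeta₁_sub_le
  obtain ⟨K', hK', hup⟩ := exists_norm_riemannZeta₁_le_im
  refine ⟨min (1 / 400) (min (c / 40) (k / (10 * K))), (2 * K') * (4 / c), by positivity,
    (min_le_right _ _).trans (min_le_left _ _), by positivity, fun s hs hs2 hcs w hw => ?_⟩
  set κ := min (1 / 400) (min (c / 40) (k / (10 * K))) with hκ
  have hκ0 : 0 < κ := by positivity
  have hκ1 : κ ≤ 1 / 400 := min_le_left _ _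
  have hκ2 : κ ≤ c / 40 := (min_le_right _ _).trans (min_le_left _ _)
  have hκ3 : 10 * K * κ ≤ k := by
    have : κ ≤ k / (10 * K) := (min_le_right _ _).trans (min_le_right _ _)
    rw [le_div_iff₀ (by positivity)] at this
    linarith
  set T := 1 + |s.im| with hTdef
  have hT : 1 ≤ T := by simp [T]
  have hT0 : 0 < T := by linarith
  have hTm : T ^ (-(1 / 20) : ℝ) ≤ 1 := Real.rpow_le_one_of_one_le_of_nonpos hT (by norm_num)
  have hwκ : ‖w - s‖ ≤ κ := hw.trans (by
    calc κ * T ^ (-(1 / 20) : ℝ) ≤ κ * 1 := by gcongr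
      _ = κ := mul_one _)
  have hs1 : s ≠ 1 := by rintro rfl; simp at hs
  have hsT : c * T / 2 ≤ ‖s - 1‖ := by
    have h1 : |s.im| ≤ ‖s - 1‖ := by simpa using Complex.abs_im_le_norm (s - 1)
    have h2 : c * |s.im| ≤ |s.im| := mul_le_of_le_one_left (abs_nonneg _) hc1
    simp only [hTdef]
    linarith
  have hw1 : ‖s - 1‖ * (39 / 40) ≤ ‖w - 1‖ := by
    have h1 := norm_sub_norm_le (s - 1) (s - w)
    rw [show s - 1 - (s - w) = w - 1 by ring, norm_sub_rev s w] at h1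
    linarith
  have hs1p : 0 < ‖s - 1‖ := by linarith
  have hw1p : 0 < ‖w - 1‖ := lt_of_lt_of_le (by positivity) hw1
  have hwne : w ≠ 1 := by rintro rfl; simp at hw1p
  have hhs : riemannZeta₁ s ≠ 0 := riemannZeta₁_ne_zero_of_one_le_re hs.le
  have hα : ‖riemannZeta₁ w / riemannZeta₁ s - 1‖ ≤ 1 / 10 := by
    rw [div_sub_one hhs, norm_div, div_le_iff₀ (norm_pos_iff.mpr hhs)]
    calc ‖riemannZeta₁ w - riemannZeta₁ s‖ ≤ K * T ^ (101 / 100 : ℝ) * ‖w - s‖ :=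
          hlip s w hs.le hs2 (hwκ.trans hκ1)
      _ ≤ K * T ^ (101 / 100 : ℝ) * (κ * T ^ (-(1 / 20) : ℝ)) := by gcongr
      _ = (10 * K * κ) / 10 * (T ^ (101 / 100 : ℝ) * T ^ (-(1 / 20) : ℝ)) := by ring
      _ = (10 * K * κ) / 10 * T ^ (24 / 25 : ℝ) := by rw [← Real.rpow_add hT0]; norm_num
      _ ≤ k / 10 * T ^ (24 / 25 : ℝ) := by gcongr
      _ = 1 / 10 * (k * T ^ (24 / 25 : ℝ)) := by ring
      _ ≤ _ := by gcongr; exact hlow s hs hs2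
  have hβ : ‖(s - 1) / (w - 1) - 1‖ ≤ 1 / 10 := by
    rw [div_sub_one (sub_ne_zero.mpr hwne), norm_div, div_le_iff₀ hw1p,
      show s - 1 - (w - 1) = s - w by ring, norm_sub_rev]
    linarith
  constructor
  · have e : riemannZeta w / riemannZeta s - 1 =
        (riemannZeta₁ w / riemannZeta₁ s - 1) * ((s - 1) / (w - 1) - 1) +
        (riemannZeta₁ w / riemannZeta₁ s - 1) + ((s - 1) / (w - 1) - 1) := by
      rw [riemannZeta_eq_inv_sub_mul hwne, riemannZeta_eq_inv_sub_mul hs1]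
      have := sub_ne_zero.mpr hwne
      have := sub_ne_zero.mpr hs1
      field_simp
      ring
    rw [e]
    refine (norm_add_le _ _).trans ?_
    have h1 := norm_add_le ((riemannZeta₁ w / riemannZeta₁ s - 1) * ((s - 1) / (w - 1) - 1))
      (riemannZeta₁ w / riemannZeta₁ s - 1)
    rw [norm_mul] at h1
    have h2 : ‖riemannZeta₁ w / riemannZeta₁ s - 1‖ * ‖(s - 1) / (w - 1) - 1‖ ≤
      1 / 10 * (1 / 10) := by gcongr
    linarith
  · have h1 : ‖riemannZeta₁ w‖ ≤ 2 * ‖riemannZeta₁ s‖ := by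
      have h2 := norm_add_le (riemannZeta₁ w / riemannZeta₁ s - 1) 1
      rw [sub_add_cancel, norm_div, norm_one] at h2
      have h3 : ‖riemannZeta₁ w‖ / ‖riemannZeta₁ s‖ ≤ 2 := by linarith
      rwa [div_le_iff₀ (norm_pos_iff.mpr hhs)] at h3
    have h2 := hup s (by linarith) (by linarith)
    rw [riemannZeta_eq_inv_sub_mul hwne, norm_mul, norm_inv, inv_mul_le_iff₀ hw1p]
    have h3 : c * T / 4 ≤ ‖w - 1‖ := by linarith
    calc ‖riemannZeta₁ w‖ ≤ 2 * (K' * T ^ (101 / 100 : ℝ)) := h1.trans (by gcongr)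
      _ = (c * T / 4) * ((2 * K') * (4 / c) * T ^ (1 / 100 : ℝ)) := by
          rw [show (101 / 100 : ℝ) = 1 + 1 / 100 by norm_num, Real.rpow_add hT0, Real.rpow_one]
          field_simp
      _ ≤ _ := by gcongr

lemma norm_exp_logZeta_re {σ : ℝ} (hσ : 1 < σ) :
    Real.exp (logZeta σ).re = ‖riemannZeta σ‖ := by
  rw [← exp_logZeta (by simpa using hσ), Complex.norm_exp]

lemma tendsto_logZeta_re : Tendsto (fun σ : ℝ => (logZeta σ).re) (𝓝[>] 1) atTop := by
  have h1 : Tendsto (fun σ : ℝ => ‖riemannZeta₁ σ‖ * (σ - 1)⁻¹) (𝓝[>] 1) atTop := by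
    apply Tendsto.pos_mul_atTop (C := 1) one_pos
    · have : ContinuousAt (fun σ : ℝ => ‖riemannZeta₁ σ‖) 1 := by
        have := differentiable_riemannZeta₁.continuous
        fun_prop
      have h := this.tendsto
      simp only [ofReal_one, riemannZeta₁_one, norm_one] at h
      exact h.mono_left nhdsWithin_le_nhds
    · apply Tendsto.comp tendsto_inv_nhdsGT_zero
      apply tendsto_nhdsWithin_iff.2 ⟨?_, ?_⟩
      · have : Tendsto (fun σ : ℝ => σ - 1) (𝓝 1) (𝓝 0) := by
          have : ContinuousAt (fun σ : ℝ => σ - 1) 1 := by fun_prop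
          simpa using this.tendsto
        exact this.mono_left nhdsWithin_le_nhds
      · filter_upwards [self_mem_nhdsWithin] with σ hσ
        simpa using hσ
  have h2 := Real.tendsto_log_atTop.comp h1
  refine h2.congr' ?_
  filter_upwards [self_mem_nhdsWithin] with σ hσ
  have hσ' : (1 : ℝ) < σ := hσ
  have hne : (σ : ℂ) ≠ 1 := by exact_mod_cast hσ'.ne'
  simp only [Function.comp]
  rw [riemannZeta₁_eq hne, norm_mul, ← norm_exp_logZeta_re hσ', mul_comm ‖_‖, mul_assoc]
  have : ‖(σ : ℂ) - 1‖ = σ - 1 := by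
    rw [← ofReal_one, ← ofReal_sub, norm_real, Real.norm_eq_abs, abs_of_pos (by linarith)]
  rw [this, mul_inv_cancel₀ (by linarith), mul_one, Real.log_exp]

lemma DSeries_ofReal_ge {a : ℕ → ℝ} (ha : ∀ n, 0 ≤ a n)
    (hsum : ∀ s : ℂ, 1 < s.re → Summable fun n : ℕ => ‖(a (n + 1) : ℂ) / ((n + 1 : ℕ) : ℂ) ^ s‖)
    (N : ℕ) {σ : ℝ} (hσ : 1 < σ) (hσ2 : σ ≤ 2) :
    ∃ f : ℝ, DSeries (fun n => (a n : ℂ)) σ = f ∧ a (N + 1) / ((N + 1 : ℕ) : ℝ) ^ (2 : ℝ) ≤ f := by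
  have h := hsum σ (by simpa using hσ)
  have e : ∀ n : ℕ, (a (n + 1) : ℂ) / ((n + 1 : ℕ) : ℂ) ^ (σ : ℂ)
      = ((a (n + 1) / ((n + 1 : ℕ) : ℝ) ^ σ : ℝ) : ℂ) := by
    intro n
    rw [ofReal_div, ofReal_cpow (by positivity)]
    simp
  have hs : Summable fun n : ℕ => a (n + 1) / ((n + 1 : ℕ) : ℝ) ^ σ := by
    refine h.congr fun n => ?_
    rw [e n, norm_real, Real.norm_eq_abs, abs_of_nonneg]
    have := ha (n + 1)
    positivity
  refine ⟨∑' n : ℕ, a (n + 1) / ((n + 1 : ℕ) : ℝ) ^ σ, ?_, ?_⟩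
  · unfold DSeries
    rw [ofReal_tsum]
    exact tsum_congr e
  · refine le_trans ?_ (hs.le_tsum N fun n _ => ?_)
    · have := ha (N + 1)
      gcongr
      simp
    · have := ha (n + 1)
      positivity

/-- If the Dirichlet series has nonnegative coefficients, not all zero, then the exponent `z`
is a nonnegative real number. -/
lemma exponent_nonneg {a : ℕ → ℝ} (ha : ∀ n, 0 ≤ a n)
    (hsum : ∀ s : ℂ, 1 < s.re → Summable fun n : ℕ => ‖(a (n + 1) : ℂ) / ((n + 1 : ℕ) : ℂ) ^ s‖)
    {N : ℕ} (hN : a (N + 1) ≠ 0) {z : ℂ} {G : ℂ → ℂ} (hG : AnalyticAt ℂ G 1)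
    (hGF : ∀ s : ℂ, 1 < s.re → G s = DSeries (fun n => (a n : ℂ)) s * cexp (-z * logZeta s)) :
    0 ≤ z.re ∧ z.im = 0 := by
  set η : ℝ := a (N + 1) / ((N + 1 : ℕ) : ℝ) ^ (2 : ℝ) with hη
  have hη0 : 0 < η := by
    have := (ha (N + 1)).lt_of_ne' hN
    positivity
  set l : ℝ → ℝ := fun σ => (logZeta σ).re with hl
  have hlz : ∀ σ : ℝ, logZeta σ = l σ := fun σ => by
    apply Complex.ext <;> simp [hl, logZeta_ofReal_im]
  have near : ∀ᶠ σ : ℝ in 𝓝[>] 1, 1 < σ ∧ σ ≤ 2 := by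
    filter_upwards [self_mem_nhdsWithin, nhdsWithin_le_nhds (Iic_mem_nhds (show (1:ℝ) < 2 by norm_num))]
      with σ h1 h2 using ⟨h1, h2⟩
  have tcoe : Tendsto (fun σ : ℝ => (σ : ℂ)) (𝓝[>] 1) (𝓝 1) := by
    have : ContinuousAt (fun σ : ℝ => (σ : ℂ)) 1 := by fun_prop
    have h := this.tendsto
    rw [ofReal_one] at h
    exact h.mono_left nhdsWithin_le_nhds
  constructor
  · by_contra! hz
    have h1 : Tendsto (fun σ : ℝ => ‖G σ‖) (𝓝[>] 1) (𝓝 ‖G 1‖) :=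
      (hG.continuousAt.tendsto.comp tcoe).norm
    have h2 : Tendsto (fun σ : ℝ => η * Real.exp (-z.re * l σ)) (𝓝[>] 1) atTop :=
      Tendsto.const_mul_atTop hη0 (Real.tendsto_exp_atTop.comp
        (tendsto_logZeta_re.const_mul_atTop (by linarith)))
    refine not_tendsto_atTop_of_tendsto_nhds h1 (tendsto_atTop_mono' _ ?_ h2)
    filter_upwards [near] with σ hσ
    obtain ⟨f, hf, hfη⟩ := DSeries_ofReal_ge ha hsum N hσ.1 hσ.2
    rw [hGF σ (by simpa using hσ.1), hf, norm_mul, norm_exp, hlz, norm_real]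
    simp only [neg_mul, neg_re, mul_re, ofReal_re, ofReal_im, mul_zero, sub_zero]
    gcongr
    exact hfη.trans (le_abs_self _)
  · by_contra hy
    have hne : ¬ ∀ᶠ s in 𝓝 1, G s = 0 := by
      intro h
      have h' := (tcoe.eventually h).and near
      obtain ⟨σ, hσ0, hσ⟩ := h'.exists
      obtain ⟨f, hf, hfη⟩ := DSeries_ofReal_ge ha hsum N hσ.1 hσ.2
      rw [hGF σ (by simpa using hσ.1), hf, mul_eq_zero] at hσ0
      rcases hσ0 with h0 | h0
      · have : f = 0 := by exact_mod_cast h0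
        linarith
      · exact Complex.exp_ne_zero _ h0
    obtain ⟨m, g, hg, hg1, hGg⟩ := hG.exists_eventuallyEq_pow_smul_nonzero_iff.2 hne
    have h1 : Tendsto (fun σ : ℝ => g σ / (‖g σ‖ : ℂ)) (𝓝[>] 1) (𝓝 (g 1 / (‖g 1‖ : ℂ))) := by
      have t := hg.continuousAt.tendsto.comp tcoe
      refine t.div ?_ (by simpa using hg1)
      exact (continuous_ofReal.tendsto _).comp t.norm
    have h2 : ∀ᶠ σ : ℝ in 𝓝[>] 1, g σ / (‖g σ‖ : ℂ) = cexp (-(z.im * l σ : ℝ) * I) := by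
      filter_upwards [near, tcoe.eventually hGg] with σ hσ hG'
      obtain ⟨f, hf, hfη⟩ := DSeries_ofReal_ge ha hsum N hσ.1 hσ.2
      have hf0 : 0 < f := hη0.trans_le hfη
      have hp : 0 < (σ - 1) ^ m := pow_pos (by linarith [hσ.1]) m
      rw [hGF σ (by simpa using hσ.1), hf, hlz] at hG'
      have e1 : cexp (-z * l σ) = (Real.exp (-z.re * l σ) : ℝ) * cexp (-(z.im * l σ : ℝ) * I) := by
        rw [ofReal_exp, ← Complex.exp_add]
        congr 1
        apply Complex.ext <;> simp
      have e2 : g σ = ((f * Real.exp (-z.re * l σ) / (σ - 1) ^ m : ℝ) : ℂ) *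
          cexp (-(z.im * l σ : ℝ) * I) := by
        have hp' : ((σ : ℂ) - 1) ^ m ≠ 0 := by exact_mod_cast hp.ne'
        rw [smul_eq_mul, e1] at hG'
        push_cast at hG' ⊢
        field_simp
        rw [mul_comm (g _), ← hG']
        ring_nf
      have hq : 0 < f * Real.exp (-z.re * l σ) / (σ - 1) ^ m := by positivity
      set q := f * Real.exp (-z.re * l σ) / (σ - 1) ^ m
      have e3 : ‖g σ‖ = q := by
        rw [e2, norm_mul, norm_real, Real.norm_eq_abs, abs_of_pos hq, ← ofReal_neg,
          norm_exp_ofReal_mul_I, mul_one]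
      rw [e3, e2]
      have : (q : ℂ) ≠ 0 := by exact_mod_cast hq.ne'
      field_simp
    have h3 := h1.congr' h2
    set u := g 1 / (‖g 1‖ : ℂ)
    have h4 := (h3.eventually (Metric.ball_mem_nhds u one_pos)).and near
    obtain ⟨σ₁, hσ₁, hb⟩ := mem_nhdsGT_iff_exists_Ioc_subset.1 h4
    have hσ₁' : (1 : ℝ) < σ₁ := hσ₁
    have hcont : ContinuousOn l (Ioc 1 σ₁) := by
      intro σ hσ
      have hd := (hasDerivAt_logZeta (s := (σ : ℂ)) (by simpa using hσ.1)).continuousAt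
      have hd' : ContinuousAt (fun σ : ℝ => logZeta σ) σ :=
        ContinuousAt.comp (f := fun σ : ℝ => (σ : ℂ)) hd (by fun_prop)
      exact (continuous_re.continuousAt.comp hd').continuousWithinAt
    have hivt : Ici (l σ₁) ⊆ l '' Ioc 1 σ₁ :=
      isPreconnected_Ioc.intermediate_value_Ici (l := 𝓝[>] 1) (right_mem_Ioc.2 hσ₁')
        (by simpa using Ioc_mem_nhdsGT hσ₁') hcont tendsto_logZeta_re
    obtain ⟨σ₂, hσ₂, e₂⟩ := hivt (show l σ₁ + Real.pi / |z.im| ∈ Ici (l σ₁) from by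
      simp only [mem_Ici, le_add_iff_nonneg_right]; positivity)
    have b1 := (hb (right_mem_Ioc.2 hσ₁')).1
    have b2 := (hb hσ₂).1
    have e5 : cexp (-(z.im * l σ₂ : ℝ) * I) = - cexp (-(z.im * l σ₁ : ℝ) * I) := by
      rw [e₂]
      rcases lt_or_gt_of_ne hy with h | h
      · rw [abs_of_neg h, mul_add, show z.im * (Real.pi / -z.im) = -Real.pi by field_simp]
        push_cast
        rw [neg_add, add_mul, Complex.exp_add, neg_neg, exp_pi_mul_I]
        ring
      · rw [abs_of_pos h, mul_add, show z.im * (Real.pi / z.im) = Real.pi by field_simp]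
        push_cast
        rw [neg_add, add_mul, Complex.exp_add, neg_mul (Real.pi : ℂ), Complex.exp_neg, exp_pi_mul_I]
        norm_num
    rw [e5] at b2
    have hn : ‖cexp (-(z.im * l σ₁ : ℝ) * I)‖ = 1 := by
      rw [← ofReal_neg, norm_exp_ofReal_mul_I]
    set v := cexp (-(z.im * l σ₁ : ℝ) * I)
    rw [dist_eq_norm] at b1 b2
    have : ‖(v - u) - (-v - u)‖ = 2 := by
      rw [show (v - u) - (-v - u) = 2 * v by ring, norm_mul, hn]; norm_num
    have := norm_sub_le (v - u) (-v - u)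
    linarith

lemma one_add_sq_le_norm_mul {σ : ℝ} (hσ : 1 ≤ σ) (t : ℝ) :
    1 + t ^ 2 ≤ ‖((σ : ℂ) + t * I) * ((σ : ℂ) + t * I + 1)‖ := by
  have h1 : 1 + t ^ 2 ≤ ‖(σ : ℂ) + t * I‖ ^ 2 := by
    rw [← normSq_eq_norm_sq, normSq_add_mul_I]; nlinarith
  have h2 : ‖(σ : ℂ) + t * I‖ ≤ ‖(σ : ℂ) + t * I + 1‖ := by
    apply le_of_sq_le_sq _ (norm_nonneg _)
    rw [← normSq_eq_norm_sq, ← normSq_eq_norm_sq, normSq_apply, normSq_apply]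
    simp
    nlinarith
  rw [norm_mul]
  nlinarith [norm_nonneg ((σ : ℂ) + t * I)]

lemma ofReal_add_mul_I_ne_zero {σ : ℝ} (hσ : 1 ≤ σ) (t : ℝ) :
    (σ : ℂ) + t * I ≠ 0 ∧ (σ : ℂ) + t * I + 1 ≠ 0 := by
  have h := one_add_sq_le_norm_mul hσ t
  have : 0 < ‖((σ : ℂ) + t * I) * ((σ : ℂ) + t * I + 1)‖ := by nlinarith [sq_nonneg t]
  rw [norm_pos_iff] at this
  exact ⟨left_ne_zero_of_mul this, right_ne_zero_of_mul this⟩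

lemma integrable_perronKernel {σ : ℝ} (hσ : 1 ≤ σ) :
    Integrable fun t : ℝ => 1 / (((σ : ℂ) + t * I) * ((σ : ℂ) + t * I + 1)) := by
  refine integrable_inv_one_add_sq.mono' ?_ (ae_of_all _ fun t => ?_)
  · apply Continuous.aestronglyMeasurable
    apply Continuous.div (by fun_prop) (by fun_prop)
    intro t
    have := ofReal_add_mul_I_ne_zero hσ t
    exact mul_ne_zero this.1 this.2
  · rw [norm_div, norm_one, one_div]
    exact inv_anti₀ (by positivity) (one_add_sq_le_norm_mul hσ t)

/-- Mellin inversion for `t ↦ max 0 (1 - t)`. -/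
lemma integral_perronKernel {σ : ℝ} (hσ : 1 ≤ σ) {x : ℝ} (hx : 0 < x) :
    (1 / (2 * Real.pi) : ℝ) * ∫ t : ℝ, (x : ℂ) ^ ((σ : ℂ) + t * I) *
      (1 / (((σ : ℂ) + t * I) * ((σ : ℂ) + t * I + 1))) = (max 0 (1 - x⁻¹) : ℝ) := by
  set f : ℝ → ℂ := fun t => indicator (Ioc 0 1) (fun _ => 1 : ℝ → ℂ) t -
    indicator (Ioc 0 1) (fun t => (t : ℂ) ^ (1 : ℂ) : ℝ → ℂ) t with hf
  have hm : ∀ s : ℂ, 1 ≤ s.re → HasMellin f s (1 / s - 1 / (s + 1)) := by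
    intro s hs
    have h1 := hasMellin_one_Ioc (s := s) (by linarith)
    have h2 := hasMellin_cpow_Ioc 1 (s := s) (by simp; linarith)
    have h := hasMellin_sub h1.1 h2.1
    rw [h1.2, h2.2] at h
    exact h
  have hms : ∀ t : ℝ, mellin f ((σ : ℂ) + t * I) =
      1 / (((σ : ℂ) + t * I) * ((σ : ℂ) + t * I + 1)) := by
    intro t
    rw [(hm _ (by simpa using hσ)).2]
    have := ofReal_add_mul_I_ne_zero hσ t
    have h1 := this.1
    have h2 := this.2
    field_simp
    ring
  have hfmax : ∀ t : ℝ, 0 < t → f t = (max 0 (1 - t) : ℝ) := by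
    intro t ht
    by_cases h : t ≤ 1
    · simp [hf, ht, h]
    · simp [hf, h]
      rw [max_eq_left (by linarith)]
      simp
  have hc : ContinuousAt f x⁻¹ := by
    have : ContinuousAt (fun t : ℝ => ((max 0 (1 - t) : ℝ) : ℂ)) x⁻¹ := by fun_prop
    refine this.congr ?_
    filter_upwards [Ioi_mem_nhds (inv_pos.2 hx)] with t ht
    exact (hfmax t ht).symm
  have hv : VerticalIntegrable (mellin f) σ := by
    unfold VerticalIntegrable
    simp_rw [hms]
    exact integrable_perronKernel hσ
  have h := mellinInv_mellin_eq σ f (inv_pos.2 hx) (hm _ (by simpa using hσ)).1 hv hc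
  rw [hfmax _ (inv_pos.2 hx), mellinInv] at h
  rw [← h, Complex.real_smul]
  congr 1
  refine integral_congr_ae (ae_of_all _ fun t => ?_)
  simp only [smul_eq_mul, hms]
  rw [ofReal_inv, inv_cpow _ _ (by rw [arg_ofReal_of_nonneg hx.le]; exact Real.pi_pos.ne),
    cpow_neg, inv_inv]

/-- The weighted partial sum `∑_{n ≤ x} a_n (x - n)`. -/
def rieszSum (a : ℕ → ℝ) (x : ℝ) : ℝ := ∑' n : ℕ, a (n + 1) * max 0 (x - (n + 1 : ℕ))

lemma summable_rieszSum (a : ℕ → ℝ) (x : ℝ) :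
    Summable fun n : ℕ => a (n + 1) * max 0 (x - (n + 1 : ℕ)) := by
  refine summable_of_ne_finset_zero (s := Finset.range ⌈x⌉₊) fun n hn => ?_
  have h1 : ⌈x⌉₊ ≤ n := by simpa using hn
  have h2 : x ≤ n := (Nat.le_ceil x).trans (by exact_mod_cast h1)
  rw [max_eq_left (by push_cast; linarith), mul_zero]

/-- Subgradient inequality for the convex function `rieszSum a`. -/
lemma sub_mul_sum_le_rieszSum_sub {a : ℕ → ℝ} (ha : ∀ n, 0 ≤ a n) {x : ℝ} (hx : 0 ≤ x) (y : ℝ) :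
    (y - x) * ∑ n ∈ Finset.Icc 1 ⌊x⌋₊, a n ≤ rieszSum a y - rieszSum a x := by
  have e : ∑ n ∈ Finset.Icc 1 ⌊x⌋₊, a n = ∑ n ∈ Finset.range ⌊x⌋₊, a (n + 1) := by
    rw [Finset.range_eq_Ico, Finset.sum_Ico_add' a 0 ⌊x⌋₊ 1]
    rfl
  unfold rieszSum
  rw [e, Finset.mul_sum, ← (summable_rieszSum a y).tsum_sub (summable_rieszSum a x)]
  have hs := (summable_rieszSum a y).sub (summable_rieszSum a x)
  have key : ∀ n : ℕ, (if n ∈ Finset.range ⌊x⌋₊ then (y - x) * a (n + 1) else 0) ≤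
      a (n + 1) * max 0 (y - (n + 1 : ℕ)) - a (n + 1) * max 0 (x - (n + 1 : ℕ)) := by
    intro n
    have ha' := ha (n + 1)
    split_ifs with h
    · have h1 : ((n + 1 : ℕ) : ℝ) ≤ x := by
        rw [← Nat.le_floor_iff hx]
        exact Finset.mem_range.1 h
      rw [max_eq_right (by linarith : (0:ℝ) ≤ x - (n + 1 : ℕ))]
      nlinarith [le_max_right 0 (y - (n + 1 : ℕ))]
    · have h1 : x < ((n + 1 : ℕ) : ℝ) := by
        rw [← Nat.floor_lt hx]
        have : ⌊x⌋₊ ≤ n := by simpa using h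
        omega
      rw [max_eq_left (by linarith : x - (n + 1 : ℕ) ≤ (0:ℝ)), mul_zero, sub_zero]
      exact mul_nonneg ha' (le_max_left _ _)
  have h1 : ∑' n : ℕ, (if n ∈ Finset.range ⌊x⌋₊ then (y - x) * a (n + 1) else 0) =
      ∑ n ∈ Finset.range ⌊x⌋₊, (y - x) * a (n + 1) := by
    rw [tsum_eq_sum (s := Finset.range ⌊x⌋₊)]
    · exact Finset.sum_congr rfl fun n hn => by simp only [hn, if_true]
    · intro n hn; simp only [hn, if_false]
  rw [← h1]
  exact Summable.tsum_le_tsum key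
    (summable_of_ne_finset_zero (s := Finset.range ⌊x⌋₊) fun n hn => by simp only [hn, if_false]) hs

lemma norm_natCast_add_one_cpow (n : ℕ) (s : ℂ) :
    ‖((n + 1 : ℕ) : ℂ) ^ s‖ = ((n + 1 : ℕ) : ℝ) ^ s.re :=
  norm_natCast_cpow_of_pos n.succ_pos s

/-- Absolutely convergent Perron formula for `rieszSum`. -/
lemma integral_DSeries_mul_cpow {a : ℕ → ℝ}
    (hsum : ∀ s : ℂ, 1 < s.re → Summable fun n : ℕ => ‖(a (n + 1) : ℂ) / ((n + 1 : ℕ) : ℂ) ^ s‖)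
    {σ : ℝ} (hσ : 1 < σ) {x : ℝ} (hx : 0 < x) :
    (1 / (2 * Real.pi) : ℝ) * ∫ t : ℝ, DSeries (fun n => (a n : ℂ)) ((σ : ℂ) + t * I) *
      (x : ℂ) ^ ((σ : ℂ) + t * I) * (1 / (((σ : ℂ) + t * I) * ((σ : ℂ) + t * I + 1))) =
      (rieszSum a x / x : ℝ) := by
  set k : ℝ → ℂ := fun t => 1 / (((σ : ℂ) + t * I) * ((σ : ℂ) + t * I + 1)) with hk
  have hkint : Integrable k := integrable_perronKernel hσ.le
  set f : ℕ → ℝ → ℂ := fun n t =>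
    (a (n + 1) : ℂ) * (((x / (n + 1 : ℕ) : ℝ) : ℂ) ^ ((σ : ℂ) + t * I) * k t) with hf
  have hxn : ∀ n : ℕ, 0 < x / (n + 1 : ℕ) := fun n => by positivity
  have hnorm : ∀ n t, ‖f n t‖ = (‖(a (n + 1) : ℂ) / ((n + 1 : ℕ) : ℂ) ^ (σ : ℂ)‖ * x ^ σ) * ‖k t‖ := by
    intro n t
    rw [hf]
    simp only
    rw [norm_mul, norm_mul, norm_cpow_eq_rpow_re_of_pos (hxn n), norm_div (a (n + 1) : ℂ),
      norm_natCast_add_one_cpow]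
    simp only [add_re, ofReal_re, mul_re, I_re, mul_zero, ofReal_im, I_im, mul_one, sub_self,
      add_zero]
    rw [Real.div_rpow hx.le (by positivity)]
    ring
  have hcpow : ∀ n : ℕ, Continuous fun t : ℝ => ((x / (n + 1 : ℕ) : ℝ) : ℂ) ^ ((σ : ℂ) + t * I) := by
    intro n
    apply Continuous.const_cpow (by fun_prop)
    left
    exact_mod_cast (hxn n).ne'
  have hInt : ∀ n, Integrable (f n) := by
    intro n
    refine (hkint.norm.const_mul (‖(a (n + 1) : ℂ) / ((n + 1 : ℕ) : ℂ) ^ (σ : ℂ)‖ * x ^ σ)).mono' ?_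
      (ae_of_all _ fun t => (hnorm n t).le)
    exact (((hcpow n).aestronglyMeasurable).mul hkint.1).const_mul _
  have hsn : Summable fun n => ∫ t, ‖f n t‖ := by
    simp_rw [hnorm, integral_const_mul]
    exact ((hsum σ (by simpa using hσ)).mul_right _).mul_right _
  have h := (hasSum_integral_of_summable_integral_norm hInt hsn).mul_left
    (((1 / (2 * Real.pi) : ℝ)) : ℂ)
  have e1 : ∀ n : ℕ, (((1 / (2 * Real.pi) : ℝ)) : ℂ) * ∫ t, f n t =
      ((a (n + 1) * max 0 (x - (n + 1 : ℕ)) / x : ℝ) : ℂ) := by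
    intro n
    rw [hf]
    simp only
    rw [integral_const_mul, mul_left_comm, hk, integral_perronKernel hσ.le (hxn n), ← ofReal_mul]
    congr 1
    rw [mul_div_assoc]
    congr 1
    rw [inv_div, ← max_div_div_right hx.le, zero_div, sub_div, div_self hx.ne']
  have e2 : ∀ t, ∑' n, f n t = DSeries (fun n => (a n : ℂ)) ((σ : ℂ) + t * I) *
      (x : ℂ) ^ ((σ : ℂ) + t * I) * k t := by
    intro t
    unfold DSeries
    rw [mul_assoc, ← tsum_mul_right]
    refine tsum_congr fun n => ?_
    rw [hf]
    simp only
    rw [ofReal_div, div_cpow_ofReal_nonneg hx.le (by positivity)]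
    push_cast
    ring
  simp_rw [e1, e2] at h
  rw [← h.tsum_eq, ← ofReal_tsum, rieszSum, tsum_div_const]

lemma integrableOn_rpow_mul_exp_neg {p b : ℝ} (hp : -1 < p) (hb : 0 < b) :
    IntegrableOn (fun t : ℝ => t ^ p * Real.exp (-(b * t))) (Ioi 0) := by
  have := integrableOn_rpow_mul_exp_neg_mul_rpow (s := p) (p := 1) hp one_pos hb
  simpa using this

lemma norm_cpow_mul_cexp {t : ℝ} (ht : 0 < t) (p : ℝ) (r : ℂ) :
    ‖(t : ℂ) ^ (p : ℂ) * cexp (-(r * t))‖ = t ^ p * Real.exp (-(r.re * t)) := by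
  rw [norm_mul, norm_cpow_eq_rpow_re_of_pos ht, norm_exp]
  simp

lemma continuousOn_cpow_mul_cexp (p : ℝ) (r : ℂ) :
    ContinuousOn (fun t : ℝ => (t : ℂ) ^ (p : ℂ) * cexp (-(r * t))) (Ioi 0) := by
  intro t ht
  apply ContinuousAt.continuousWithinAt
  apply ContinuousAt.mul _ (by fun_prop)
  exact continuousAt_ofReal_cpow_const _ _ (Or.inr (ne_of_gt ht))

lemma integrableOn_cpow_mul_cexp {p : ℝ} (hp : -1 < p) {r : ℂ} (hr : 0 < r.re) :
    IntegrableOn (fun t : ℝ => (t : ℂ) ^ (p : ℂ) * cexp (-(r * t))) (Ioi 0) := by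
  refine (integrableOn_rpow_mul_exp_neg hp hr).mono'
    ((continuousOn_cpow_mul_cexp p r).aestronglyMeasurable measurableSet_Ioi) ?_
  exact (ae_restrict_mem measurableSet_Ioi).mono fun t ht => (norm_cpow_mul_cexp ht p r).le

lemma differentiableAt_integral_cpow_mul_cexp {p : ℝ} (hp : -1 < p) {r : ℂ} (hr : 0 < r.re) :
    DifferentiableAt ℂ
      (fun r : ℂ => ∫ t : ℝ in Ioi 0, (t : ℂ) ^ (p : ℂ) * cexp (-(r * t))) r := by
  have hmem : {w : ℂ | r.re / 2 < w.re} ∈ 𝓝 r :=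
    (isOpen_lt continuous_const continuous_re).mem_nhds (by simp; linarith)
  have h := hasDerivAt_integral_of_dominated_loc_of_deriv_le (μ := volume.restrict (Ioi 0))
    (F := fun (r : ℂ) (t : ℝ) => (t : ℂ) ^ (p : ℂ) * cexp (-(r * t)))
    (F' := fun (r : ℂ) (t : ℝ) => (t : ℂ) ^ (p : ℂ) * (cexp (-(r * t)) * (-(t : ℂ))))
    (x₀ := r) (s := {w : ℂ | r.re / 2 < w.re})
    (bound := fun t : ℝ => t ^ (p + 1) * Real.exp (-(r.re / 2 * t))) hmem ?_ ?_ ?_ ?_ ?_ ?_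
  · exact h.2.differentiableAt
  · exact Eventually.of_forall fun w =>
      (continuousOn_cpow_mul_cexp p w).aestronglyMeasurable measurableSet_Ioi
  · exact integrableOn_cpow_mul_cexp hp hr
  · have h1 : ContinuousOn (fun t : ℝ => ((t : ℂ) ^ (p : ℂ) * cexp (-(r * t))) * (-(t : ℂ))) (Ioi 0) :=
      (continuousOn_cpow_mul_cexp p r).mul (by fun_prop)
    simp only [← mul_assoc]
    exact h1.aestronglyMeasurable measurableSet_Ioi
  · refine (ae_restrict_mem measurableSet_Ioi).mono fun t ht w hw => ?_
    have ht0 : (0 : ℝ) < t := ht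
    rw [← mul_assoc, norm_mul, norm_cpow_mul_cexp ht0, norm_neg, norm_real, Real.norm_eq_abs,
      abs_of_pos ht0, Real.rpow_add_one ht0.ne']
    have h1 : Real.exp (-(w.re * t)) ≤ Real.exp (-(r.re / 2 * t)) := by
      apply Real.exp_le_exp.2
      have : r.re / 2 < w.re := hw
      nlinarith
    have h2 : 0 ≤ t ^ p * t := by positivity
    nlinarith
  · exact integrableOn_rpow_mul_exp_neg (by linarith) (by linarith)
  · refine ae_of_all _ fun t w _ => ?_
    have h1 : HasDerivAt (fun r : ℂ => -(r * (t : ℂ))) (-(t : ℂ)) w := by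
      simpa using ((hasDerivAt_id' w).mul_const (t : ℂ)).fun_neg
    exact h1.cexp.const_mul _

/-- The Gamma integral with complex scale parameter. -/
lemma integral_cpow_mul_cexp {z : ℝ} (hz : 0 < z) {r : ℂ} (hr : 0 < r.re) :
    ∫ t : ℝ in Ioi 0, (t : ℂ) ^ ((z - 1 : ℝ) : ℂ) * cexp (-(r * t)) =
      r ^ (-(z : ℂ)) * Real.Gamma z := by
  have hopen : IsOpen {w : ℂ | 0 < w.re} := isOpen_lt continuous_const continuous_re
  have h1 : AnalyticOnNhd ℂ
      (fun r : ℂ => ∫ t : ℝ in Ioi 0, (t : ℂ) ^ ((z - 1 : ℝ) : ℂ) * cexp (-(r * t)))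
      {w : ℂ | 0 < w.re} :=
    DifferentiableOn.analyticOnNhd (fun w hw => (differentiableAt_integral_cpow_mul_cexp
      (by linarith) hw).differentiableWithinAt) hopen
  have h2 : AnalyticOnNhd ℂ (fun r : ℂ => r ^ (-(z : ℂ)) * Real.Gamma z) {w : ℂ | 0 < w.re} := by
    refine DifferentiableOn.analyticOnNhd (fun w hw => ?_) hopen
    apply DifferentiableAt.differentiableWithinAt
    exact (differentiableAt_id.cpow_const (Or.inl hw)).mul_const _
  have hconn : IsPreconnected {w : ℂ | 0 < w.re} :=
    (convex_halfSpace_re_gt 0).isPreconnected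
  refine h1.eqOn_of_preconnected_of_frequently_eq h2 hconn (z₀ := 1) (by simp) ?_ hr
  have hreal : ∀ x : ℝ, 0 < x → ∫ t : ℝ in Ioi 0, (t : ℂ) ^ ((z - 1 : ℝ) : ℂ) * cexp (-((x : ℂ) * t)) =
      (x : ℂ) ^ (-(z : ℂ)) * Real.Gamma z := by
    intro x hx
    have h := integral_cpow_mul_exp_neg_mul_Ioi (a := (z : ℂ)) (by simpa using hz) hx
    rw [Gamma_ofReal] at h
    push_cast
    rw [h, one_div, inv_cpow _ _ (by rw [arg_ofReal_of_nonneg hx.le]; exact Real.pi_pos.ne),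
      cpow_neg]
  have t1 : Tendsto (fun n : ℕ => ((1 + 1 / ((n : ℝ) + 1) : ℝ) : ℂ)) atTop (𝓝[≠] 1) := by
    apply tendsto_nhdsWithin_iff.2 ⟨?_, ?_⟩
    · have := (tendsto_one_div_add_atTop_nhds_zero_nat (𝕜 := ℝ)).const_add 1
      have := (continuous_ofReal.tendsto _).comp this
      simpa [Function.comp_def] using this
    · refine Eventually.of_forall fun n => ?_
      simp only [mem_compl_iff, mem_singleton_iff]
      have : (1 + 1 / ((n : ℝ) + 1) : ℝ) ≠ 1 := by
        have : (0:ℝ) < 1 / ((n : ℝ) + 1) := by positivity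
        linarith
      exact_mod_cast this
  refine t1.frequently (Frequently.of_forall fun n => ?_)
  exact hreal _ (by positivity)

/-- The comparison function `(s - 1)^{-z} - 2 s^{-z} + (s + 1)^{-z}`. -/
def modelSeries (z : ℝ) (s : ℂ) : ℂ :=
  (s - 1) ^ (-(z : ℂ)) - 2 * s ^ (-(z : ℂ)) + (s + 1) ^ (-(z : ℂ))

lemma modelSeries_zero (s : ℂ) : modelSeries 0 s = 0 := by
  simp [modelSeries]; ring

/-- The inverse transform of `modelSeries`, restricted to a vertical line. -/
def modelDensity (z σ : ℝ) (u : ℝ) : ℂ :=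
  indicator (Ioi 0) (fun u : ℝ => ((u ^ (z - 1) * (1 - Real.exp (-u)) ^ 2 *
    Real.exp (-((σ - 1) * u)) / Real.Gamma z : ℝ) : ℂ)) u

lemma modelDensity_mul_cexp {z σ u : ℝ} (hu : 0 < u) (t : ℝ) :
    ((u ^ (z - 1) * (1 - Real.exp (-u)) ^ 2 * Real.exp (-((σ - 1) * u)) / Real.Gamma z : ℝ) : ℂ) *
      cexp (-(t * I * u)) =
    ((Real.Gamma z : ℂ))⁻¹ * ((u : ℂ) ^ ((z - 1 : ℝ) : ℂ) * cexp (-((σ + t * I - 1) * u)) -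
      2 * ((u : ℂ) ^ ((z - 1 : ℝ) : ℂ) * cexp (-((σ + t * I) * u))) +
      (u : ℂ) ^ ((z - 1 : ℝ) : ℂ) * cexp (-((σ + t * I + 1) * u))) := by
  have e2 : cexp (-((σ + t * I) * u)) = cexp (-((σ + t * I - 1) * u)) * cexp (-(u : ℂ)) := by
    rw [← Complex.exp_add]; ring_nf
  have e3 : cexp (-((σ + t * I + 1) * u)) = cexp (-((σ + t * I - 1) * u)) * cexp (-(u : ℂ)) ^ 2 := by
    rw [sq, ← Complex.exp_add, ← Complex.exp_add]; ring_nf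
  have e1 : cexp (-((σ + t * I - 1) * u)) = cexp (-((σ - 1) * u)) * cexp (-(t * I * u)) := by
    rw [← Complex.exp_add]; ring_nf
  rw [e2, e3, e1, ← ofReal_cpow hu.le]
  push_cast
  ring

lemma integrable_modelDensity {z σ : ℝ} (hz : 0 < z) (hσ : 1 < σ) :
    Integrable (modelDensity z σ) := by
  unfold modelDensity
  rw [integrable_indicator_iff measurableSet_Ioi]
  have h1 := integrableOn_cpow_mul_cexp (p := z - 1) (r := σ - 1) (by linarith) (by simpa using hσ)
  have h2 := integrableOn_cpow_mul_cexp (p := z - 1) (r := σ) (by linarith) (by simp; linarith)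
  have h3 := integrableOn_cpow_mul_cexp (p := z - 1) (r := σ + 1) (by linarith) (by simp; linarith)
  have h := ((h1.sub (h2.const_mul 2)).add h3).const_mul ((Real.Gamma z : ℂ))⁻¹
  refine h.congr ((ae_restrict_mem measurableSet_Ioi).mono fun u hu => ?_)
  have := modelDensity_mul_cexp (z := z) (σ := σ) hu 0
  simp only [ofReal_zero, zero_mul, neg_zero, Complex.exp_zero, mul_one, add_zero] at this
  simp only [Pi.add_apply, Pi.sub_apply]
  rw [this]

lemma integral_modelDensity_mul_cexp {z σ : ℝ} (hz : 0 < z) (hσ : 1 < σ) (t : ℝ) :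
    ∫ u : ℝ, modelDensity z σ u * cexp (-(t * I * u)) = modelSeries z (σ + t * I) := by
  have h1 := integrableOn_cpow_mul_cexp (p := z - 1) (r := σ + t * I - 1) (by linarith)
    (by simpa using hσ)
  have h2 := integrableOn_cpow_mul_cexp (p := z - 1) (r := σ + t * I) (by linarith)
    (by simp; linarith)
  have h3 := integrableOn_cpow_mul_cexp (p := z - 1) (r := σ + t * I + 1) (by linarith)
    (by simp; linarith)
  have e : (fun u : ℝ => modelDensity z σ u * cexp (-(t * I * u))) = indicator (Ioi 0)
      (fun u : ℝ => ((Real.Gamma z : ℂ))⁻¹ * ((u : ℂ) ^ ((z - 1 : ℝ) : ℂ) *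
        cexp (-((σ + t * I - 1) * u)) - 2 * ((u : ℂ) ^ ((z - 1 : ℝ) : ℂ) *
        cexp (-((σ + t * I) * u))) + (u : ℂ) ^ ((z - 1 : ℝ) : ℂ) * cexp (-((σ + t * I + 1) * u)))) := by
    funext u
    by_cases hu : u ∈ Ioi (0 : ℝ)
    · rw [modelDensity, indicator_of_mem hu, indicator_of_mem hu, modelDensity_mul_cexp hu]
    · rw [modelDensity, indicator_of_notMem hu, indicator_of_notMem hu, zero_mul]
  have h12 := h1.fun_sub (h2.const_mul 2)
  rw [e, integral_indicator measurableSet_Ioi, integral_const_mul, integral_add h12 h3, integral_sub h1 (h2.const_mul 2), integral_const_mul,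
    integral_cpow_mul_cexp hz (by simpa using hσ), integral_cpow_mul_cexp hz (by simp; linarith),
    integral_cpow_mul_cexp hz (by simp; linarith), modelSeries]
  have : (Real.Gamma z : ℂ) ≠ 0 := by exact_mod_cast (Real.Gamma_pos_of_pos hz).ne'
  field_simp

lemma norm_cpow_neg_ofReal (v : ℂ) (z : ℝ) : ‖v ^ (-(z : ℂ))‖ = ‖v‖ ^ (-z) := by
  rw [← ofReal_neg, norm_cpow_real]

lemma norm_cpow_neg_le_rpow {v : ℂ} {ρ z : ℝ} (hρ : 0 < ρ) (hv : ρ ≤ ‖v‖) (hz : 0 ≤ z) :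
    ‖v ^ (-(z : ℂ))‖ ≤ ρ ^ (-z) := by
  rw [norm_cpow_neg_ofReal]
  exact Real.rpow_le_rpow_of_nonpos hρ hv (by linarith)

lemma norm_cpow_neg_le_one {v : ℂ} {z : ℝ} (hv : 1 ≤ ‖v‖) (hz : 0 ≤ z) : ‖v ^ (-(z : ℂ))‖ ≤ 1 := by
  simpa using norm_cpow_neg_le_rpow one_pos hv hz

lemma hasDerivAt_cpow_const_slit {v : ℂ} (hv : v ∈ slitPlane) (c : ℂ) :
    HasDerivAt (fun v : ℂ => v ^ c) (c * v ^ (c - 1)) v := by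
  simpa using (hasDerivAt_id v).cpow_const (c := c) hv

lemma slitPlane_of_im {v : ℂ} (h : v.im ≠ 0) : v ∈ slitPlane := Or.inr h

/-- Decay of `modelSeries` in vertical direction. -/
lemma norm_modelSeries_le {z : ℝ} (hz : 0 ≤ z) (hz1 : z ≤ 1) {w : ℂ} (hw : 1 ≤ |w.im|) :
    ‖modelSeries z w‖ ≤ 2 / |w.im| ^ 2 := by
  set y := w.im with hy
  have hy0 : y ≠ 0 := by intro h; rw [h] at hw; norm_num at hw
  set S : Set ℂ := {v : ℂ | v.im = y} with hS
  have hconv : Convex ℝ S := by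
    have : S = imCLM ⁻¹' {y} := by ext v; simp [hS]
    rw [this]
    exact (convex_singleton y).linear_preimage imCLM.toLinearMap
  have hslit : ∀ v ∈ S, v ∈ slitPlane := fun v hv => slitPlane_of_im (by rw [show v.im = y from hv]; exact hy0)
  have hnorm : ∀ v ∈ S, |y| ≤ ‖v‖ := fun v hv => by
    rw [← show v.im = y from hv]; exact abs_im_le_norm v
  have hadd : ∀ v ∈ S, v + 1 ∈ S := fun v hv => by simpa [hS] using hv
  set c : ℂ := -(z : ℂ) with hc
  have hB : ∀ v ∈ S, ‖c * ((c - 1) * v ^ (c - 1 - 1))‖ ≤ 2 / |y| ^ 2 := by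
    intro v hv
    have e : c - 1 - 1 = -((z + 2 : ℝ) : ℂ) := by rw [hc]; push_cast; ring
    have h1 : ‖v ^ (c - 1 - 1)‖ ≤ (|y| ^ 2)⁻¹ := by
      rw [e]
      refine (norm_cpow_neg_le_rpow (by positivity) (hnorm v hv) (by linarith)).trans ?_
      calc |y| ^ (-(z + 2)) ≤ |y| ^ (-2 : ℝ) := Real.rpow_le_rpow_of_exponent_le hw (by linarith)
        _ = _ := by rw [Real.rpow_neg (by positivity)]; norm_num
    have h2 : ‖c‖ ≤ 1 := by rw [hc, norm_neg, norm_real, Real.norm_eq_abs, abs_of_nonneg hz]; exact hz1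
    have h3 : ‖c - 1‖ ≤ 2 := (norm_sub_le _ _).trans (by rw [norm_one]; linarith)
    rw [norm_mul, norm_mul, div_eq_mul_inv]
    calc ‖c‖ * (‖c - 1‖ * ‖v ^ (c - 1 - 1)‖) ≤ 1 * (2 * (|y| ^ 2)⁻¹) := by gcongr
      _ = _ := by ring
  have hd1 : ∀ v ∈ S, ‖c * (v + 1) ^ (c - 1) - c * v ^ (c - 1)‖ ≤ 2 / |y| ^ 2 := by
    intro v hv
    have h := hconv.norm_image_sub_le_of_norm_hasDerivWithin_le
      (f := fun v : ℂ => c * v ^ (c - 1)) (f' := fun v => c * ((c - 1) * v ^ (c - 1 - 1)))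
      (fun v hv => ((hasDerivAt_cpow_const_slit (hslit v hv) _).const_mul c).hasDerivWithinAt)
      hB hv (hadd v hv)
    simpa using h
  have hw1 : w - 1 ∈ S := by simp [hS, hy]
  have h := hconv.norm_image_sub_le_of_norm_hasDerivWithin_le
      (f := fun v : ℂ => (v + 1) ^ c - v ^ c) (f' := fun v => c * (v + 1) ^ (c - 1) - c * v ^ (c - 1))
      (fun v hv => (((hasDerivAt_cpow_const_slit (hslit _ (hadd v hv)) c).comp_add_const v 1).sub
        (hasDerivAt_cpow_const_slit (hslit v hv) c)).hasDerivWithinAt)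
      hd1 hw1 (show w ∈ S from rfl)
  simp only [sub_add_cancel, sub_sub_cancel, norm_one, mul_one] at h
  rw [modelSeries, ← hc]
  refine le_trans (le_of_eq ?_) h
  congr 1
  ring

lemma continuous_modelSeries_line (z : ℝ) {σ : ℝ} (hσ : 1 < σ) :
    Continuous fun t : ℝ => modelSeries z (σ + t * I) := by
  unfold modelSeries
  refine Continuous.add (Continuous.sub ?_ (Continuous.mul continuous_const ?_)) ?_
  all_goals
    apply Continuous.cpow (by fun_prop) (by fun_prop)
    intro t
    left
    simp
    linarith

lemma le_norm_of_le_re {v : ℂ} {r : ℝ} (h : r ≤ v.re) : r ≤ ‖v‖ := h.trans (re_le_norm v)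

lemma integrable_modelSeries {z σ : ℝ} (hz : 0 ≤ z) (hz1 : z ≤ 1) (hσ : 1 < σ) :
    Integrable fun t : ℝ => modelSeries z (σ + t * I) := by
  set K : ℝ := (σ - 1) ^ (-z) + 3 with hK
  have hp : 0 < (σ - 1) ^ (-z) := Real.rpow_pos_of_pos (by linarith) _
  refine (integrable_inv_one_add_sq.const_mul (2 * K + 4)).mono'
    (continuous_modelSeries_line z hσ).aestronglyMeasurable (ae_of_all _ fun t => ?_)
  rcases le_total 1 |t| with ht | ht
  · have h := norm_modelSeries_le hz hz1 (w := σ + t * I) (by simpa using ht)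
    simp only [add_im, ofReal_im, mul_im, ofReal_re, I_im, mul_one, I_re, mul_zero, add_zero,
      zero_add, sq_abs] at h
    refine h.trans ?_
    have ht2 : 1 ≤ t ^ 2 := by rw [← sq_abs]; nlinarith
    rw [← div_eq_mul_inv, div_le_div_iff₀ (by linarith) (by linarith)]
    nlinarith
  · have ht2 : t ^ 2 ≤ 1 := by rw [← sq_abs]; nlinarith [abs_nonneg t]
    have h1 : ‖modelSeries z (σ + t * I)‖ ≤ K := by
      have b1 := norm_cpow_neg_le_rpow (v := σ + t * I - 1) (by linarith : 0 < σ - 1)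
        (le_norm_of_le_re (by simp)) hz
      have b2 := norm_cpow_neg_le_one (v := σ + t * I) (le_norm_of_le_re (by simp; linarith)) hz
      have b3 := norm_cpow_neg_le_one (v := σ + t * I + 1) (le_norm_of_le_re (by simp; linarith)) hz
      unfold modelSeries
      refine (norm_add_le _ _).trans ?_
      refine (add_le_add (norm_sub_le _ _) le_rfl).trans ?_
      rw [norm_mul, Complex.norm_ofNat]
      linarith
    refine h1.trans ?_
    rw [← div_eq_mul_inv, le_div_iff₀ (by positivity)]
    nlinarith

/-- Fourier inversion for the pair `modelDensity`, `modelSeries`. -/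
lemma integral_modelSeries {z σ L : ℝ} (hz : 0 ≤ z) (hz1 : z ≤ 1) (hσ : 1 < σ) (hL : 0 < L) :
    (1 / (2 * Real.pi) : ℝ) * ∫ t : ℝ, modelSeries z (σ + t * I) * cexp (t * I * L) =
      ((L ^ (z - 1) * (1 - Real.exp (-L)) ^ 2 * Real.exp (-((σ - 1) * L)) / Real.Gamma z : ℝ) : ℂ) := by
  rcases hz.eq_or_lt with rfl | hz0
  · simp [modelSeries_zero, Real.Gamma_zero]
  have hF : ∀ ξ : ℝ, 𝓕 (modelDensity z σ) ξ = modelSeries z (σ + (2 * Real.pi * ξ : ℝ) * I) := by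
    intro ξ
    rw [Real.fourier_real_eq_integral_exp_smul, ← integral_modelDensity_mul_cexp hz0 hσ]
    congr 1
    funext u
    rw [smul_eq_mul, mul_comm]
    congr 2
    push_cast
    ring
  have hi := integrable_modelSeries hz hz1 hσ
  have hInt : Integrable (𝓕 (modelDensity z σ)) := by
    have := hi.comp_mul_left' (R := 2 * Real.pi) (by positivity)
    refine this.congr (ae_of_all _ fun ξ => ?_)
    simp only [hF]
  have hc : ContinuousAt (modelDensity z σ) L := by
    have : ContinuousAt (fun u : ℝ => ((u ^ (z - 1) * (1 - Real.exp (-u)) ^ 2 *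
        Real.exp (-((σ - 1) * u)) / Real.Gamma z : ℝ) : ℂ)) L := by
      have h1 : ContinuousAt (fun u : ℝ => u ^ (z - 1)) L :=
        Real.continuousAt_rpow_const _ _ (Or.inl hL.ne')
      have : Real.Gamma z ≠ 0 := (Real.Gamma_pos_of_pos hz0).ne'
      fun_prop (disch := assumption)
    refine this.congr ?_
    filter_upwards [Ioi_mem_nhds hL] with u hu
    rw [modelDensity, indicator_of_mem (show u ∈ Ioi (0:ℝ) from hu)]
  have h := (integrable_modelDensity hz0 hσ).fourierInv_fourier_eq hInt hc
  rw [modelDensity, indicator_of_mem (show L ∈ Ioi (0:ℝ) from hL)] at h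
  rw [← h, Real.fourierInv_eq']
  have e : ∀ ξ : ℝ, cexp ((2 * Real.pi * inner ℝ ξ L : ℝ) * I) • 𝓕 (modelDensity z σ) ξ =
      (fun t : ℝ => modelSeries z (σ + t * I) * cexp (t * I * L)) (2 * Real.pi * ξ) := by
    intro ξ
    rw [hF, smul_eq_mul, mul_comm]
    congr 2
    simp
    ring
  rw [integral_congr_ae (ae_of_all _ e), Measure.integral_comp_mul_left
    (fun t : ℝ => modelSeries z (σ + t * I) * cexp (t * I * L)) (2 * Real.pi), Complex.real_smul,
    abs_of_pos (by positivity), one_div]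

lemma norm_iteratedDeriv_le_of_closedBall {h : ℂ → ℂ} {s : ℂ} {r B : ℝ} (hr : 0 < r) (hr1 : r ≤ 1)
    (hd : DifferentiableOn ℂ h (Metric.closedBall s r))
    (hB : ∀ w ∈ Metric.closedBall s r, ‖h w‖ ≤ B) {n : ℕ} (hn : n ≤ 3) :
    ‖iteratedDeriv n h s‖ ≤ 6 * B / r ^ 3 := by
  have h1 := norm_iteratedDeriv_le_of_forall_mem_sphere_norm_le n hr (hd.diffContOnCl_ball subset_rfl)
    (fun w hw => hB w (Metric.sphere_subset_closedBall hw))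
  have hB0 : 0 ≤ B := (norm_nonneg _).trans (hB s (Metric.mem_closedBall_self hr.le))
  refine h1.trans ?_
  have hf : (n.factorial : ℝ) ≤ 6 := by
    exact_mod_cast Nat.factorial_le hn
  have hp : r ^ 3 ≤ r ^ n := pow_le_pow_of_le_one hr.le hr1 hn
  gcongr

/-- Cauchy estimate for a function that is locally a sum of two holomorphic functions. -/
lemma norm_iteratedDeriv_le_of_eventuallyEq_add {f h₁ h₂ : ℂ → ℂ} {s : ℂ} {r₁ B₁ r₂ B₂ : ℝ}
    (hr₁ : 0 < r₁) (hr₁1 : r₁ ≤ 1) (hr₂ : 0 < r₂) (hr₂1 : r₂ ≤ 1)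
    (hd₁ : DifferentiableOn ℂ h₁ (Metric.closedBall s r₁))
    (hB₁ : ∀ w ∈ Metric.closedBall s r₁, ‖h₁ w‖ ≤ B₁)
    (hd₂ : DifferentiableOn ℂ h₂ (Metric.closedBall s r₂))
    (hB₂ : ∀ w ∈ Metric.closedBall s r₂, ‖h₂ w‖ ≤ B₂)
    (hf : f =ᶠ[𝓝 s] fun w => h₁ w + h₂ w) {n : ℕ} (hn : n ≤ 3) :
    ‖iteratedDeriv n f s‖ ≤ 6 * B₁ / r₁ ^ 3 + 6 * B₂ / r₂ ^ 3 := by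
  have c₁ : ContDiffAt ℂ n h₁ s :=
    ((hd₁.analyticAt (Metric.closedBall_mem_nhds s hr₁)).contDiffAt)
  have c₂ : ContDiffAt ℂ n h₂ s :=
    ((hd₂.analyticAt (Metric.closedBall_mem_nhds s hr₂)).contDiffAt)
  rw [hf.iteratedDeriv_eq, iteratedDeriv_fun_add c₁ c₂]
  exact (norm_add_le _ _).trans (add_le_add
    (norm_iteratedDeriv_le_of_closedBall hr₁ hr₁1 hd₁ hB₁ hn)
    (norm_iteratedDeriv_le_of_closedBall hr₂ hr₂1 hd₂ hB₂ hn))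

lemma integral_cexp_mul_deriv {g g' : ℝ → ℂ} (hg : ∀ t, HasDerivAt g (g' t) t)
    (hgi : Integrable g) (hgi' : Integrable g') (L : ℝ) :
    (I * L) * ∫ t : ℝ, g t * cexp (t * I * L) = -∫ t : ℝ, g' t * cexp (t * I * L) := by
  have he : ∀ t : ℝ, HasDerivAt (fun t : ℝ => cexp (t * I * L)) (cexp (t * I * L) * (I * L)) t := by
    intro t
    have h1 : HasDerivAt (fun t : ℝ => (t : ℂ) * I * L) (I * L) t := by
      have := ((hasDerivAt_id t).ofReal_comp.mul_const I).mul_const (L : ℂ)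
      simpa using this
    exact h1.cexp
  have hn : ∀ t : ℝ, ‖cexp (t * I * L)‖ = 1 := fun t => by
    rw [show (t : ℂ) * I * L = ((t * L : ℝ) : ℂ) * I by push_cast; ring, norm_exp_ofReal_mul_I]
  have hc : Continuous fun t : ℝ => cexp (t * I * L) := by fun_prop
  have i1 : ∀ f : ℝ → ℂ, Integrable f → Integrable fun t : ℝ => f t * cexp (t * I * L) := by
    intro f hf
    refine hf.norm.mono' (hf.1.mul hc.aestronglyMeasurable) (ae_of_all _ fun t => ?_)
    rw [norm_mul, hn, mul_one]
  have h := integral_eq_zero_of_hasDerivAt_of_integrable (f := fun t => g t * cexp (t * I * L))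
    (f' := fun t => g' t * cexp (t * I * L) + g t * (cexp (t * I * L) * (I * L)))
    (fun t => (hg t).mul (he t)) ((i1 _ hgi').add (by
      have := (i1 _ hgi).mul_const (I * L)
      simpa only [mul_assoc] using this)) (i1 _ hgi)
  rw [integral_add (i1 _ hgi') (by
      have := (i1 _ hgi).mul_const (I * L)
      simpa only [mul_assoc] using this)] at h
  simp only [← mul_assoc] at h
  have e : ∀ t : ℝ, g t * cexp (t * I * L) * I * L = (I * L) * (g t * cexp (t * I * L)) :=
    fun t => by ring
  simp only [e] at h
  rw [integral_const_mul] at h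
  exact eq_neg_of_add_eq_zero_right h

/-- Three integrations by parts on a vertical line. -/
lemma norm_integral_mul_cexp_le {f : ℂ → ℂ} (hf : DifferentiableOn ℂ f {s | 1 < s.re}) {σ : ℝ}
    (hσ : 1 < σ) {B : ℝ → ℝ} (hB : Integrable B)
    (hfB : ∀ n ≤ 3, ∀ t : ℝ, ‖iteratedDeriv n f (σ + t * I)‖ ≤ B t) {L : ℝ} (hL : 0 < L) :
    L ^ 3 * ‖∫ t : ℝ, f (σ + t * I) * cexp (t * I * L)‖ ≤ ∫ t, B t := by
  have hmem : ∀ t : ℝ, ((σ : ℂ) + t * I) ∈ {s : ℂ | 1 < s.re} := fun t => by simpa using hσ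
  have han : ∀ t : ℝ, AnalyticAt ℂ f (σ + t * I) := fun t =>
    hf.analyticAt (isOpen_halfPlane.mem_nhds (hmem t))
  have hd : ∀ n : ℕ, ∀ t : ℝ, HasDerivAt (fun t : ℝ => iteratedDeriv n f (σ + t * I))
      (iteratedDeriv (n + 1) f (σ + t * I) * I) t := by
    intro n t
    have h1 : HasDerivAt (iteratedDeriv n f) (iteratedDeriv (n + 1) f (σ + t * I)) (σ + t * I) := by
      rw [iteratedDeriv_succ]
      have h := (han t).iterated_deriv n
      rw [← iteratedDeriv_eq_iterate] at h
      exact h.differentiableAt.hasDerivAt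
    have h2 : HasDerivAt (fun t : ℝ => (σ : ℂ) + t * I) I t := by
      have := ((hasDerivAt_id t).ofReal_comp.mul_const I).const_add (σ : ℂ)
      simpa using this
    exact h1.comp t h2
  have hc : ∀ n : ℕ, Continuous fun t : ℝ => iteratedDeriv n f (σ + t * I) := fun n =>
    continuous_iff_continuousAt.2 fun t => (hd n t).continuousAt
  have hi : ∀ n ≤ 3, Integrable fun t : ℝ => iteratedDeriv n f (σ + t * I) := fun n hn =>
    hB.mono' (hc n).aestronglyMeasurable (ae_of_all _ (hfB n hn))
  have step : ∀ n < 3, L * ‖∫ t : ℝ, iteratedDeriv n f (σ + t * I) * cexp (t * I * L)‖ =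
      ‖∫ t : ℝ, iteratedDeriv (n + 1) f (σ + t * I) * cexp (t * I * L)‖ := by
    intro n hn
    have h := integral_cexp_mul_deriv (hd n) (hi n hn.le) ((hi (n + 1) hn).mul_const I) L
    have e : ∀ t : ℝ, iteratedDeriv (n + 1) f (σ + t * I) * I * cexp (t * I * L) =
        I * (iteratedDeriv (n + 1) f (σ + t * I) * cexp (t * I * L)) := fun t => by ring
    simp only [e] at h
    rw [integral_const_mul] at h
    have h' := congrArg norm h
    simpa [abs_of_pos hL] using h'
  have s0 := step 0 (by norm_num)
  have s1 := step 1 (by norm_num)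
  have s2 := step 2 (by norm_num)
  simp only [iteratedDeriv_zero, zero_add] at s0
  rw [show 1 + 1 = 2 from rfl] at s1
  rw [show 2 + 1 = 3 from rfl] at s2
  calc L ^ 3 * ‖∫ t : ℝ, f (σ + t * I) * cexp (t * I * L)‖
      = ‖∫ t : ℝ, iteratedDeriv 3 f (σ + t * I) * cexp (t * I * L)‖ := by
        rw [← s2, ← s1, ← s0]; ring
    _ ≤ ∫ t, B t := by
        refine norm_integral_le_of_norm_le hB (ae_of_all _ fun t => ?_)
        rw [norm_mul, show (t : ℂ) * I * L = ((t * L : ℝ) : ℂ) * I by push_cast; ring,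
          norm_exp_ofReal_mul_I, mul_one]
        exact hfB 3 le_rfl t

/-- The kernel `((1 + δ)^{w + 1} - 1) / (δ w (w + 1))`. -/
def smoothFactor (δ : ℝ) (w : ℂ) : ℂ :=
  (cexp ((w + 1) * (Real.log (1 + δ) : ℝ)) - 1) / (δ * (w * (w + 1)))

lemma abs_log_one_add_le {δ : ℝ} (hδ : |δ| ≤ 1 / 88) : |Real.log (1 + δ)| ≤ 2 * |δ| := by
  obtain ⟨h1, h2⟩ := abs_le.1 hδ
  have hp : 0 < 1 + δ := by linarith
  have hu := Real.log_le_sub_one_of_pos hp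
  have hl := Real.one_sub_inv_le_log_of_pos hp
  have e : 1 - (1 + δ)⁻¹ = δ / (1 + δ) := by field_simp; ring
  rw [e] at hl
  have h3 : -(2 * |δ|) ≤ δ / (1 + δ) := by
    rw [le_div_iff₀ hp]
    nlinarith [neg_abs_le δ, abs_nonneg δ]
  rw [abs_le]
  exact ⟨by linarith, by linarith [le_abs_self δ, abs_nonneg δ]⟩

lemma norm_smoothFactor_le_near {δ : ℝ} (hδ : |δ| ≤ 1 / 88) {w : ℂ} (hw : ‖w - 1‖ ≤ 1 / 4) :
    ‖smoothFactor δ w‖ ≤ 6 := by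
  rcases eq_or_ne δ 0 with rfl | hδ0
  · simp [smoothFactor]
  have hδp : 0 < |δ| := abs_pos.2 hδ0
  have hlog := abs_log_one_add_le hδ
  have hw1 : ‖w + 1‖ ≤ 9 / 4 := by
    calc ‖w + 1‖ = ‖(w - 1) + 2‖ := by ring_nf
      _ ≤ ‖w - 1‖ + ‖(2 : ℂ)‖ := norm_add_le _ _
      _ ≤ _ := by rw [Complex.norm_ofNat]; linarith
  have hre : 3 / 4 ≤ w.re := by
    have := (abs_le.1 ((abs_re_le_norm (w - 1)).trans hw)).1
    simp at this; linarith
  have hwn : 3 / 4 ≤ ‖w‖ := le_norm_of_le_re hre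
  have hwn1 : 0 < ‖w + 1‖ := by
    have : 7 / 4 ≤ ‖w + 1‖ := le_norm_of_le_re (by simp; linarith)
    linarith
  have hv : ‖(w + 1) * (Real.log (1 + δ) : ℝ)‖ ≤ ‖w + 1‖ * (2 * |δ|) := by
    rw [norm_mul, norm_real, Real.norm_eq_abs]; gcongr
  have hv1 : ‖(w + 1) * (Real.log (1 + δ) : ℝ)‖ ≤ 1 := by nlinarith
  have h := norm_exp_sub_one_le hv1
  rw [smoothFactor, norm_div, norm_mul, norm_mul, norm_real, Real.norm_eq_abs,
    div_le_iff₀ (by positivity)]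
  refine h.trans ?_
  nlinarith [mul_pos hδp hwn1]

lemma norm_smoothFactor_le_far {δ : ℝ} (hδ : |δ| ≤ 1 / 88) {w : ℂ} (hw0 : 0 < w.re)
    (hw3 : w.re ≤ 3) : ‖smoothFactor δ w‖ ≤ 3 / (|δ| * ‖w‖ ^ 2) := by
  rcases eq_or_ne δ 0 with rfl | hδ0
  · simp [smoothFactor]
  have hδp : 0 < |δ| := abs_pos.2 hδ0
  have hlog := abs_log_one_add_le hδ
  have hwn : 0 < ‖w‖ := hw0.trans_le (re_le_norm w)
  have h2 : ‖w‖ ≤ ‖w + 1‖ := by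
    apply le_of_sq_le_sq _ (norm_nonneg _)
    rw [← normSq_eq_norm_sq, ← normSq_eq_norm_sq, normSq_apply, normSq_apply]
    simp
    nlinarith
  have he : ‖cexp ((w + 1) * (Real.log (1 + δ) : ℝ))‖ ≤ 2 := by
    rw [norm_exp, re_mul_ofReal]
    have h3 : (w + 1).re * Real.log (1 + δ) ≤ Real.log 2 := by
      have : (w + 1).re = w.re + 1 := by simp
      rw [this]
      have := le_abs_self (Real.log (1 + δ))
      have := Real.log_two_gt_d9
      nlinarith
    calc Real.exp _ ≤ Real.exp (Real.log 2) := Real.exp_le_exp.2 h3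
      _ = 2 := Real.exp_log (by norm_num)
  rw [smoothFactor, norm_div, norm_mul, norm_mul, norm_real, Real.norm_eq_abs]
  have h4 : ‖cexp ((w + 1) * (Real.log (1 + δ) : ℝ)) - 1‖ ≤ 3 :=
    (norm_sub_le _ _).trans (by rw [norm_one]; linarith)
  gcongr
  rw [sq]
  gcongr

lemma smoothFactor_one {δ : ℝ} (hδ0 : δ ≠ 0) (hδ : |δ| ≤ 1 / 88) :
    smoothFactor δ 1 = 1 + δ / 2 := by
  have hp : 0 < 1 + δ := by linarith [(abs_le.1 hδ).1]
  have : cexp ((1 + 1) * (Real.log (1 + δ) : ℝ)) = ((1 + δ : ℝ) : ℂ) ^ 2 := by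
    rw [show ((1 : ℂ) + 1) * (Real.log (1 + δ) : ℝ) = (2 : ℕ) * ((Real.log (1 + δ) : ℝ) : ℂ) by
      norm_num, Complex.exp_nat_mul, ← ofReal_exp, Real.exp_log hp]
  rw [smoothFactor, this]
  have : (δ : ℂ) ≠ 0 := by exact_mod_cast hδ0
  push_cast
  field_simp
  ring

lemma differentiableAt_smoothFactor {δ : ℝ} (hδ0 : δ ≠ 0) {w : ℂ} (hw : 0 < w.re) :
    DifferentiableAt ℂ (smoothFactor δ) w := by
  unfold smoothFactor
  have h1 : w ≠ 0 := by rintro rfl; simp at hw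
  have h2 : w + 1 ≠ 0 := by
    intro h
    have := congrArg re h
    simp at this; linarith
  have h3 : (δ : ℂ) ≠ 0 := by exact_mod_cast hδ0
  apply DifferentiableAt.div (by fun_prop) (by fun_prop)
  exact mul_ne_zero h3 (mul_ne_zero h1 h2)

lemma exists_riemannZeta₁_near_one : ∃ c : ℝ, 0 < c ∧ c ≤ 1 / 8 ∧
    ∀ w : ℂ, ‖w - 1‖ ≤ 2 * c → ‖riemannZeta₁ w - 1‖ ≤ 1 / 2 := by
  have h := differentiable_riemannZeta₁.continuous.continuousAt (x := 1)
  obtain ⟨ε, hε, h⟩ := Metric.continuousAt_iff.1 h (1 / 2) (by norm_num)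
  refine ⟨min (1 / 8) (ε / 4), by positivity, min_le_left _ _, fun w hw => ?_⟩
  have := h (x := w) (by
    rw [dist_eq_norm]
    have := min_le_right (1 / 8) (ε / 4)
    linarith)
  rw [dist_eq_norm, riemannZeta₁_one] at this
  exact this.le

lemma mem_slitPlane_of_norm_sub_one {v : ℂ} (hv : ‖v - 1‖ ≤ 1 / 2) : v ∈ slitPlane := by
  left
  have := (abs_le.1 ((abs_re_le_norm (v - 1)).trans hv)).1
  simp at this; linarith

/-- Near `s = 1` the branch `logZeta` is expressed by principal logarithms. -/
lemma logZeta_eq_near_one {c : ℝ} (hc : ∀ w : ℂ, ‖w - 1‖ ≤ 2 * c → ‖riemannZeta₁ w - 1‖ ≤ 1 / 2)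
    {w : ℂ} (hw : 1 < w.re) (hwc : ‖w - 1‖ < 2 * c) :
    logZeta w = -log (w - 1) + log (riemannZeta₁ w) := by
  set S : Set ℂ := {s : ℂ | 1 < s.re} ∩ Metric.ball 1 (2 * c) with hS
  have hopen : IsOpen S := isOpen_halfPlane.inter Metric.isOpen_ball
  have hconv : Convex ℝ S := (convex_halfSpace_re_gt 1).inter (convex_ball _ _)
  have hmemS : ∀ v ∈ S, 1 < v.re ∧ ‖v - 1‖ < 2 * c := fun v hv =>
    ⟨hv.1, by simpa [dist_eq_norm] using hv.2⟩
  have hv1 : ∀ v ∈ S, v - 1 ∈ slitPlane := fun v hv => by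
    left; simpa using (hmemS v hv).1
  have hvz : ∀ v ∈ S, riemannZeta₁ v ∈ slitPlane := fun v hv =>
    mem_slitPlane_of_norm_sub_one (hc v (hmemS v hv).2.le)
  set D : ℂ → ℂ := fun v => logZeta v + log (v - 1) - log (riemannZeta₁ v) with hD
  have hdiff : ∀ v ∈ S, DifferentiableAt ℂ D v := by
    intro v hv
    have d1 := (hasDerivAt_logZeta (hmemS v hv).1).differentiableAt
    have d2 : DifferentiableAt ℂ (fun v : ℂ => log (v - 1)) v :=
      (differentiableAt_id.sub_const 1).clog (hv1 v hv)
    have d3 : DifferentiableAt ℂ (fun v : ℂ => log (riemannZeta₁ v)) v :=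
      differentiable_riemannZeta₁.differentiableAt.clog (hvz v hv)
    exact (d1.add d2).sub d3
  have hexp : ∀ v ∈ S, cexp (D v) = 1 := by
    intro v hv
    have h1 : v ≠ 1 := by rintro rfl; simpa using (hmemS _ hv).1
    have h0 := slitPlane_ne_zero (hvz v hv)
    simp only [hD]
    rw [Complex.exp_sub, Complex.exp_add, exp_logZeta (hmemS v hv).1,
      exp_log (slitPlane_ne_zero (hv1 v hv)), exp_log h0, mul_comm, ← riemannZeta₁_eq h1, div_self h0]
  have hderiv : EqOn (deriv D) 0 S := by
    intro v hv
    have h1 : HasDerivAt (fun v => cexp (D v)) (cexp (D v) * deriv D v) v :=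
      (hdiff v hv).hasDerivAt.cexp
    have h2 : (fun v => cexp (D v)) =ᶠ[𝓝 v] fun _ => 1 := by
      filter_upwards [hopen.mem_nhds hv] with u hu using hexp u hu
    have h3 := (h1.congr_of_eventuallyEq h2.symm).unique (hasDerivAt_const v 1)
    rw [hexp v hv, one_mul] at h3
    exact h3
  have hc0 : 0 < c := by linarith [norm_nonneg (w - 1)]
  have hp : ((1 + c : ℝ) : ℂ) ∈ S := by
    refine ⟨by simpa using hc0, ?_⟩
    simp [abs_of_pos hc0, hc0]
  have hwS : w ∈ S := ⟨hw, by simpa [dist_eq_norm] using hwc⟩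
  have hconst := hopen.is_const_of_deriv_eq_zero hconv.isPreconnected
    (fun v hv => (hdiff v hv).differentiableWithinAt) hderiv hwS hp
  have hne : ((1 + c : ℝ) : ℂ) ≠ 1 := by
    have : (1 + c : ℝ) ≠ 1 := by linarith
    exact_mod_cast this
  have hDp : D ((1 + c : ℝ) : ℂ) = 0 := by
    have him : (D ((1 + c : ℝ) : ℂ)).im = 0 := by
      have e1 : (((1 + c : ℝ) : ℂ) - 1) = ((c : ℝ) : ℂ) := by push_cast; ring
      have e2 : riemannZeta₁ ((1 + c : ℝ) : ℂ) =
          ((c * Real.exp (logZeta ((1 + c : ℝ) : ℂ)).re : ℝ) : ℂ) := by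
        rw [riemannZeta₁_eq hne, ← exp_logZeta (hmemS _ hp).1, e1]
        push_cast
        congr 2
        apply Complex.ext
        · simp
        · simpa using logZeta_ofReal_im (1 + c)
      simp only [hD]
      rw [sub_im, add_im, logZeta_ofReal_im, e1, e2, ← ofReal_log hc0.le,
        ← ofReal_log (by positivity)]
      simp
    have hre := congrArg norm (hexp _ hp)
    rw [norm_exp, norm_one, Real.exp_eq_one_iff] at hre
    exact Complex.ext hre him
  rw [hDp] at hconst
  simp only [hD] at hconst
  linear_combination hconst

/-- `G` is holomorphic of moderate growth on `sdRegion c₀`, and the exponent is in `[0, 1]`. -/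
structure IsModerate (z c₀ M : ℝ) (G : ℂ → ℂ) : Prop where
  exponent_nonneg : 0 ≤ z
  exponent_le_one : z ≤ 1
  width_pos : 0 < c₀
  width_le : c₀ ≤ 2 / 11
  bound_pos : 0 < M
  differentiableAt : ∀ s ∈ sdRegion c₀, DifferentiableAt ℂ G s
  norm_le : ∀ s ∈ sdRegion c₀, ‖G s‖ ≤ M * (1 + |s.im|) ^ (1 / 2 : ℝ)

/-- The smoothed integrand minus its model singularity at `s = 1`. -/
def modelError (z δ : ℝ) (G : ℂ → ℂ) (s : ℂ) : ℂ :=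
  smoothFactor δ s * (G s * cexp (z * logZeta s)) - G 1 * smoothFactor δ 1 * modelSeries z s

lemma mem_sdRegion_of_abs_im_le_one {c₀ : ℝ} {w : ℂ} (him : |w.im| ≤ 1) (hre : 1 - c₀ ≤ w.re) :
    w ∈ sdRegion c₀ := by
  have h0 : logPlus |w.im| = 0 := max_eq_left (Real.log_nonpos (abs_nonneg _) him)
  simpa [sdRegion, h0] using hre

lemma mem_sdRegion_of_norm_sub_one_le {c₀ : ℝ} (hc : c₀ ≤ 1) {w : ℂ} (hw : ‖w - 1‖ ≤ c₀) :
    w ∈ sdRegion c₀ := by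
  have h1 := (abs_im_le_norm (w - 1)).trans hw
  have h2 := (abs_le.1 ((abs_re_le_norm (w - 1)).trans hw)).1
  simp at h1 h2
  exact mem_sdRegion_of_abs_im_le_one (h1.trans hc) (by linarith)

namespace IsModerate

variable {z c₀ M : ℝ} {G : ℂ → ℂ}

lemma norm_le_of_abs_im_le_one (h : IsModerate z c₀ M G) {w : ℂ} (hw : w ∈ sdRegion c₀)
    (him : |w.im| ≤ 1) : ‖G w‖ ≤ 2 * M := by
  have hM := h.bound_pos
  have h1 : (1 + |w.im|) ^ (1 / 2 : ℝ) ≤ 2 := by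
    calc (1 + |w.im|) ^ (1 / 2 : ℝ) ≤ (1 + |w.im|) ^ (1 : ℝ) :=
          Real.rpow_le_rpow_of_exponent_le (by linarith [abs_nonneg w.im]) (by norm_num)
      _ ≤ 2 := by rw [Real.rpow_one]; linarith
  calc ‖G w‖ ≤ M * (1 + |w.im|) ^ (1 / 2 : ℝ) := h.norm_le w hw
    _ ≤ M * 2 := by gcongr
    _ = 2 * M := by ring

lemma norm_one_le (h : IsModerate z c₀ M G) : ‖G 1‖ ≤ M := by
  have := h.norm_le 1 (mem_sdRegion_of_abs_im_le_one (by simp) (by simp [h.width_pos.le]))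
  simpa using this

/-- Lipschitz bound for `G` at `1`. -/
lemma norm_sub_one_le (h : IsModerate z c₀ M G) {w : ℂ} (hw : w ∈ sdRegion c₀)
    (him : |w.im| ≤ 1) : ‖G w - G 1‖ ≤ 4 * M / c₀ * ‖w - 1‖ := by
  have hM := h.bound_pos
  have hc := h.width_pos
  have h1 := h.norm_one_le
  have hc1 : c₀ ≤ 1 := h.width_le.trans (by norm_num)
  rcases lt_or_ge ‖w - 1‖ c₀ with hlt | hge
  · have hball : ∀ v ∈ Metric.ball (1 : ℂ) c₀, v ∈ sdRegion c₀ ∧ |v.im| ≤ 1 := by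
      intro v hv
      have hv' : ‖v - 1‖ < c₀ := by simpa [dist_eq_norm] using hv
      refine ⟨mem_sdRegion_of_norm_sub_one_le hc1 hv'.le, ?_⟩
      have := (abs_im_le_norm (v - 1)).trans hv'.le
      simp at this
      linarith
    have hs := Complex.dist_le_div_mul_dist_of_mapsTo_ball (f := G) (c := 1) (R₁ := c₀)
      (R₂ := 4 * M) (z := w)
      (fun v hv => (h.differentiableAt v (hball v hv).1).differentiableWithinAt)
      (fun v hv => by
        rw [Metric.mem_closedBall, dist_eq_norm]
        have := h.norm_le_of_abs_im_le_one (hball v hv).1 (hball v hv).2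
        exact (norm_sub_le _ _).trans (by linarith))
      (by simpa [dist_eq_norm] using hlt)
    rwa [dist_eq_norm, dist_eq_norm] at hs
  · have h2 := h.norm_le_of_abs_im_le_one hw him
    calc ‖G w - G 1‖ ≤ 4 * M := (norm_sub_le _ _).trans (by linarith)
      _ = 4 * M / c₀ * c₀ := by field_simp
      _ ≤ _ := by gcongr

end IsModerate

lemma norm_cpow_ofReal_le {v : ℂ} (hv : ‖v - 1‖ ≤ 1 / 2) {z : ℝ} (hz : 0 ≤ z) (hz1 : z ≤ 1) :
    ‖v ^ (z : ℂ)‖ ≤ 3 / 2 := by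
  have h0 := slitPlane_ne_zero (mem_slitPlane_of_norm_sub_one hv)
  have h1 : ‖v‖ ≤ 3 / 2 := by
    calc ‖v‖ = ‖(v - 1) + 1‖ := by ring_nf
      _ ≤ ‖v - 1‖ + ‖(1 : ℂ)‖ := norm_add_le _ _
      _ ≤ _ := by rw [norm_one]; linarith
  rw [norm_cpow_of_ne_zero h0]
  simp only [ofReal_re, ofReal_im, mul_zero, Real.exp_zero, div_one]
  calc ‖v‖ ^ z ≤ (3 / 2) ^ z := by gcongr
    _ ≤ (3 / 2) ^ (1 : ℝ) := Real.rpow_le_rpow_of_exponent_le (by norm_num) hz1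
    _ = _ := Real.rpow_one _

/-- Lipschitz bound at `1` for the regular part of the integrand. -/
lemma norm_smoothFactor_mul_cpow_sub_le {c : ℝ} (hc0 : 0 < c) (hc8 : c ≤ 1 / 8)
    (hc : ∀ w : ℂ, ‖w - 1‖ ≤ 2 * c → ‖riemannZeta₁ w - 1‖ ≤ 1 / 2) {z δ : ℝ} (hz : 0 ≤ z)
    (hz1 : z ≤ 1) (hδ0 : δ ≠ 0) (hδ : |δ| ≤ 1 / 88) {w : ℂ} (hw : ‖w - 1‖ < 2 * c) :
    ‖smoothFactor δ w * riemannZeta₁ w ^ (z : ℂ)‖ ≤ 9 ∧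
    ‖smoothFactor δ w * riemannZeta₁ w ^ (z : ℂ) - smoothFactor δ 1‖ ≤ 9 / c * ‖w - 1‖ ∧
    DifferentiableAt ℂ (fun w => smoothFactor δ w * riemannZeta₁ w ^ (z : ℂ)) w := by
  have hb : ∀ v : ℂ, ‖v - 1‖ < 2 * c → ‖smoothFactor δ v * riemannZeta₁ v ^ (z : ℂ)‖ ≤ 9 := by
    intro v hv
    rw [norm_mul]
    have h1 := norm_smoothFactor_le_near hδ (w := v) (by linarith)
    have h2 := norm_cpow_ofReal_le (hc v hv.le) hz hz1
    nlinarith [norm_nonneg (smoothFactor δ v), norm_nonneg (riemannZeta₁ v ^ (z : ℂ))]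
  have hd : ∀ v : ℂ, ‖v - 1‖ < 2 * c →
      DifferentiableAt ℂ (fun w => smoothFactor δ w * riemannZeta₁ w ^ (z : ℂ)) v := by
    intro v hv
    have hre := (abs_le.1 ((abs_re_le_norm (v - 1)).trans hv.le)).1
    simp at hre
    refine (differentiableAt_smoothFactor hδ0 (by linarith)).mul ?_
    exact differentiable_riemannZeta₁.differentiableAt.cpow_const
      (mem_slitPlane_of_norm_sub_one (hc v hv.le))
  have h1 : smoothFactor δ 1 * riemannZeta₁ 1 ^ (z : ℂ) = smoothFactor δ 1 := by
    simp [riemannZeta₁_one]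
  refine ⟨hb w hw, ?_, hd w hw⟩
  have hs := Complex.dist_le_div_mul_dist_of_mapsTo_ball
    (f := fun w => smoothFactor δ w * riemannZeta₁ w ^ (z : ℂ)) (c := 1) (R₁ := 2 * c)
    (R₂ := 18) (z := w)
    (fun v hv => (hd v (by simpa [dist_eq_norm] using hv)).differentiableWithinAt)
    (fun v hv => by
      rw [Metric.mem_closedBall, dist_eq_norm]
      have := hb v (by simpa [dist_eq_norm] using hv)
      have := hb 1 (by simpa using hc0)
      exact (norm_sub_le _ _).trans (by linarith))
    (by simpa [dist_eq_norm] using hw)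
  rw [dist_eq_norm, dist_eq_norm] at hs
  simp only [h1] at hs
  convert hs using 2
  field_simp; norm_num

/-- A disc around a point of the right half plane avoiding the origin stays in the slit plane. -/
lemma mem_slitPlane_of_norm_sub_lt {u v : ℂ} (hu : 0 < u.re) (hv : ‖v - u‖ < ‖u‖) :
    v ∈ slitPlane := by
  by_contra hcon
  rw [mem_slitPlane_iff] at hcon
  push Not at hcon
  obtain ⟨h1, h2⟩ := hcon
  have : ‖u‖ ≤ ‖v - u‖ := by
    apply le_of_sq_le_sq _ (norm_nonneg _)
    rw [← normSq_eq_norm_sq, ← normSq_eq_norm_sq, normSq_apply, normSq_apply]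
    simp [h2]
    nlinarith
  linarith

lemma norm_iteratedDeriv_modelError_le_near {c : ℝ} (hc0 : 0 < c) (hc8 : c ≤ 1 / 8)
    (hc : ∀ w : ℂ, ‖w - 1‖ ≤ 2 * c → ‖riemannZeta₁ w - 1‖ ≤ 1 / 2) :
    ∃ K : ℝ, 0 < K ∧ ∀ (z c₀ M : ℝ) (G : ℂ → ℂ), IsModerate z c₀ M G →
      ∀ δ : ℝ, δ ≠ 0 → |δ| ≤ 1 / 88 → ∀ s : ℂ, 1 < s.re → ‖s - 1‖ ≤ c → ∀ n ≤ 3,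
        ‖iteratedDeriv n (modelError z δ G) s‖ ≤
          K * M * (‖s - 1‖ ^ (-2 - z) / c₀ + 1 / c₀ ^ 4) := by
  refine ⟨816 / c * 64 + 9216, by positivity, ?_⟩
  intro z c₀ M G hG δ hδ0 hδ s hs hsc n hn
  have hz := hG.exponent_nonneg
  have hz1 := hG.exponent_le_one
  have hw0 := hG.width_pos
  have hw1 := hG.width_le
  have hM := hG.bound_pos
  set ρ := ‖s - 1‖ with hρ
  have hs1 : 0 < (s - 1).re := by simpa using hs
  have hρ0 : 0 < ρ := hs1.trans_le (re_le_norm _)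
  set r := min (ρ / 2) (c₀ / 4) with hr
  have hr0 : 0 < r := by positivity
  have hrρ : r ≤ ρ / 2 := min_le_left _ _
  have hrc : r ≤ c₀ / 4 := min_le_right _ _
  have hnear : ∀ w ∈ Metric.closedBall s r, ‖w - s‖ ≤ r ∧ ‖w - 1‖ ≤ 3 / 2 * ρ ∧ ρ / 2 ≤ ‖w - 1‖ ∧
      w ∈ sdRegion c₀ ∧ |w.im| ≤ 1 ∧ w - 1 ∈ slitPlane := by
    intro w hw
    have h1 : ‖w - s‖ ≤ r := by simpa [dist_eq_norm] using hw
    have h2 : ‖w - 1‖ ≤ 3 / 2 * ρ := by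
      calc ‖w - 1‖ = ‖(w - s) + (s - 1)‖ := by ring_nf
        _ ≤ ‖w - s‖ + ‖s - 1‖ := norm_add_le _ _
        _ ≤ _ := by linarith
    have h3 : ρ / 2 ≤ ‖w - 1‖ := by
      have : ρ ≤ ‖w - 1‖ + ‖w - s‖ := by
        calc ρ = ‖(w - 1) - (w - s)‖ := by rw [hρ]; ring_nf
          _ ≤ _ := norm_sub_le _ _
      linarith
    have him : |w.im| ≤ 1 := by
      have := (abs_im_le_norm (w - 1)).trans h2
      simp at this
      linarith
    have hre := (abs_le.1 ((abs_re_le_norm (w - s)).trans h1)).1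
    simp at hre
    refine ⟨h1, h2, h3, mem_sdRegion_of_abs_im_le_one him (by linarith), him, ?_⟩
    refine mem_slitPlane_of_norm_sub_lt hs1 ?_
    rw [sub_sub_sub_cancel_right]
    linarith
  have hQ := fun (w : ℂ) (hw : ‖w - 1‖ < 2 * c) =>
    norm_smoothFactor_mul_cpow_sub_le hc0 hc8 hc hz hz1 hδ0 hδ hw
  have hW1 : ‖smoothFactor δ 1‖ ≤ 6 := norm_smoothFactor_le_near hδ (by simp)
  have hG1 := hG.norm_one_le
  set h₁ : ℂ → ℂ := fun w => (w - 1) ^ (-(z : ℂ)) *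
    (smoothFactor δ w * riemannZeta₁ w ^ (z : ℂ) * G w - G 1 * smoothFactor δ 1) with hh₁
  set h₂ : ℂ → ℂ := fun w => G 1 * smoothFactor δ 1 *
    (2 * w ^ (-(z : ℂ)) - (w + 1) ^ (-(z : ℂ))) with hh₂
  have hd₁ : DifferentiableOn ℂ h₁ (Metric.closedBall s r) := by
    intro w hw
    obtain ⟨-, b2, -, b4, -, b6⟩ := hnear w hw
    apply DifferentiableAt.differentiableWithinAt
    refine DifferentiableAt.mul ?_ ?_
    · exact (differentiableAt_id.sub_const 1).cpow_const b6
    · exact ((hQ w (by linarith)).2.2.mul (hG.differentiableAt w b4)).sub_const _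
  have hB₁ : ∀ w ∈ Metric.closedBall s r, ‖h₁ w‖ ≤ 136 / c * M / c₀ * (ρ ^ (-z) * ρ) := by
    intro w hw
    obtain ⟨-, b2, b3, b4, b5, b6⟩ := hnear w hw
    obtain ⟨q1, q2, -⟩ := hQ w (by linarith)
    have e : smoothFactor δ w * riemannZeta₁ w ^ (z : ℂ) * G w - G 1 * smoothFactor δ 1 =
        smoothFactor δ w * riemannZeta₁ w ^ (z : ℂ) * (G w - G 1) +
        G 1 * (smoothFactor δ w * riemannZeta₁ w ^ (z : ℂ) - smoothFactor δ 1) := by ring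
    have hL := hG.norm_sub_one_le b4 b5
    have h1 : ‖smoothFactor δ w * riemannZeta₁ w ^ (z : ℂ) * G w - G 1 * smoothFactor δ 1‖ ≤
        68 / c * M / c₀ * ρ := by
      rw [e]
      calc _ ≤ ‖smoothFactor δ w * riemannZeta₁ w ^ (z : ℂ)‖ * ‖G w - G 1‖ +
          ‖G 1‖ * ‖smoothFactor δ w * riemannZeta₁ w ^ (z : ℂ) - smoothFactor δ 1‖ := by
            rw [← norm_mul, ← norm_mul]; exact norm_add_le _ _
        _ ≤ 9 * (4 * M / c₀ * (3 / 2 * ρ)) + M * (9 / c * (3 / 2 * ρ)) := by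
            gcongr
            · exact hL.trans (by gcongr)
            · exact q2.trans (by gcongr)
        _ = (54 * c + 27 / 2 * c₀) * (M / c / c₀ * ρ) := by field_simp; ring
        _ ≤ 68 * (M / c / c₀ * ρ) := by gcongr; nlinarith
        _ = _ := by ring
    have h2 : ‖(w - 1) ^ (-(z : ℂ))‖ ≤ 2 * ρ ^ (-z) := by
      refine (norm_cpow_neg_le_rpow (by positivity) b3 hz).trans ?_
      rw [Real.div_rpow hρ0.le (by norm_num), Real.rpow_neg (by norm_num : (0 : ℝ) ≤ 2), div_inv_eq_mul,
        mul_comm]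
      gcongr
      calc (2 : ℝ) ^ z ≤ 2 ^ (1 : ℝ) := Real.rpow_le_rpow_of_exponent_le (by norm_num) hz1
        _ = 2 := Real.rpow_one _
    rw [hh₁]
    simp only [norm_mul ((w - 1) ^ (-(z : ℂ)))]
    calc _ ≤ 2 * ρ ^ (-z) * (68 / c * M / c₀ * ρ) := by gcongr
      _ = _ := by ring
  have hre4 : ∀ w ∈ Metric.closedBall s (1 / 4), 3 / 4 ≤ w.re := by
    intro w hw
    have h1 : ‖w - s‖ ≤ 1 / 4 := by simpa [dist_eq_norm] using hw
    have hre := (abs_le.1 ((abs_re_le_norm (w - s)).trans h1)).1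
    simp at hre
    linarith
  have hd₂ : DifferentiableOn ℂ h₂ (Metric.closedBall s (1 / 4)) := by
    intro w hw
    have := hre4 w hw
    apply DifferentiableAt.differentiableWithinAt
    refine DifferentiableAt.const_mul (DifferentiableAt.sub (DifferentiableAt.const_mul ?_ _) ?_) _
    · exact differentiableAt_id.cpow_const (Or.inl (by simp; linarith))
    · exact (differentiableAt_id.add_const 1).cpow_const (Or.inl (by simp; linarith))
  have hB₂ : ∀ w ∈ Metric.closedBall s (1 / 4), ‖h₂ w‖ ≤ 24 * M := by
    intro w hw
    have hre := hre4 w hw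
    have h1 : ‖w ^ (-(z : ℂ))‖ ≤ 4 / 3 := by
      refine (norm_cpow_neg_le_rpow (by norm_num : (0 : ℝ) < 3 / 4) (le_norm_of_le_re hre) hz).trans ?_
      calc (3 / 4 : ℝ) ^ (-z) = (4 / 3 : ℝ) ^ z := by
            rw [Real.rpow_neg (by norm_num), ← Real.inv_rpow (by norm_num)]; norm_num
        _ ≤ (4 / 3) ^ (1 : ℝ) := Real.rpow_le_rpow_of_exponent_le (by norm_num) hz1
        _ = _ := Real.rpow_one _
    have h2 : ‖(w + 1) ^ (-(z : ℂ))‖ ≤ 1 := by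
      refine (norm_cpow_neg_le_rpow one_pos (le_norm_of_le_re (by simp; linarith)) hz).trans ?_
      simp
    rw [hh₂]
    simp only [norm_mul (G 1 * smoothFactor δ 1), norm_mul (G 1)]
    calc _ ≤ M * 6 * (2 * (4 / 3) + 1) := by
          gcongr
          refine (norm_sub_le _ _).trans ?_
          rw [norm_mul, Complex.norm_ofNat]
          gcongr
      _ ≤ _ := by linarith
  have hf : modelError z δ G =ᶠ[𝓝 s] fun w => h₁ w + h₂ w := by
    have m1 : {w : ℂ | 1 < w.re} ∈ 𝓝 s := isOpen_halfPlane.mem_nhds hs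
    have m2 : Metric.ball s (1/8 * c) ∈ 𝓝 s := Metric.ball_mem_nhds _ (by positivity)
    filter_upwards [m1, m2] with w hw hwb
    have hwc : ‖w - 1‖ < 2 * c := by
      have h1 : ‖w - s‖ < 1 / 8 * c := by simpa [dist_eq_norm] using hwb
      calc ‖w - 1‖ = ‖(w - s) + (s - 1)‖ := by ring_nf
        _ ≤ ‖w - s‖ + ‖s - 1‖ := norm_add_le _ _
        _ < _ := by linarith
    have n1 : w - 1 ≠ 0 := by
      intro h0
      have := congrArg re h0
      simp at this
      have : 1 < w.re := hw
      linarith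
    have n2 := slitPlane_ne_zero (mem_slitPlane_of_norm_sub_one (hc w hwc.le))
    have e1 : cexp (z * logZeta w) = (w - 1) ^ (-(z : ℂ)) * riemannZeta₁ w ^ (z : ℂ) := by
      rw [logZeta_eq_near_one hc hw hwc, cpow_def_of_ne_zero n1, cpow_def_of_ne_zero n2,
        ← Complex.exp_add]
      congr 1; ring
    simp only [modelError, hh₁, hh₂, modelSeries, e1]
    ring
  have hfin := norm_iteratedDeriv_le_of_eventuallyEq_add hr0 (by linarith) (by norm_num)
    (by norm_num) hd₁ hB₁ hd₂ hB₂ hf hn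
  refine hfin.trans ?_
  have e1 : ρ ^ (-2 - z) = ρ ^ (-z) * ρ / ρ ^ 3 := by
    rw [show -2 - z = -z + 1 - (3 : ℕ) by push_cast; ring, Real.rpow_sub hρ0, Real.rpow_add hρ0,
      Real.rpow_one, Real.rpow_natCast]
  have e2 : ρ ^ (-z) * ρ ≤ 1 := by
    rw [← Real.rpow_add_one hρ0.ne']
    exact Real.rpow_le_one hρ0.le (by linarith) (by linarith)
  have e3 : 1 / r ^ 3 ≤ 64 * (1 / ρ ^ 3 + 1 / c₀ ^ 3) := by
    have p1 : 0 < 1 / ρ ^ 3 := by positivity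
    have p2 : 0 < 1 / c₀ ^ 3 := by positivity
    rcases min_choice (ρ / 2) (c₀ / 4) with h | h
    · rw [hr, h, show 1 / (ρ / 2) ^ 3 = 8 * (1 / ρ ^ 3) by field_simp; norm_num]
      linarith
    · rw [hr, h, show 1 / (c₀ / 4) ^ 3 = 64 * (1 / c₀ ^ 3) by field_simp; norm_num]
      linarith
  have e4 : 1 ≤ 1 / c₀ ^ 4 := by
    rw [le_div_iff₀ (by positivity), one_mul]
    exact pow_le_one₀ hw0.le (by linarith)
  have hp : 0 ≤ ρ ^ (-z) * ρ := by positivity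
  calc _ = 816 / c * M / c₀ * (ρ ^ (-z) * ρ) * (1 / r ^ 3) + 9216 * M := by ring
    _ ≤ 816 / c * M / c₀ * (ρ ^ (-z) * ρ) * (64 * (1 / ρ ^ 3 + 1 / c₀ ^ 3)) + 9216 * M := by gcongr
    _ = 816 / c * 64 * M * (ρ ^ (-2 - z) / c₀ + ρ ^ (-z) * ρ * (1 / c₀ ^ 4)) + 9216 * M * 1 := by
        rw [e1]; field_simp
    _ ≤ 816 / c * 64 * M * (ρ ^ (-2 - z) / c₀ + 1 * (1 / c₀ ^ 4)) +
          9216 * M * (ρ ^ (-2 - z) / c₀ + 1 / c₀ ^ 4) := by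
        gcongr
        have : 0 ≤ ρ ^ (-2 - z) / c₀ := by positivity
        linarith
    _ = _ := by ring

lemma one_add_logPlus_le {y T : ℝ} (hy : 0 ≤ y) (hT : 1 ≤ T) (hyT : y ≤ T) :
    1 + logPlus y ≤ 21 * T ^ (1 / 20 : ℝ) := by
  have h1 : 1 ≤ T ^ (1 / 20 : ℝ) := Real.one_le_rpow hT (by norm_num)
  have h2 : Real.log y ≤ T ^ (1 / 20 : ℝ) / (1 / 20) := by
    refine (Real.log_le_rpow_div hy (by norm_num : (0 : ℝ) < 1 / 20)).trans ?_
    gcongr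
  have h3 : logPlus y ≤ 20 * T ^ (1 / 20 : ℝ) := max_le (by positivity) (by linarith)
  linarith

/-- A local branch of `logZeta` continued through the principal logarithm. -/
lemma logZeta_eventuallyEq {s : ℂ} (hs : 1 < s.re) :
    logZeta =ᶠ[𝓝 s] fun w => logZeta s + log (riemannZeta w / riemannZeta s) := by
  have hcont : ContinuousAt (fun w => logZeta w - logZeta s) s :=
    (hasDerivAt_logZeta hs).continuousAt.sub continuousAt_const
  have hm : Metric.ball (0 : ℂ) 1 ∈ 𝓝 (logZeta s - logZeta s) := by
    rw [sub_self]; exact Metric.ball_mem_nhds _ one_pos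
  filter_upwards [hcont hm, isOpen_halfPlane.mem_nhds hs] with w hw hw1
  have h1 : ‖logZeta w - logZeta s‖ < 1 := by simpa using hw
  have h2 := abs_lt.1 ((abs_im_le_norm _).trans_lt h1)
  have hpi := Real.pi_gt_three
  rw [← exp_logZeta hs, ← exp_logZeta hw1, ← Complex.exp_sub,
    Complex.log_exp (by linarith) (by linarith)]
  ring

lemma norm_modelSeries_le_of_near {c : ℝ} (hc0 : 0 < c) (hc1 : c ≤ 1) {z : ℝ} (hz : 0 ≤ z)
    (hz1 : z ≤ 1) {s w : ℂ} (hw : c / 2 ≤ ‖w - 1‖) (hre : 1 / 2 ≤ w.re)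
    (him : |s.im| ≤ |w.im| + 1 / 4) :
    ‖modelSeries z w‖ ≤ 63 / c / (1 + |s.im|) ^ 2 := by
  have hT : 0 < 1 + |s.im| := by positivity
  rcases le_or_gt 2 |s.im| with h2 | h2
  · have h3 : (1 + |s.im|) / 2 ≤ |w.im| := by linarith
    calc _ ≤ 2 / |w.im| ^ 2 := norm_modelSeries_le hz hz1 (by linarith)
      _ ≤ 2 / ((1 + |s.im|) / 2) ^ 2 := by gcongr
      _ = 8 / (1 + |s.im|) ^ 2 := by field_simp; norm_num
      _ ≤ _ := by
        gcongr
        rw [le_div_iff₀ hc0]; linarith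
  · have hone : ∀ {ρ : ℝ} {v : ℂ}, 0 < ρ → ρ ≤ 1 → ρ ≤ ‖v‖ → ‖v ^ (-(z : ℂ))‖ ≤ 1 / ρ := by
      intro ρ v h0 h1 hv
      refine (norm_cpow_neg_le_rpow h0 hv hz).trans ?_
      calc ρ ^ (-z) ≤ ρ ^ (-1 : ℝ) := Real.rpow_le_rpow_of_exponent_ge h0 h1 (by linarith)
        _ = _ := by rw [Real.rpow_neg_one, one_div]
    have b1 := hone (by positivity) (by linarith) hw
    have b2 := hone (by norm_num : (0 : ℝ) < 1 / 2) (by norm_num) (le_norm_of_le_re hre)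
    have b3 := hone one_pos le_rfl (le_norm_of_le_re (v := w + 1) (by simp; linarith))
    have hsum : ‖modelSeries z w‖ ≤ 7 / c := by
      calc ‖modelSeries z w‖ ≤ ‖(w - 1) ^ (-(z : ℂ))‖ + 2 * ‖w ^ (-(z : ℂ))‖ +
            ‖(w + 1) ^ (-(z : ℂ))‖ := by
            unfold modelSeries
            refine (norm_add_le _ _).trans ?_
            gcongr
            refine (norm_sub_le _ _).trans ?_
            rw [norm_mul, Complex.norm_ofNat]
        _ ≤ 1 / (c / 2) + 2 * (1 / (1 / 2)) + 1 / 1 := by gcongr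
        _ = 2 / c + 5 := by field_simp; ring
        _ ≤ 7 / c := by
          rw [show (7 : ℝ) / c = 2 / c + 5 / c by ring]
          gcongr
          rw [le_div_iff₀ hc0]; linarith
    refine hsum.trans ?_
    rw [le_div_iff₀ (by positivity), div_mul_eq_mul_div]
    gcongr
    nlinarith [abs_nonneg s.im]

lemma norm_iteratedDeriv_modelError_le_far {c : ℝ} (hc0 : 0 < c) (hc1 : c ≤ 1) :
    ∃ K : ℝ, 0 < K ∧ ∀ (z c₀ M : ℝ) (G : ℂ → ℂ), IsModerate z c₀ M G →
      ∀ δ : ℝ, δ ≠ 0 → |δ| ≤ 1 / 88 → ∀ s : ℂ, 1 < s.re → s.re ≤ 2 → c ≤ ‖s - 1‖ → ∀ n ≤ 3,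
        ‖iteratedDeriv n (modelError z δ G) s‖ ≤
          K * M / (|δ| * c₀ ^ 3) * (1 + |s.im|) ^ (-(134 / 100) : ℝ) := by
  obtain ⟨κ, K, hκ0, hκ, hK0, hζ⟩ := exists_riemannZeta_disc hc0 hc1
  refine ⟨6 * (96 * (1 + K) + 378 / c) * (21 / κ) ^ 3, by positivity, ?_⟩
  intro z c₀ M G hG δ hδ0 hδ s hs hs2 hsc n hn
  have hz := hG.exponent_nonneg
  have hz1 := hG.exponent_le_one
  have hw0 := hG.width_pos
  have hw1 := hG.width_le
  have hM := hG.bound_pos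
  have hδp : 0 < |δ| := abs_pos.2 hδ0
  have hs1 : 0 < (s - 1).re := by simpa using hs
  set T := 1 + |s.im| with hT
  have hT1 : 1 ≤ T := by linarith [abs_nonneg s.im]
  have hT0 : 0 < T := by linarith
  set r := κ * c₀ / 21 * T ^ (-(1 / 20) : ℝ) with hr
  have hr0 : 0 < r := by positivity
  have hTle : T ^ (-(1 / 20) : ℝ) ≤ 1 := Real.rpow_le_one_of_one_le_of_nonpos hT1 (by norm_num)
  have hrκ : r ≤ κ * T ^ (-(1 / 20) : ℝ) := by
    rw [hr]; gcongr; nlinarith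
  have hrc : r ≤ c / 40 := hrκ.trans (by nlinarith)
  have hrc₀ : r ≤ c₀ / (21 * T ^ (1 / 20 : ℝ)) := by
    rw [hr, Real.rpow_neg hT0.le]
    rw [show κ * c₀ / 21 * (T ^ (1 / 20 : ℝ))⁻¹ = κ * (c₀ / (21 * T ^ (1 / 20 : ℝ))) by field_simp]
    have : 0 < c₀ / (21 * T ^ (1 / 20 : ℝ)) := by positivity
    nlinarith
  have hnear : ∀ w ∈ Metric.closedBall s r, ‖w - s‖ ≤ r ∧ |w.im| ≤ T ∧ |s.im| ≤ |w.im| + 1 / 4 ∧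
      1 / 2 ≤ w.re ∧ w.re ≤ 3 ∧ c / 2 ≤ ‖w - 1‖ ∧ w ∈ sdRegion c₀ ∧ w - 1 ∈ slitPlane := by
    intro w hw
    have h1 : ‖w - s‖ ≤ r := by simpa [dist_eq_norm] using hw
    have hre := abs_le.1 ((abs_re_le_norm (w - s)).trans h1)
    have him := (abs_im_le_norm (w - s)).trans h1
    simp only [sub_re, sub_im] at hre him
    have i1 := abs_sub_abs_le_abs_sub w.im s.im
    have i2 := abs_sub_abs_le_abs_sub s.im w.im
    rw [abs_sub_comm] at i2
    have hwT : |w.im| ≤ T := by linarith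
    refine ⟨h1, hwT, by linarith, by linarith, by linarith, ?_, ?_, ?_⟩
    · have : ‖s - 1‖ ≤ ‖w - 1‖ + ‖w - s‖ := by
        calc ‖s - 1‖ = ‖(w - 1) - (w - s)‖ := by ring_nf
          _ ≤ _ := norm_sub_le _ _
      linarith
    · have h2 := one_add_logPlus_le (abs_nonneg w.im) hT1 hwT
      have h3 : 0 < 1 + logPlus |w.im| := by
        have : 0 ≤ logPlus |w.im| := le_max_left _ _
        linarith
      have h4 : c₀ / (21 * T ^ (1 / 20 : ℝ)) ≤ c₀ / (1 + logPlus |w.im|) := by gcongr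
      change 1 - c₀ / (1 + logPlus |w.im|) ≤ w.re
      linarith
    · refine mem_slitPlane_of_norm_sub_lt hs1 ?_
      rw [sub_sub_sub_cancel_right]
      linarith
  have hζs : riemannZeta s ≠ 0 := by rw [← exp_logZeta hs]; exact Complex.exp_ne_zero _
  set E : ℂ → ℂ := fun w => logZeta s + log (riemannZeta w / riemannZeta s) with hE
  set h : ℂ → ℂ := fun w => smoothFactor δ w * (G w * cexp (z * E w)) -
    G 1 * smoothFactor δ 1 * modelSeries z w with hh
  have hdisc := fun w (hw : w ∈ Metric.closedBall s r) =>
    hζ s hs hs2 hsc w ((hnear w hw).1.trans hrκ)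
  have hd : DifferentiableOn ℂ h (Metric.closedBall s r) := by
    intro w hw
    obtain ⟨-, -, -, b4, -, b6, b7, b8⟩ := hnear w hw
    have hw1 : w ≠ 1 := sub_ne_zero.1 (slitPlane_ne_zero b8)
    apply DifferentiableAt.differentiableWithinAt
    have d1 := differentiableAt_smoothFactor hδ0 (w := w) (by linarith)
    have d2 : DifferentiableAt ℂ E w :=
      (((differentiableAt_riemannZeta hw1).div_const _).clog
        (mem_slitPlane_of_norm_sub_one (hdisc w hw).1)).const_add _
    have d3 : DifferentiableAt ℂ (modelSeries z) w := by
      unfold modelSeries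
      refine DifferentiableAt.add (DifferentiableAt.sub ?_ (DifferentiableAt.const_mul ?_ _)) ?_
      · exact (differentiableAt_id.sub_const 1).cpow_const b8
      · exact differentiableAt_id.cpow_const (Or.inl (by simp; linarith))
      · exact (differentiableAt_id.add_const 1).cpow_const (Or.inl (by simp; linarith))
    exact (d1.mul ((hG.differentiableAt w b7).mul (d2.const_mul _).cexp)).sub (d3.const_mul _)
  have hB : ∀ w ∈ Metric.closedBall s r,
      ‖h w‖ ≤ (96 * (1 + K) + 378 / c) * M / |δ| * T ^ (-(149 / 100) : ℝ) := by
    intro w hw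
    obtain ⟨-, b2, b3, b4, b5, b6, b7, -⟩ := hnear w hw
    have hwT : T / 4 ≤ ‖w‖ := by
      rcases le_or_gt 1 |s.im| with h1 | h1
      · exact le_trans (by linarith) (abs_im_le_norm w)
      · exact le_trans (by linarith) (le_norm_of_le_re b4)
    have hW : ‖smoothFactor δ w‖ ≤ 48 / |δ| * T ^ (-2 : ℝ) := by
      calc _ ≤ 3 / (|δ| * ‖w‖ ^ 2) := norm_smoothFactor_le_far hδ (by linarith) b5
        _ ≤ 3 / (|δ| * (T / 4) ^ 2) := by gcongr
        _ = _ := by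
          rw [Real.rpow_neg hT0.le, Real.rpow_two]
          field_simp; norm_num
    have hGw : ‖G w‖ ≤ 2 * M * T ^ (1 / 2 : ℝ) := by
      calc ‖G w‖ ≤ M * (1 + |w.im|) ^ (1 / 2 : ℝ) := hG.norm_le w b7
        _ ≤ M * (2 * T) ^ (1 / 2 : ℝ) := by gcongr; linarith
        _ = M * (2 ^ (1 / 2 : ℝ) * T ^ (1 / 2 : ℝ)) := by rw [Real.mul_rpow (by norm_num) hT0.le]
        _ ≤ M * (2 ^ (1 : ℝ) * T ^ (1 / 2 : ℝ)) := by
          gcongr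
          · norm_num
          · norm_num
        _ = _ := by rw [Real.rpow_one]; ring
    have hexp : cexp (E w) = riemannZeta w := by
      have := slitPlane_ne_zero (mem_slitPlane_of_norm_sub_one (hdisc w hw).1)
      simp only [hE]
      rw [Complex.exp_add, exp_logZeta hs, exp_log this, mul_div_cancel₀ _ hζs]
    have hF : ‖cexp (z * E w)‖ ≤ (1 + K) * T ^ (1 / 100 : ℝ) := by
      have h1 : ‖cexp (z * E w)‖ = ‖riemannZeta w‖ ^ z := by
        rw [← hexp, norm_exp, norm_exp, re_ofReal_mul, ← Real.exp_mul, mul_comm]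
      have h2 : ‖riemannZeta w‖ ^ z ≤ 1 + ‖riemannZeta w‖ := by
        calc ‖riemannZeta w‖ ^ z ≤ (1 + ‖riemannZeta w‖) ^ z := by gcongr; linarith
          _ ≤ (1 + ‖riemannZeta w‖) ^ (1 : ℝ) :=
            Real.rpow_le_rpow_of_exponent_le (by linarith [norm_nonneg (riemannZeta w)]) hz1
          _ = _ := Real.rpow_one _
      have h3 : 1 ≤ T ^ (1 / 100 : ℝ) := Real.one_le_rpow hT1 (by norm_num)
      rw [h1]
      linarith [(hdisc w hw).2]
    have hmod := norm_modelSeries_le_of_near hc0 hc1 hz hz1 b6 b4 b3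
    have hW1 : ‖smoothFactor δ 1‖ ≤ 6 := norm_smoothFactor_le_near hδ (by simp)
    have t1 : T ^ (-2 : ℝ) * T ^ (1 / 2 : ℝ) * T ^ (1 / 100 : ℝ) = T ^ (-(149 / 100) : ℝ) := by
      rw [← Real.rpow_add hT0, ← Real.rpow_add hT0]; norm_num
    have t2 : 1 / T ^ 2 ≤ T ^ (-(149 / 100) : ℝ) := by
      rw [show 1 / T ^ 2 = T ^ (-2 : ℝ) by rw [Real.rpow_neg hT0.le, Real.rpow_two, one_div]]
      exact Real.rpow_le_rpow_of_exponent_le hT1 (by norm_num)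
    have t3 : (1 : ℝ) ≤ 1 / |δ| := by rw [le_div_iff₀ hδp]; linarith
    simp only [hh]
    calc _ ≤ ‖smoothFactor δ w‖ * (‖G w‖ * ‖cexp (z * E w)‖) +
          ‖G 1‖ * ‖smoothFactor δ 1‖ * ‖modelSeries z w‖ := by
          rw [← norm_mul, ← norm_mul, ← norm_mul, ← norm_mul]; exact norm_sub_le _ _
      _ ≤ 48 / |δ| * T ^ (-2 : ℝ) * (2 * M * T ^ (1 / 2 : ℝ) * ((1 + K) * T ^ (1 / 100 : ℝ))) +
          M * 6 * (63 / c / T ^ 2) := by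
          gcongr
          exact hG.norm_one_le
      _ = 96 * (1 + K) * M / |δ| * (T ^ (-2 : ℝ) * T ^ (1 / 2 : ℝ) * T ^ (1 / 100 : ℝ)) +
          378 / c * M * 1 * (1 / T ^ 2) := by ring
      _ ≤ 96 * (1 + K) * M / |δ| * T ^ (-(149 / 100) : ℝ) +
          378 / c * M * (1 / |δ|) * T ^ (-(149 / 100) : ℝ) := by
          rw [t1]; gcongr
      _ = _ := by ring
  have hf : modelError z δ G =ᶠ[𝓝 s] h := by
    filter_upwards [logZeta_eventuallyEq hs] with w hw
    simp only [modelError, hh, hE, hw]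
  rw [hf.iteratedDeriv_eq]
  refine (norm_iteratedDeriv_le_of_closedBall hr0 (by linarith) hd hB hn).trans (le_of_eq ?_)
  have e1 : T ^ (-(134 / 100) : ℝ) = T ^ (-(149 / 100) : ℝ) / (T ^ (-(1 / 20) : ℝ)) ^ 3 := by
    rw [← Real.rpow_natCast, ← Real.rpow_mul hT0.le, ← Real.rpow_sub hT0]
    norm_num
  rw [e1, hr]
  field_simp

lemma integrable_and_integral_inv_sq_add_sq {L : ℝ} (hL : 0 < L) :
    (Integrable fun t : ℝ => ((L⁻¹) ^ 2 + t ^ 2)⁻¹) ∧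
      ∫ t : ℝ, ((L⁻¹) ^ 2 + t ^ 2)⁻¹ = Real.pi * L := by
  have e : (fun t : ℝ => ((L⁻¹) ^ 2 + t ^ 2)⁻¹) = fun t : ℝ => L ^ 2 * (1 + (L * t) ^ 2)⁻¹ := by
    funext t
    have h1 : (0 : ℝ) < 1 + (L * t) ^ 2 := by positivity
    have h2 : (0 : ℝ) < (L⁻¹) ^ 2 + t ^ 2 := by positivity
    rw [eq_comm, ← div_eq_mul_inv, div_eq_iff h1.ne', ← div_eq_inv_mul, eq_div_iff h2.ne']
    field_simp
  rw [e]
  refine ⟨((integrable_inv_one_add_sq).comp_mul_left' hL.ne').const_mul _, ?_⟩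
  rw [integral_const_mul, Measure.integral_comp_mul_left (fun u : ℝ => (1 + u ^ 2)⁻¹),
    integral_univ_inv_one_add_sq, abs_of_pos (by positivity), smul_eq_mul]
  field_simp

/-- Majorant of the derivatives of `modelError` on the line `Re s = 1 + 1 / L`. -/
def errorMajorant (z c₀ M L : ℝ) (t : ℝ) : ℝ :=
  M * (L ^ z / c₀ * ((L⁻¹) ^ 2 + t ^ 2)⁻¹ + L / c₀ ^ 3 * (1 + |t|) ^ (-(134 / 100) : ℝ))

lemma integrable_one_add_abs_rpow :
    Integrable fun t : ℝ => (1 + |t|) ^ (-(134 / 100) : ℝ) := by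
  have := integrable_one_add_norm (E := ℝ) (μ := volume) (r := 134 / 100) (by simp; norm_num)
  simpa using this

lemma integrable_errorMajorant (z c₀ M : ℝ) {L : ℝ} (hL : 0 < L) :
    Integrable (errorMajorant z c₀ M L) :=
  (((integrable_and_integral_inv_sq_add_sq hL).1.const_mul _).add
    (integrable_one_add_abs_rpow.const_mul _)).const_mul M

lemma integral_errorMajorant_le : ∃ K : ℝ, 0 < K ∧ ∀ (z c₀ M L : ℝ), 0 ≤ z → 0 < c₀ → c₀ ≤ 1 →
    0 < M → 1 ≤ L → ∫ t, errorMajorant z c₀ M L t ≤ K * M / c₀ ^ 3 * L ^ (z + 1) := by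
  set J := ∫ t : ℝ, (1 + |t|) ^ (-(134 / 100) : ℝ) with hJ
  have hJ0 : 0 ≤ J := integral_nonneg fun t => by positivity
  have hpi := Real.pi_pos
  refine ⟨Real.pi + J, by positivity, ?_⟩
  intro z c₀ M L hz hc0 hc1 hM hL
  have hL0 : 0 < L := by linarith
  unfold errorMajorant
  rw [integral_const_mul, integral_add ((integrable_and_integral_inv_sq_add_sq hL0).1.const_mul _)
    (integrable_one_add_abs_rpow.const_mul _), integral_const_mul, integral_const_mul,
    (integrable_and_integral_inv_sq_add_sq hL0).2, ← hJ]
  have e1 : L ^ (z + 1) = L ^ z * L := Real.rpow_add_one hL0.ne' z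
  have e2 : 1 ≤ L ^ z := Real.one_le_rpow hL hz
  have e3 : c₀ ^ 3 ≤ c₀ := by
    calc c₀ ^ 3 = c₀ * c₀ ^ 2 := by ring
      _ ≤ c₀ * 1 := by gcongr; exact pow_le_one₀ hc0.le hc1
      _ = c₀ := mul_one _
  calc M * (L ^ z / c₀ * (Real.pi * L) + L / c₀ ^ 3 * J)
      ≤ M * (L ^ z / c₀ ^ 3 * (Real.pi * L) + (L ^ z * L) / c₀ ^ 3 * J) := by
        gcongr
        nlinarith
    _ = _ := by rw [e1]; ring

lemma norm_iteratedDeriv_modelError_le : ∃ K : ℝ, 0 < K ∧ ∀ (z c₀ M : ℝ) (G : ℂ → ℂ),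
    IsModerate z c₀ M G → ∀ L : ℝ, 16 / c₀ ≤ L → ∀ δ : ℝ, |δ| = L⁻¹ → ∀ n ≤ 3, ∀ t : ℝ,
      ‖iteratedDeriv n (modelError z δ G) (((1 + L⁻¹ : ℝ) : ℂ) + t * I)‖ ≤
        K * errorMajorant z c₀ M L t := by
  obtain ⟨c, hc0, hc8, hc⟩ := exists_riemannZeta₁_near_one
  obtain ⟨K₁, hK₁, h₁⟩ := norm_iteratedDeriv_modelError_le_near hc0 hc8 hc
  obtain ⟨K₂, hK₂, h₂⟩ := norm_iteratedDeriv_modelError_le_far hc0 (hc8.trans (by norm_num))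
  refine ⟨4 * K₁ + K₂, by positivity, ?_⟩
  intro z c₀ M G hG L hL δ hδ n hn t
  have hz := hG.exponent_nonneg
  have hw0 := hG.width_pos
  have hw1 := hG.width_le
  have hM := hG.bound_pos
  have hL88 : 88 ≤ L := by
    refine le_trans ?_ hL
    rw [le_div_iff₀ hw0]; linarith
  have hL0 : 0 < L := by linarith
  have hLi : L⁻¹ ≤ 1 / 88 := by
    rw [one_div]; exact inv_anti₀ (by norm_num) hL88
  have hLi0 : 0 < L⁻¹ := by positivity
  have hδ88 : |δ| ≤ 1 / 88 := hδ ▸ hLi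
  have hδ0 : δ ≠ 0 := abs_pos.1 (hδ ▸ hLi0)
  set s : ℂ := ((1 + L⁻¹ : ℝ) : ℂ) + t * I with hs
  have hre : s.re = 1 + L⁻¹ := by simp [hs]
  have him : s.im = t := by simp [hs]
  have hρ : ‖s - 1‖ ^ 2 = (L⁻¹) ^ 2 + t ^ 2 := by
    rw [← normSq_eq_norm_sq, normSq_apply]
    simp [hre, him]; ring
  have hρL : L⁻¹ ≤ ‖s - 1‖ := le_norm_of_le_re (by simp [hre])
  have hρ0 : 0 < ‖s - 1‖ := hLi0.trans_le hρL
  have hm2 : 0 ≤ L / c₀ ^ 3 * (1 + |t|) ^ (-(134 / 100) : ℝ) := by positivity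
  have hm1 : 0 ≤ L ^ z / c₀ * ((L⁻¹) ^ 2 + t ^ 2)⁻¹ := by positivity
  rcases le_total ‖s - 1‖ c with hle | hge
  · have hb := h₁ z c₀ M G hG δ hδ0 hδ88 s (by rw [hre]; linarith) hle n hn
    refine hb.trans ?_
    have e1 : ‖s - 1‖ ^ (-2 - z) ≤ L ^ z * ((L⁻¹) ^ 2 + t ^ 2)⁻¹ := by
      rw [Real.rpow_sub hρ0, Real.rpow_neg hρ0.le, Real.rpow_two, hρ, div_eq_mul_inv, mul_comm]
      gcongr
      rw [← Real.rpow_neg hρ0.le]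
      calc ‖s - 1‖ ^ (-z) ≤ (L⁻¹) ^ (-z) :=
            Real.rpow_le_rpow_of_nonpos hLi0 hρL (by linarith)
        _ = L ^ z := by rw [Real.rpow_neg hLi0.le, Real.inv_rpow hL0.le, inv_inv]
    have e2 : 1 / c₀ ^ 4 ≤ L / c₀ ^ 3 := by
      rw [div_le_div_iff₀ (by positivity) (by positivity)]
      have : 16 ≤ L * c₀ := (div_le_iff₀ hw0).1 hL
      nlinarith [pow_pos hw0 3]
    have e3 : 1 / 4 ≤ (1 + |t|) ^ (-(134 / 100) : ℝ) := by
      have ht : |t| ≤ 1 := by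
        have := (abs_im_le_norm (s - 1)).trans hle
        simp [him] at this
        linarith
      calc (1 / 4 : ℝ) = 2 ^ (-2 : ℝ) := by norm_num
        _ ≤ 2 ^ (-(134 / 100) : ℝ) := Real.rpow_le_rpow_of_exponent_le (by norm_num) (by norm_num)
        _ ≤ _ := Real.rpow_le_rpow_of_nonpos (by positivity) (by linarith) (by norm_num)
    have e4 : 1 / c₀ ^ 4 ≤ 4 * (L / c₀ ^ 3 * (1 + |t|) ^ (-(134 / 100) : ℝ)) := by
      have : 0 < L / c₀ ^ 3 := by positivity
      nlinarith
    unfold errorMajorant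
    calc K₁ * M * (‖s - 1‖ ^ (-2 - z) / c₀ + 1 / c₀ ^ 4)
        ≤ K₁ * M * (L ^ z * ((L⁻¹) ^ 2 + t ^ 2)⁻¹ / c₀ +
          4 * (L / c₀ ^ 3 * (1 + |t|) ^ (-(134 / 100) : ℝ))) := by gcongr
      _ = K₁ * M * (L ^ z / c₀ * ((L⁻¹) ^ 2 + t ^ 2)⁻¹ +
          4 * (L / c₀ ^ 3 * (1 + |t|) ^ (-(134 / 100) : ℝ))) := by ring
      _ ≤ K₁ * M * (4 * (L ^ z / c₀ * ((L⁻¹) ^ 2 + t ^ 2)⁻¹) +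
          4 * (L / c₀ ^ 3 * (1 + |t|) ^ (-(134 / 100) : ℝ))) := by
          have := le_mul_of_one_le_left hm1 (by norm_num : (1 : ℝ) ≤ 4)
          exact mul_le_mul_of_nonneg_left (by linarith) (by positivity)
      _ ≤ (4 * K₁) * (M * (L ^ z / c₀ * ((L⁻¹) ^ 2 + t ^ 2)⁻¹ +
          L / c₀ ^ 3 * (1 + |t|) ^ (-(134 / 100) : ℝ))) := le_of_eq (by ring)
      _ ≤ _ := by gcongr; linarith
  · have hb := h₂ z c₀ M G hG δ hδ0 hδ88 s (by rw [hre]; linarith) (by rw [hre]; linarith) hge n hn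
    refine hb.trans ?_
    rw [him, hδ]
    unfold errorMajorant
    calc _ = K₂ * (M * (L / c₀ ^ 3 * (1 + |t|) ^ (-(134 / 100) : ℝ))) := by field_simp
      _ ≤ (4 * K₁ + K₂) * (M * (L / c₀ ^ 3 * (1 + |t|) ^ (-(134 / 100) : ℝ))) := by
          gcongr; linarith
      _ ≤ _ := by gcongr; linarith

lemma differentiableOn_modelError {z c₀ M : ℝ} {G : ℂ → ℂ} (hG : IsModerate z c₀ M G) {δ : ℝ}
    (hδ0 : δ ≠ 0) : DifferentiableOn ℂ (modelError z δ G) {s | 1 < s.re} := by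
  intro w hw
  have hw1 : 1 < w.re := hw
  have hmem : w ∈ sdRegion c₀ := by
    have h0 : 0 ≤ logPlus |w.im| := le_max_left _ _
    have := hG.width_pos
    have : 0 ≤ c₀ / (1 + logPlus |w.im|) := by positivity
    change 1 - c₀ / (1 + logPlus |w.im|) ≤ w.re
    linarith
  apply DifferentiableAt.differentiableWithinAt
  have d1 := differentiableAt_smoothFactor hδ0 (w := w) (by linarith)
  have d2 := (hasDerivAt_logZeta hw1).differentiableAt
  have d3 : DifferentiableAt ℂ (modelSeries z) w := by
    unfold modelSeries
    refine DifferentiableAt.add (DifferentiableAt.sub ?_ (DifferentiableAt.const_mul ?_ _)) ?_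
    · exact (differentiableAt_id.sub_const 1).cpow_const (Or.inl (by simpa using hw1))
    · exact differentiableAt_id.cpow_const (Or.inl (by simp; linarith))
    · exact (differentiableAt_id.add_const 1).cpow_const (Or.inl (by simp; linarith))
  exact (d1.mul ((hG.differentiableAt w hmem).mul (d2.const_mul _).cexp)).sub (d3.const_mul _)

lemma norm_integral_modelError_le : ∃ K : ℝ, 0 < K ∧ ∀ (z c₀ M : ℝ) (G : ℂ → ℂ),
    IsModerate z c₀ M G → ∀ L : ℝ, 16 / c₀ ≤ L → ∀ δ : ℝ, |δ| = L⁻¹ →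
      (Integrable fun t : ℝ => modelError z δ G (((1 + L⁻¹ : ℝ) : ℂ) + t * I)) ∧
      ‖∫ t : ℝ, modelError z δ G (((1 + L⁻¹ : ℝ) : ℂ) + t * I) * cexp (t * I * L)‖ ≤
        K * M / c₀ ^ 3 * L ^ (z - 2) := by
  obtain ⟨K₁, hK₁, h₁⟩ := norm_iteratedDeriv_modelError_le
  obtain ⟨K₂, hK₂, h₂⟩ := integral_errorMajorant_le
  refine ⟨K₁ * K₂, by positivity, ?_⟩
  intro z c₀ M G hG L hL δ hδ
  have hw0 := hG.width_pos
  have hw1 := hG.width_le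
  have hL1 : 1 ≤ L := by
    refine le_trans ?_ hL
    rw [le_div_iff₀ hw0]; linarith
  have hL0 : 0 < L := by linarith
  have hδ0 : δ ≠ 0 := abs_pos.1 (by rw [hδ]; positivity)
  have hσ : 1 < 1 + L⁻¹ := by
    have : 0 < L⁻¹ := by positivity
    linarith
  have hInt := (integrable_errorMajorant z c₀ M hL0).const_mul K₁
  have hdiff := differentiableOn_modelError hG hδ0
  have hbound := h₁ z c₀ M G hG L hL δ hδ
  constructor
  · refine hInt.mono' ?_ (ae_of_all _ fun t => ?_)
    · refine Continuous.aestronglyMeasurable ?_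
      rw [← continuousOn_univ]
      refine hdiff.continuousOn.comp (by fun_prop) fun t _ => ?_
      simpa using hσ
    · simpa using hbound 0 (by norm_num) t
  · have h3 := norm_integral_mul_cexp_le hdiff hσ hInt hbound hL0
    rw [integral_const_mul] at h3
    have h4 := h₂ z c₀ M L hG.exponent_nonneg hw0 (by linarith) hG.bound_pos hL1
    have e : L ^ (z + 1) = L ^ 3 * L ^ (z - 2) := by
      rw [← Real.rpow_natCast, ← Real.rpow_add hL0]; congr 1; push_cast; ring
    rw [e] at h4
    have h5 : L ^ 3 * ‖∫ t : ℝ, modelError z δ G (((1 + L⁻¹ : ℝ) : ℂ) + t * I) *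
        cexp (t * I * L)‖ ≤ L ^ 3 * (K₁ * K₂ * M / c₀ ^ 3 * L ^ (z - 2)) := by
      refine h3.trans ?_
      calc _ ≤ K₁ * (K₂ * M / c₀ ^ 3 * (L ^ 3 * L ^ (z - 2))) := by gcongr
        _ = _ := by ring
    exact le_of_mul_le_mul_left h5 (by positivity)

lemma norm_DSeries_le {a : ℕ → ℝ}
    (hsum : ∀ s : ℂ, 1 < s.re → Summable fun n : ℕ => ‖(a (n + 1) : ℂ) / ((n + 1 : ℕ) : ℂ) ^ s‖)
    {σ : ℝ} (hσ : 1 < σ) (t : ℝ) :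
    ‖DSeries (fun n => (a n : ℂ)) ((σ : ℂ) + t * I)‖ ≤
      ∑' n : ℕ, ‖(a (n + 1) : ℂ) / ((n + 1 : ℕ) : ℂ) ^ (σ : ℂ)‖ := by
  have e : ∀ n : ℕ, ‖(a (n + 1) : ℂ) / ((n + 1 : ℕ) : ℂ) ^ ((σ : ℂ) + t * I)‖ =
      ‖(a (n + 1) : ℂ) / ((n + 1 : ℕ) : ℂ) ^ (σ : ℂ)‖ := by
    intro n
    rw [norm_div, norm_div, norm_natCast_add_one_cpow, norm_natCast_add_one_cpow]
    simp
  unfold DSeries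
  refine (norm_tsum_le_tsum_norm (hsum _ (by simpa using hσ))).trans (le_of_eq ?_)
  exact tsum_congr e

lemma integrable_DSeries_mul_cpow {a : ℕ → ℝ}
    (hsum : ∀ s : ℂ, 1 < s.re → Summable fun n : ℕ => ‖(a (n + 1) : ℂ) / ((n + 1 : ℕ) : ℂ) ^ s‖)
    {σ : ℝ} (hσ : 1 < σ)
    (hcont : Continuous fun t : ℝ => DSeries (fun n => (a n : ℂ)) ((σ : ℂ) + t * I))
    {x : ℝ} (hx : 0 < x) :
    Integrable fun t : ℝ => DSeries (fun n => (a n : ℂ)) ((σ : ℂ) + t * I) *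
      (x : ℂ) ^ ((σ : ℂ) + t * I) * (1 / (((σ : ℂ) + t * I) * ((σ : ℂ) + t * I + 1))) := by
  have hc2 : Continuous fun t : ℝ => (x : ℂ) ^ ((σ : ℂ) + t * I) :=
    Continuous.const_cpow (by fun_prop) (Or.inl (by exact_mod_cast hx.ne'))
  refine (integrable_perronKernel hσ.le).bdd_mul (hcont.mul hc2).aestronglyMeasurable
    (c := (∑' n : ℕ, ‖(a (n + 1) : ℂ) / ((n + 1 : ℕ) : ℂ) ^ (σ : ℂ)‖) * x ^ σ)
    (ae_of_all _ fun t => ?_)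
  rw [norm_mul, norm_cpow_eq_rpow_re_of_pos hx]
  simp only [add_re, ofReal_re, mul_re, I_re, mul_zero, ofReal_im, I_im, mul_one, sub_self,
    add_zero]
  gcongr
  exact norm_DSeries_le hsum hσ t

/-- Perron formula for a difference quotient of `rieszSum`. -/
lemma rieszSum_sub_div {a : ℕ → ℝ}
    (hsum : ∀ s : ℂ, 1 < s.re → Summable fun n : ℕ => ‖(a (n + 1) : ℂ) / ((n + 1 : ℕ) : ℂ) ^ s‖)
    {σ : ℝ} (hσ : 1 < σ)
    (hcont : Continuous fun t : ℝ => DSeries (fun n => (a n : ℂ)) ((σ : ℂ) + t * I))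
    {x : ℝ} (hx : 0 < x) {δ : ℝ} (hδ0 : δ ≠ 0) (hδ : |δ| ≤ 1 / 88) :
    (((rieszSum a ((1 + δ) * x) - rieszSum a x) / (δ * x) : ℝ) : ℂ) =
      (x ^ σ : ℝ) * ((1 / (2 * Real.pi) : ℝ) * ∫ t : ℝ, smoothFactor δ ((σ : ℂ) + t * I) *
        DSeries (fun n => (a n : ℂ)) ((σ : ℂ) + t * I) * cexp (t * I * (Real.log x : ℝ))) := by
  have hp : 0 < 1 + δ := by linarith [(abs_le.1 hδ).1]
  have hy : 0 < (1 + δ) * x := by positivity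
  have hδc : (δ : ℂ) ≠ 0 := by exact_mod_cast hδ0
  have hxc : (x : ℂ) ≠ 0 := by exact_mod_cast hx.ne'
  have hpc : ((1 + δ : ℝ) : ℂ) ≠ 0 := by exact_mod_cast hp.ne'
  set J : ℝ → ℝ → ℂ := fun y t => DSeries (fun n => (a n : ℂ)) ((σ : ℂ) + t * I) *
    (y : ℂ) ^ ((σ : ℂ) + t * I) * (1 / (((σ : ℂ) + t * I) * ((σ : ℂ) + t * I + 1))) with hJ
  have h1 : (1 / (2 * Real.pi) : ℝ) * ∫ t, J x t = (rieszSum a x / x : ℝ) :=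
    integral_DSeries_mul_cpow hsum hσ hx
  have h2 : (1 / (2 * Real.pi) : ℝ) * ∫ t, J ((1 + δ) * x) t =
      (rieszSum a ((1 + δ) * x) / ((1 + δ) * x) : ℝ) := integral_DSeries_mul_cpow hsum hσ hy
  have i1 : Integrable (J x) := integrable_DSeries_mul_cpow hsum hσ hcont hx
  have i2 : Integrable (J ((1 + δ) * x)) := integrable_DSeries_mul_cpow hsum hσ hcont hy
  have e : ∀ t : ℝ, (x ^ σ : ℝ) * (smoothFactor δ ((σ : ℂ) + t * I) *
        DSeries (fun n => (a n : ℂ)) ((σ : ℂ) + t * I) * cexp (t * I * (Real.log x : ℝ))) =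
      ((1 + δ : ℝ) / δ : ℂ) * J ((1 + δ) * x) t - (1 / δ : ℂ) * J x t := by
    intro t
    have hx1 : (x : ℂ) ^ ((σ : ℂ) + t * I) = (x ^ σ : ℝ) * cexp (t * I * (Real.log x : ℝ)) := by
      rw [cpow_add _ _ hxc, ofReal_cpow hx.le, cpow_def_of_ne_zero hxc (t * I), ← ofReal_log hx.le,
        mul_comm (Real.log x : ℂ)]
    have hx2 : (((1 + δ) * x : ℝ) : ℂ) ^ ((σ : ℂ) + t * I) * (1 + δ : ℝ) =
        cexp (((σ : ℂ) + t * I + 1) * (Real.log (1 + δ) : ℝ)) * (x : ℂ) ^ ((σ : ℂ) + t * I) := by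
      rw [ofReal_mul, mul_cpow_ofReal_nonneg hp.le hx.le, add_mul, one_mul, Complex.exp_add,
        ← ofReal_exp, Real.exp_log hp, cpow_def_of_ne_zero hpc, ← ofReal_log hp.le,
        mul_comm (Real.log (1 + δ) : ℂ)]
      ring
    simp only [hJ, smoothFactor]
    calc _ = ((cexp (((σ : ℂ) + t * I + 1) * (Real.log (1 + δ) : ℝ)) *
          (x : ℂ) ^ ((σ : ℂ) + t * I) - (x : ℂ) ^ ((σ : ℂ) + t * I)) *
          (DSeries (fun n => (a n : ℂ)) ((σ : ℂ) + t * I) *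
            (1 / (((σ : ℂ) + t * I) * ((σ : ℂ) + t * I + 1))) / δ)) := by
          rw [hx1, div_eq_mul_inv _ ((δ : ℂ) * _), mul_inv]; ring
      _ = _ := by rw [← hx2]; ring
  rw [mul_left_comm, ← integral_const_mul]
  simp_rw [e]
  rw [integral_sub (i2.const_mul _) (i1.const_mul _), integral_const_mul, integral_const_mul,
    mul_sub, mul_left_comm, mul_left_comm _ (1 / δ : ℂ), h1, h2, ← ofReal_div, ← ofReal_mul]
  rw [show (1 / δ : ℂ) = ((1 / δ : ℝ) : ℂ) by push_cast; rfl, ← ofReal_mul, ← ofReal_sub]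
  congr 1
  field_simp

lemma abs_one_add_mul_sq_sub_one_le {L δ : ℝ} (hL : 1 ≤ L) (hδ : |δ| = L⁻¹) :
    |(1 + δ / 2) * (1 - Real.exp (-L)) ^ 2 - 1| ≤ 3 * L⁻¹ := by
  set q := Real.exp (-L) with hq
  have hq0 : 0 < q := Real.exp_pos _
  have hq1 : q ≤ L⁻¹ := by
    rw [hq, Real.exp_neg]
    exact inv_anti₀ (by linarith) (by linarith [Real.add_one_le_exp L])
  have hL1 : L⁻¹ ≤ 1 := inv_le_one_of_one_le₀ hL
  have hsq : (1 - q) ^ 2 ≤ 1 := by nlinarith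
  have e : (1 + δ / 2) * (1 - q) ^ 2 - 1 = ((1 - q) ^ 2 - 1) + δ / 2 * (1 - q) ^ 2 := by ring
  rw [e]
  have h1 : |(1 - q) ^ 2 - 1| ≤ 2 * L⁻¹ := by
    rw [abs_le]; constructor <;> nlinarith
  have h2 : |δ / 2 * (1 - q) ^ 2| ≤ L⁻¹ := by
    rw [abs_mul, abs_div, hδ, abs_of_nonneg (sq_nonneg (1 - q)), abs_two]
    have : 0 < L⁻¹ := by positivity
    nlinarith [sq_nonneg (1 - q)]
  exact (abs_add_le _ _).trans (by linarith)

lemma exists_norm_inv_Gamma_le : ∃ K : ℝ, 0 < K ∧ ∀ z : ℝ, 0 ≤ z → z ≤ 1 →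
    |(Real.Gamma z)⁻¹| ≤ K := by
  obtain ⟨K, hK⟩ := (isCompact_closedBall (0 : ℂ) 1).exists_bound_of_continuousOn
    (Complex.differentiable_one_div_Gamma.continuous.continuousOn)
  refine ⟨max K 1, by positivity, fun z hz hz1 => ?_⟩
  have := hK z (by simp [abs_of_nonneg hz, hz1])
  rw [Complex.Gamma_ofReal, ← ofReal_inv, norm_real, Real.norm_eq_abs] at this
  exact this.trans (le_max_left _ _)

/-- Asymptotics of a difference quotient of `rieszSum`. -/
lemma norm_rieszSum_sub_div_sub_le : ∃ K : ℝ, 0 < K ∧ ∀ (z c₀ M : ℝ) (G : ℂ → ℂ) (a : ℕ → ℝ),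
    IsModerate z c₀ M G →
    (∀ s : ℂ, 1 < s.re → Summable fun n : ℕ => ‖(a (n + 1) : ℂ) / ((n + 1 : ℕ) : ℂ) ^ s‖) →
    (∀ s : ℂ, 1 < s.re → G s = DSeries (fun n => (a n : ℂ)) s * cexp (-z * logZeta s)) →
    ∀ x : ℝ, 0 < x → 16 / c₀ ≤ Real.log x → ∀ δ : ℝ, |δ| = (Real.log x)⁻¹ →
      ‖(((rieszSum a ((1 + δ) * x) - rieszSum a x) / (δ * x) : ℝ) : ℂ) -
        x * (Real.log x ^ (z - 1) : ℝ) * G 1 / Complex.Gamma z‖ ≤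
        K * x * M / c₀ ^ 3 * Real.log x ^ (z - 2) := by
  obtain ⟨K₁, hK₁, h₁⟩ := norm_integral_modelError_le
  obtain ⟨K₂, hK₂, h₂⟩ := exists_norm_inv_Gamma_le
  refine ⟨Real.exp 1 * K₁ + 3 * K₂, by positivity, ?_⟩
  intro z c₀ M G a hG hsum hGF x hx hL δ hδ
  have hz := hG.exponent_nonneg
  have hz1 := hG.exponent_le_one
  have hw0 := hG.width_pos
  have hw1 := hG.width_le
  have hM := hG.bound_pos
  set L := Real.log x with hLdef
  have hL88 : 88 ≤ L := by
    refine le_trans ?_ hL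
    rw [le_div_iff₀ hw0]; linarith
  have hL0 : 0 < L := by linarith
  have hLi0 : 0 < L⁻¹ := by positivity
  have hδ88 : |δ| ≤ 1 / 88 := by
    rw [hδ, one_div]; exact inv_anti₀ (by norm_num) hL88
  have hδ0 : δ ≠ 0 := abs_pos.1 (by rw [hδ]; exact hLi0)
  set σ : ℝ := 1 + L⁻¹ with hσdef
  have hσ : 1 < σ := by linarith
  have hF : ∀ s : ℂ, 1 < s.re → DSeries (fun n => (a n : ℂ)) s = G s * cexp (z * logZeta s) := by
    intro s hs
    rw [hGF s hs, mul_assoc, ← Complex.exp_add]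
    simp
  have hline : ∀ t : ℝ, 1 < ((σ : ℂ) + t * I).re := fun t => by simpa using hσ
  have hcont : Continuous fun t : ℝ => DSeries (fun n => (a n : ℂ)) ((σ : ℂ) + t * I) := by
    rw [continuous_iff_continuousAt]
    intro t
    have hmem : ((σ : ℂ) + t * I) ∈ sdRegion c₀ := by
      have h0 : 0 ≤ logPlus |((σ : ℂ) + t * I).im| := le_max_left _ _
      have : 0 ≤ c₀ / (1 + logPlus |((σ : ℂ) + t * I).im|) := by positivity
      change 1 - c₀ / (1 + logPlus |((σ : ℂ) + t * I).im|) ≤ ((σ : ℂ) + t * I).re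
      linarith [hline t]
    have c1 := (hG.differentiableAt _ hmem).continuousAt
    have c2 := (hasDerivAt_logZeta (hline t)).continuousAt
    have c3 : ContinuousAt (fun s => G s * cexp (z * logZeta s)) ((σ : ℂ) + t * I) :=
      c1.mul ((continuousAt_const.mul c2).cexp)
    have c4 : ContinuousAt (fun t : ℝ => (σ : ℂ) + t * I) t := by fun_prop
    refine (ContinuousAt.comp (f := fun t : ℝ => (σ : ℂ) + t * I) c3 c4).congr
      (Eventually.of_forall fun u => ?_)
    exact (hF _ (hline u)).symm
  obtain ⟨hInt, hbd⟩ := h₁ z c₀ M G hG L hL δ hδ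
  have hi1 : ∀ f : ℝ → ℂ, Integrable f → Integrable fun t : ℝ => f t * cexp (t * I * L) := by
    intro f hf
    refine hf.norm.mono' (hf.1.mul (Continuous.aestronglyMeasurable (by fun_prop)))
      (ae_of_all _ fun t => ?_)
    rw [norm_mul, show (t : ℂ) * I * L = ((t * L : ℝ) : ℂ) * I by push_cast; ring,
      norm_exp_ofReal_mul_I, mul_one]
  have hsplit : ∫ t : ℝ, smoothFactor δ ((σ : ℂ) + t * I) *
      DSeries (fun n => (a n : ℂ)) ((σ : ℂ) + t * I) * cexp (t * I * L) =
      (∫ t : ℝ, modelError z δ G ((σ : ℂ) + t * I) * cexp (t * I * L)) +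
      G 1 * smoothFactor δ 1 * ∫ t : ℝ, modelSeries z ((σ : ℂ) + t * I) * cexp (t * I * L) := by
    rw [← integral_const_mul, ← integral_add (hi1 _ hInt)
      ((hi1 _ (integrable_modelSeries hz hz1 hσ)).const_mul _)]
    refine integral_congr_ae (ae_of_all _ fun t => ?_)
    simp only [modelError, hF _ (hline t)]
    ring
  have hmain := rieszSum_sub_div hsum hσ hcont hx hδ0 hδ88
  rw [← hLdef, hsplit, mul_add, mul_left_comm _ (G 1 * smoothFactor δ 1),
    integral_modelSeries hz hz1 hσ hL0, smoothFactor_one hδ0 hδ88] at hmain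
  have hxσ : x ^ σ = x * Real.exp 1 := by
    rw [hσdef, Real.rpow_add hx, Real.rpow_one, Real.rpow_def_of_pos hx, ← hLdef,
      mul_inv_cancel₀ hL0.ne']
  have hσL : (σ - 1) * L = 1 := by
    rw [hσdef]; field_simp; ring
  rw [hxσ, hσL] at hmain
  set E := ∫ t : ℝ, modelError z δ G ((σ : ℂ) + t * I) * cexp (t * I * L) with hE
  have hexp : Real.exp 1 * Real.exp (-1) = 1 := by rw [← Real.exp_add]; simp
  have hdiff : (((rieszSum a ((1 + δ) * x) - rieszSum a x) / (δ * x) : ℝ) : ℂ) -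
        x * (L ^ (z - 1) : ℝ) * G 1 / Complex.Gamma z =
      (x * Real.exp 1 * (1 / (2 * Real.pi)) : ℝ) * E +
      G 1 * ((x * L ^ (z - 1) * (Real.Gamma z)⁻¹ *
        ((1 + δ / 2) * (1 - Real.exp (-L)) ^ 2 - 1) : ℝ) : ℂ) := by
    rw [hmain, Complex.Gamma_ofReal]
    have hexpc : (Real.exp 1 : ℂ) * (Real.exp (-1) : ℂ) = 1 := by exact_mod_cast hexp
    push_cast at hexpc ⊢
    linear_combination (G 1 * (x * (L ^ (z - 1) : ℝ) * (Real.Gamma z : ℂ)⁻¹ *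
        ((1 + δ / 2) * (1 - cexp (-L)) ^ 2))) * hexpc
  rw [hdiff]
  have b1 : ‖((x * Real.exp 1 * (1 / (2 * Real.pi)) : ℝ) : ℂ) * E‖ ≤
      Real.exp 1 * K₁ * x * M / c₀ ^ 3 * L ^ (z - 2) := by
    have hpi : 1 / (2 * Real.pi) ≤ 1 := by
      rw [div_le_one (by positivity)]; linarith [Real.pi_gt_three]
    rw [norm_mul, norm_real, Real.norm_eq_abs, abs_of_pos (by positivity)]
    calc _ ≤ x * Real.exp 1 * 1 * (K₁ * M / c₀ ^ 3 * L ^ (z - 2)) := by gcongr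
      _ = _ := by ring
  have hLz : L ^ (z - 1) * L⁻¹ = L ^ (z - 2) := by
    rw [← Real.rpow_neg_one, ← Real.rpow_add hL0]; congr 1; ring
  have b2 : ‖G 1 * ((x * L ^ (z - 1) * (Real.Gamma z)⁻¹ *
        ((1 + δ / 2) * (1 - Real.exp (-L)) ^ 2 - 1) : ℝ) : ℂ)‖ ≤
      3 * K₂ * x * M / c₀ ^ 3 * L ^ (z - 2) := by
    have hc3 : 1 ≤ 1 / c₀ ^ 3 := by
      rw [le_div_iff₀ (by positivity), one_mul]
      exact pow_le_one₀ hw0.le (by linarith)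
    rw [norm_mul, norm_real, Real.norm_eq_abs, abs_mul, abs_mul,
      abs_of_pos (by positivity : 0 < x * L ^ (z - 1))]
    calc _ ≤ M * (x * L ^ (z - 1) * K₂ * (3 * L⁻¹)) := by
          gcongr
          · exact hG.norm_one_le
          · exact h₂ z hz hz1
          · exact abs_one_add_mul_sq_sub_one_le (by linarith) hδ
      _ = 3 * K₂ * x * M * 1 * (L ^ (z - 1) * L⁻¹) := by ring
      _ ≤ 3 * K₂ * x * M * (1 / c₀ ^ 3) * (L ^ (z - 1) * L⁻¹) := by gcongr
      _ = _ := by rw [hLz]; ring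
  refine (norm_add_le _ _).trans ((add_le_add b1 b2).trans (le_of_eq ?_))
  ring

/-- A real number squeezed between two real approximations of `c`. -/
lemma norm_ofReal_sub_le_of_mem_Icc {A l u e : ℝ} {c : ℂ} (hlA : l ≤ A) (hAu : A ≤ u)
    (hl : ‖(l : ℂ) - c‖ ≤ e) (hu : ‖(u : ℂ) - c‖ ≤ e) : ‖(A : ℂ) - c‖ ≤ 2 * e := by
  have r1 := abs_le.1 ((abs_re_le_norm _).trans hl)
  have r2 := abs_le.1 ((abs_re_le_norm _).trans hu)
  have i1 := (abs_im_le_norm _).trans hl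
  simp only [sub_re, ofReal_re, sub_im, ofReal_im] at r1 r2 i1
  have h := norm_le_abs_re_add_abs_im ((A : ℂ) - c)
  simp only [sub_re, ofReal_re, sub_im, ofReal_im] at h
  have : |A - c.re| ≤ e := abs_le.2 ⟨by linarith [r1.1], by linarith [r2.2]⟩
  linarith

/-- Asymptotics of the partial sums for a real exponent in `[0, 1]`. -/
lemma norm_sum_sub_le : ∃ K : ℝ, 0 < K ∧ ∀ (z c₀ M : ℝ) (G : ℂ → ℂ) (a : ℕ → ℝ),
    IsModerate z c₀ M G → (∀ n, 0 ≤ a n) →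
    (∀ s : ℂ, 1 < s.re → Summable fun n : ℕ => ‖(a (n + 1) : ℂ) / ((n + 1 : ℕ) : ℂ) ^ s‖) →
    (∀ s : ℂ, 1 < s.re → G s = DSeries (fun n => (a n : ℂ)) s * cexp (-z * logZeta s)) →
    ∀ x : ℝ, 0 < x → 16 / c₀ ≤ Real.log x →
      ‖((∑ n ∈ Finset.Icc 1 ⌊x⌋₊, a n : ℝ) : ℂ) -
        x * (Real.log x ^ (z - 1) : ℝ) * G 1 / Complex.Gamma z‖ ≤
        K * x * M / c₀ ^ 3 * Real.log x ^ (z - 2) := by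
  obtain ⟨K, hK, h⟩ := norm_rieszSum_sub_div_sub_le
  refine ⟨2 * K, by positivity, ?_⟩
  intro z c₀ M G a hG ha hsum hGF x hx hL
  have hL0 : 0 < Real.log x := lt_of_lt_of_le (by have := hG.width_pos; positivity) hL
  set d := (Real.log x)⁻¹ with hd
  have hd0 : 0 < d := by positivity
  have h1 := h z c₀ M G a hG hsum hGF x hx hL d (abs_of_pos hd0)
  have h2 := h z c₀ M G a hG hsum hGF x hx hL (-d) (by rw [abs_neg, abs_of_pos hd0])
  have c1 := sub_mul_sum_le_rieszSum_sub ha hx.le ((1 + d) * x)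
  have c2 := sub_mul_sum_le_rieszSum_sub ha hx.le ((1 + -d) * x)
  have hu : ∑ n ∈ Finset.Icc 1 ⌊x⌋₊, a n ≤
      (rieszSum a ((1 + d) * x) - rieszSum a x) / (d * x) := by
    rw [le_div_iff₀ (by positivity)]
    linarith
  have hl : (rieszSum a ((1 + -d) * x) - rieszSum a x) / (-d * x) ≤
      ∑ n ∈ Finset.Icc 1 ⌊x⌋₊, a n := by
    rw [div_le_iff_of_neg (by nlinarith)]
    linarith
  refine (norm_ofReal_sub_le_of_mem_Icc hl hu h2 h1).trans (le_of_eq ?_)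
  ring

/-- If all coefficients vanish, so does the value at `1` of the continuation. -/
lemma continuation_one_eq_zero {a : ℕ → ℝ} (ha : ∀ n, a (n + 1) = 0) {z : ℂ} {G : ℂ → ℂ}
    (hG : ContinuousAt G 1)
    (hGF : ∀ s : ℂ, 1 < s.re → G s = DSeries (fun n => (a n : ℂ)) s * cexp (-z * logZeta s)) :
    G 1 = 0 := by
  have hu : Tendsto (fun ε : ℝ => ((1 + ε : ℝ) : ℂ)) (𝓝[>] 0) (𝓝 1) := by
    have : Continuous fun ε : ℝ => ((1 + ε : ℝ) : ℂ) := by fun_prop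
    simpa using (this.tendsto 0).mono_left nhdsWithin_le_nhds
  refine tendsto_nhds_unique (hG.tendsto.comp hu) (tendsto_const_nhds.congr' ?_)
  filter_upwards [self_mem_nhdsWithin] with ε hε
  have hε' : 0 < ε := hε
  rw [Function.comp_apply, hGF _ (by simpa using hε')]
  simp [DSeries, ha]

end

theorem stmt19 : ∃ C : ℝ, 0 < C ∧
    ∀ (z : ℂ) (c₀ M : ℝ) (a : ℕ → ℝ),
      ‖z‖ ≤ 1 → 0 < c₀ → c₀ ≤ 2 / 11 → 0 < M → (∀ n : ℕ, 0 ≤ a n) →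
      HasPropertyP (fun n => (a n : ℂ)) z c₀ (1 / 2) M →
      ∀ (Gext : ℂ → ℂ) (U : Set ℂ),
        IsPContinuation (fun n => (a n : ℂ)) z c₀ (1 / 2) M Gext U →
      ∀ x : ℝ, Real.exp (16 / c₀) ≤ x →
        ‖(∑ n ∈ Finset.Icc 1 ⌊x⌋₊, (a n : ℂ)) -
            (x : ℂ) * Complex.exp ((z - 1) * (Real.log (Real.log x) : ℂ)) *
              Gext 1 / Complex.Gamma z‖ ≤
          C * x * Real.log x ^ (z.re - 1) * M *
            (c₀ ^ (-(3 : ℝ)) *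
              (Real.exp (-(1 / 9) * Real.sqrt (c₀ * Real.log x)) + (Real.log x)⁻¹)) := by
  obtain ⟨K, hK, h⟩ := norm_sum_sub_le
  refine ⟨K, hK, ?_⟩
  intro z c₀ M a hz hc0 hc1 hM ha hP G U hG x hx
  obtain ⟨hsum, -⟩ := hP
  obtain ⟨-, hsub, han, hGF, hbound⟩ := hG
  have hx0 : 0 < x := (Real.exp_pos _).trans_le hx
  have hL : 16 / c₀ ≤ Real.log x := (Real.le_log_iff_exp_le hx0).2 hx
  have hL0 : 0 < Real.log x := lt_of_lt_of_le (by positivity) hL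
  have h1mem : (1 : ℂ) ∈ sdRegion c₀ :=
    mem_sdRegion_of_abs_im_le_one (by simp) (by simp [hc0.le])
  by_cases hzero : ∀ n, a (n + 1) = 0
  · have hG1 := continuation_one_eq_zero hzero (han 1 (hsub h1mem)).continuousAt hGF
    have hs0 : ∑ n ∈ Finset.Icc 1 ⌊x⌋₊, (a n : ℂ) = 0 := by
      refine Finset.sum_eq_zero fun n hn => ?_
      obtain ⟨m, rfl⟩ := Nat.exists_eq_add_of_le' (Finset.mem_Icc.1 hn).1
      simp [hzero m]
    rw [hs0, hG1]
    simp only [mul_zero, zero_div, sub_zero, norm_zero]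
    positivity
  · push Not at hzero
    obtain ⟨N, hN⟩ := hzero
    obtain ⟨hzre, hzim⟩ := exponent_nonneg ha hsum hN (han 1 (hsub h1mem)) hGF
    have hz1 : z.re ≤ 1 := (Complex.re_le_norm z).trans hz
    obtain ⟨y, rfl⟩ : ∃ y : ℝ, (y : ℂ) = z := ⟨z.re, Complex.ext (by simp) (by simp [hzim])⟩
    simp only [Complex.ofReal_re] at hzre hz1 ⊢
    have hmod : IsModerate y c₀ M G :=
      ⟨hzre, hz1, hc0, hc1, hM, fun s hs => (han s (hsub hs)).differentiableAt, fun s hs => by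
        have := hbound s hs
        norm_num at this ⊢
        exact this⟩
    have hfin := h y c₀ M G a hmod ha hsum hGF x hx0 hL
    have e1 : Complex.exp (((y : ℂ) - 1) * (Real.log (Real.log x) : ℂ)) =
        (Real.log x ^ (y - 1) : ℝ) := by
      rw [Real.rpow_def_of_pos hL0, Complex.ofReal_exp]
      congr 1
      push_cast
      ring
    rw [e1]
    push_cast at hfin ⊢
    refine hfin.trans ?_
    have e2 : Real.log x ^ (y - 2) = Real.log x ^ (y - 1) * (Real.log x)⁻¹ := by
      rw [← Real.rpow_neg_one, ← Real.rpow_add hL0]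
      congr 1
      ring
    have e3 : c₀ ^ (-(3 : ℝ)) = 1 / c₀ ^ 3 := by
      rw [Real.rpow_neg hc0.le, one_div]
      norm_cast
    rw [e2, e3]
    calc K * x * M / c₀ ^ 3 * (Real.log x ^ (y - 1) * (Real.log x)⁻¹)
        = K * x * Real.log x ^ (y - 1) * M * (1 / c₀ ^ 3 * (0 + (Real.log x)⁻¹)) := by ring
      _ ≤ _ := by gcongr; exact (Real.exp_pos _).le
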